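/- Suppose the Fractional assumptions hold and b ∈ L¹_loc(ℝⁿ). Then the following are equivalent: (1) b ∈ BMO(ℝⁿ) and b⁻ ∈ L^∞(ℝⁿ); (2) the commutator [M_α, b] : L^φ(ℝⁿ) → L^ψ(ℝⁿ) is bounded; (3) sup_Q ‖(b − M_Q b)·χ_Q‖_{L^ψ(ℝⁿ)} / ‖χ_Q‖_{L^ψ(ℝⁿ)} < ∞, the supremum taken over all cubes Q ⊂ ℝⁿ. -/

import Mathlib

open MeasureTheory NNReal ENNReal Filter Set

noncomputable section

/-- `ℝⁿ` with the Euclidean structure. -/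
abbrev RSp (n : ℕ) := EuclideanSpace ℝ (Fin n)

variable {n : ℕ}

/-- A cube in `ℝⁿ` with sides parallel to the coordinate axes,
with center `c` and side length `2r`. -/
structure Cube (n : ℕ) where
  c : RSp n
  r : ℝ
  r_pos : 0 < r

/-- The underlying set of a cube. -/
def Cube.set (Q : Cube n) : Set (RSp n) := {y | ∀ i, |y i - Q.c i| ≤ Q.r}

/-- A weak Φ-function on `Ω` (the class `Φ_w(Ω)`). -/
structure IsWeakPhi (Ω : Set (RSp n)) (φ : RSp n → ℝ≥0 → ℝ≥0∞) : Prop where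
  meas : ∀ f : RSp n → ℝ≥0, Measurable f →
    AEMeasurable (fun x => φ x (f x)) (volume.restrict Ω)
  mono : ∀ x ∈ Ω, Monotone (φ x)
  zero : ∀ x ∈ Ω, φ x 0 = 0
  lim_zero : ∀ x ∈ Ω, Tendsto (fun t : ℝ≥0 => φ x t) (nhdsWithin 0 (Set.Ioi 0)) (nhds 0)
  lim_top : ∀ x ∈ Ω, Tendsto (fun t : ℝ≥0 => φ x t) atTop (nhds ∞)
  almost_inc : ∃ L : ℝ≥0, 1 ≤ L ∧ ∀ x ∈ Ω, ∀ s t : ℝ≥0, 0 < s → s < t →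
    φ x s / (s : ℝ≥0∞) ≤ (L : ℝ≥0∞) * (φ x t / (t : ℝ≥0∞))

/-- A convex Φ-function on `Ω` (the class `Φ_c(Ω)`): a weak Φ-function which is
additionally convex and left-continuous in `t` for a.e. `x ∈ Ω`. -/
structure IsConvexPhi (Ω : Set (RSp n)) (φ : RSp n → ℝ≥0 → ℝ≥0∞)
    extends IsWeakPhi Ω φ : Prop where
  convex : ∀ᵐ x ∂(volume.restrict Ω), ∀ s t a b : ℝ≥0, a + b = 1 →
    φ x (a * s + b * t) ≤ (a : ℝ≥0∞) * φ x s + (b : ℝ≥0∞) * φ x t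
  left_cont : ∀ᵐ x ∂(volume.restrict Ω), ∀ t : ℝ≥0,
    Tendsto (φ x) (nhdsWithin t (Set.Iio t)) (nhds (φ x t))

/-- A strong Φ-function on `Ω` (the class `Φ_s(Ω)`): a weak Φ-function which is
additionally convex and continuous into `[0,∞]` for a.e. `x ∈ Ω`. -/
structure IsStrongPhi (Ω : Set (RSp n)) (φ : RSp n → ℝ≥0 → ℝ≥0∞)
    extends IsWeakPhi Ω φ : Prop where
  convex : ∀ᵐ x ∂(volume.restrict Ω), ∀ s t a b : ℝ≥0, a + b = 1 →
    φ x (a * s + b * t) ≤ (a : ℝ≥0∞) * φ x s + (b : ℝ≥0∞) * φ x t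
  cont : ∀ᵐ x ∂(volume.restrict Ω), Continuous (φ x)

/-- The generalized (left-)inverse `φ⁻¹(x,t) = inf {τ ≥ 0 : φ(x,τ) ≥ t}`. -/
def phiInv (φ : RSp n → ℝ≥0 → ℝ≥0∞) (x : RSp n) (t : ℝ≥0∞) : ℝ≥0∞ :=
  sInf ((fun s : ℝ≥0 => (s : ℝ≥0∞)) '' {s : ℝ≥0 | t ≤ φ x s})

/-- The condition `(aInc)_p` on `Ω`: `t ↦ φ(x,t)/t^p` is almost increasing, uniformly in `x`. -/
def AInc (p : ℝ) (Ω : Set (RSp n)) (φ : RSp n → ℝ≥0 → ℝ≥0∞) : Prop :=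
  ∃ L : ℝ≥0, 1 ≤ L ∧ ∀ x ∈ Ω, ∀ s t : ℝ≥0, 0 < s → s < t →
    φ x s / (s : ℝ≥0∞) ^ p ≤ (L : ℝ≥0∞) * (φ x t / (t : ℝ≥0∞) ^ p)

/-- The condition `(aDec)_q` on `Ω`: `t ↦ φ(x,t)/t^q` is almost decreasing, uniformly in `x`. -/
def ADec (q : ℝ) (Ω : Set (RSp n)) (φ : RSp n → ℝ≥0 → ℝ≥0∞) : Prop :=
  ∃ L : ℝ≥0, 1 ≤ L ∧ ∀ x ∈ Ω, ∀ s t : ℝ≥0, 0 < s → s < t →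
    φ x t / (t : ℝ≥0∞) ^ q ≤ (L : ℝ≥0∞) * (φ x s / (s : ℝ≥0∞) ^ q)

/-- The condition `(A0)` on `Ω`: `β ≤ φ⁻¹(x,1) ≤ 1/β` for a.e. `x ∈ Ω`. -/
def A0 (Ω : Set (RSp n)) (φ : RSp n → ℝ≥0 → ℝ≥0∞) : Prop :=
  ∃ β : ℝ≥0, 0 < β ∧ β ≤ 1 ∧ ∀ᵐ x ∂(volume.restrict Ω),
    (β : ℝ≥0∞) ≤ phiInv φ x 1 ∧ phiInv φ x 1 ≤ (β : ℝ≥0∞)⁻¹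

/-- The condition `(A1)` (on all of `ℝⁿ`). -/
def A1 (φ : RSp n → ℝ≥0 → ℝ≥0∞) : Prop :=
  ∃ β : ℝ≥0, 0 < β ∧ β < 1 ∧ ∀ Q : Cube n, volume Q.set ≤ 1 →
    ∀ᵐ x ∂(volume.restrict Q.set), ∀ᵐ y ∂(volume.restrict Q.set),
      ∀ t : ℝ≥0∞, 1 ≤ t → t ≤ (volume Q.set)⁻¹ →
        (β : ℝ≥0∞) * phiInv φ x t ≤ phiInv φ y t

/-- The condition `(A2)` (on all of `ℝⁿ`). -/
def A2 (φ : RSp n → ℝ≥0 → ℝ≥0∞) : Prop :=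
  ∃ φi : ℝ≥0 → ℝ≥0∞, IsWeakPhi Set.univ (fun _ : RSp n => φi) ∧
  ∃ h : RSp n → ℝ≥0∞, (∫⁻ x, h x) < ∞ ∧ (∃ M : ℝ≥0, ∀ᵐ x ∂(volume : Measure (RSp n)), h x ≤ M) ∧
  ∃ β : ℝ≥0, 0 < β ∧ β ≤ 1 ∧ ∃ s : ℝ≥0, 0 < s ∧
    ∀ᵐ x ∂(volume : Measure (RSp n)), ∀ t : ℝ≥0,
      (φi t ≤ (s : ℝ≥0∞) → φ x (β * t) ≤ φi t + h x) ∧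
      (φ x t ≤ (s : ℝ≥0∞) → φi (β * t) ≤ φ x t + h x)

/-- Membership in the generalized Orlicz space `L^φ(Ω)`. -/
def MemOrlicz (φ : RSp n → ℝ≥0 → ℝ≥0∞) (Ω : Set (RSp n)) (f : RSp n → ℝ) : Prop :=
  AEMeasurable f (volume.restrict Ω) ∧
  ∃ lam : ℝ≥0, 0 < lam ∧ (∫⁻ x in Ω, φ x (lam * ‖f x‖₊) ∂volume) < ∞

/-- The Luxemburg (quasi)norm of `L^φ(Ω)`. -/
def orliczNorm (φ : RSp n → ℝ≥0 → ℝ≥0∞) (Ω : Set (RSp n)) (f : RSp n → ℝ) : ℝ≥0∞ :=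
  sInf ((fun lam : ℝ≥0 => (lam : ℝ≥0∞)) ''
    {lam : ℝ≥0 | 0 < lam ∧ (∫⁻ x in Ω, φ x (‖f x‖₊ / lam) ∂volume) ≤ 1})

/-- The canonical extension of `φ(x,·)` to `[0,∞]`. -/
def phiE (φ : RSp n → ℝ≥0 → ℝ≥0∞) (x : RSp n) (t : ℝ≥0∞) : ℝ≥0∞ :=
  ⨆ (s : ℝ≥0) (_ : (s : ℝ≥0∞) ≤ t), φ x s

/-- The Luxemburg (quasi)norm for `[0,∞]`-valued functions. -/
def orliczNormE (φ : RSp n → ℝ≥0 → ℝ≥0∞) (Ω : Set (RSp n)) (g : RSp n → ℝ≥0∞) : ℝ≥0∞ :=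
  sInf ((fun lam : ℝ≥0 => (lam : ℝ≥0∞)) ''
    {lam : ℝ≥0 | 0 < lam ∧ (∫⁻ x in Ω, phiE φ x (g x / (lam : ℝ≥0∞)) ∂volume) ≤ 1})

/-- The average `b_Q` of `b` over the cube `Q`. -/
def cubeAvg (Q : Cube n) (b : RSp n → ℝ) : ℝ := ⨍ x in Q.set, b x

/-- The BMO seminorm `‖b‖_*`. -/
def bmoNorm (b : RSp n → ℝ) : ℝ≥0∞ :=
  ⨆ Q : Cube n, (volume Q.set)⁻¹ * ∫⁻ x in Q.set, ‖b x - cubeAvg Q b‖₊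

/-- `b ∈ BMO(ℝⁿ)`. -/
def IsBMO (b : RSp n → ℝ) : Prop := LocallyIntegrable b volume ∧ bmoNorm b < ∞

/-- The non-centred Hardy–Littlewood maximal function (over axes-parallel cubes). -/
def maximal (f : RSp n → ℝ) (x : RSp n) : ℝ≥0∞ :=
  ⨆ (Q : Cube n) (_ : x ∈ Q.set), (volume Q.set)⁻¹ * ∫⁻ y in Q.set, (‖f y‖₊ : ℝ≥0∞) ∂volume

/-- The fractional maximal function `M_α`. -/
def fracMaximal (α : ℝ) (f : RSp n → ℝ) (x : RSp n) : ℝ≥0∞ :=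
  ⨆ (Q : Cube n) (_ : x ∈ Q.set),
    volume Q.set ^ (α / (n : ℝ) - 1) * ∫⁻ y in Q.set, (‖f y‖₊ : ℝ≥0∞) ∂volume

/-- The maximal function restricted to subcubes of `Q₀`. -/
def restMaximal (Q₀ : Cube n) (f : RSp n → ℝ) (x : RSp n) : ℝ≥0∞ :=
  ⨆ (Q : Cube n) (_ : x ∈ Q.set) (_ : Q.set ⊆ Q₀.set),
    (volume Q.set)⁻¹ * ∫⁻ y in Q.set, (‖f y‖₊ : ℝ≥0∞) ∂volume

/-- The fractional maximal function restricted to subcubes of `Q₀`. -/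
def restFracMaximal (α : ℝ) (Q₀ : Cube n) (f : RSp n → ℝ) (x : RSp n) : ℝ≥0∞ :=
  ⨆ (Q : Cube n) (_ : x ∈ Q.set) (_ : Q.set ⊆ Q₀.set),
    volume Q.set ^ (α / (n : ℝ) - 1) * ∫⁻ y in Q.set, (‖f y‖₊ : ℝ≥0∞) ∂volume

/-- The sharp maximal function `M♯`. -/
def sharpMaximal (f : RSp n → ℝ) (x : RSp n) : ℝ≥0∞ :=
  ⨆ (Q : Cube n) (_ : x ∈ Q.set),
    (volume Q.set)⁻¹ * ∫⁻ y in Q.set, (‖f y - ⨍ z in Q.set, f z‖₊ : ℝ≥0∞) ∂volume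

/-- The maximal commutator `M_b`. -/
def maximalComm (b f : RSp n → ℝ) (x : RSp n) : ℝ≥0∞ :=
  ⨆ (Q : Cube n) (_ : x ∈ Q.set),
    (volume Q.set)⁻¹ * ∫⁻ y in Q.set, (‖b x - b y‖₊ : ℝ≥0∞) * (‖f y‖₊ : ℝ≥0∞) ∂volume

/-- The fractional maximal commutator `M_{b,α}`. -/
def fracMaximalComm (α : ℝ) (b f : RSp n → ℝ) (x : RSp n) : ℝ≥0∞ :=
  ⨆ (Q : Cube n) (_ : x ∈ Q.set),
    volume Q.set ^ (α / (n : ℝ) - 1) *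
      ∫⁻ y in Q.set, (‖b x - b y‖₊ : ℝ≥0∞) * (‖f y‖₊ : ℝ≥0∞) ∂volume

/-- The commutator `[M,b]f = M(bf) − b·Mf` of the maximal operator. -/
def maximalCommutator (b f : RSp n → ℝ) (x : RSp n) : ℝ :=
  (maximal (fun y => b y * f y) x).toReal - b x * (maximal f x).toReal

/-- The commutator `[M_α,b]f = M_α(bf) − b·M_α f` of the fractional maximal operator. -/
def fracMaximalCommutator (α : ℝ) (b f : RSp n → ℝ) (x : RSp n) : ℝ :=
  (fracMaximal α (fun y => b y * f y) x).toReal - b x * (fracMaximal α f x).toReal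

/-- The Riesz potential `I_α f`. -/
def riesz (α : ℝ) (f : RSp n → ℝ) (x : RSp n) : ℝ :=
  ∫ y, f y / dist x y ^ ((n : ℝ) - α)

/-- The commutator `[I_α, b]f = I_α(bf) − b·I_α f` of the Riesz potential. -/
def rieszCommutator (α : ℝ) (b f : RSp n → ℝ) (x : RSp n) : ℝ :=
  riesz α (fun y => b y * f y) x - b x * riesz α f x

/-- The operator `I_{b,α} f(x) = ∫ |b(x)−b(y)|·|x−y|^{α−n} f(y) dy`. -/
def rieszAbs (α : ℝ) (b f : RSp n → ℝ) (x : RSp n) : ℝ :=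
  ∫ y, |b x - b y| / dist x y ^ ((n : ℝ) - α) * f y

/-- Equivalence `φ ≃ ψ` of Φ-functions. -/
def PhiEquiv (φ ψ : RSp n → ℝ≥0 → ℝ≥0∞) : Prop :=
  ∃ L : ℝ≥0, 1 ≤ L ∧ ∀ x : RSp n, ∀ t : ℝ≥0, ψ x (t / L) ≤ φ x t ∧ φ x t ≤ ψ x (L * t)

/-- Weak equivalence `φ ∼ ψ` of Φ-functions. -/
def PhiWeakEquiv (φ ψ : RSp n → ℝ≥0 → ℝ≥0∞) : Prop :=
  ∃ L : ℝ≥0, 1 ≤ L ∧ ∃ h : RSp n → ℝ≥0∞, (∫⁻ x, h x) < ∞ ∧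
    ∀ᵐ x ∂(volume : Measure (RSp n)), ∀ t : ℝ≥0,
      ψ x t ≤ φ x (L * t) + h x ∧ φ x t ≤ ψ x (L * t) + h x

/-- The relation `φ⁻¹(x,t) ≈ t^{α/n}·ψ⁻¹(x,t)` with constants independent of `x` and `t > 0`. -/
def FracInvRel (α : ℝ) (φ ψ : RSp n → ℝ≥0 → ℝ≥0∞) : Prop :=
  ∃ c₁ c₂ : ℝ≥0, 0 < c₁ ∧ ∀ x : RSp n, ∀ t : ℝ≥0, 0 < t →
    (c₁ : ℝ≥0∞) * ((t : ℝ≥0∞) ^ (α / (n : ℝ)) * phiInv ψ x t) ≤ phiInv φ x t ∧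
    phiInv φ x t ≤ (c₂ : ℝ≥0∞) * ((t : ℝ≥0∞) ^ (α / (n : ℝ)) * phiInv ψ x t)

/-- The characteristic function of a cube, as a real-valued function. -/
def cubeIndicator (Q : Cube n) : RSp n → ℝ := Q.set.indicator 1

end

/-- The function `(b − M_Q b)·χ_Q`. -/
noncomputable def commTestFn0 {n : ℕ} (Q : Cube n) (b : RSp n → ℝ) : RSp n → ℝ :=
  Q.set.indicator fun z => b z - (restMaximal Q b z).toReal

/-- An abstract dyadic system. -/
structure DS {X : Type*} [MeasurableSpace X] (μ : Measure X) (ι : Type*) where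
  c : ℤ → X → ι
  V : ℤ → ℝ≥0∞
  D : ℝ≥0∞
  meas : ∀ k m, MeasurableSet {y | c k y = m}
  nest : ∀ k x y, c (k + 1) x = c (k + 1) y → c k x = c k y
  vol : ∀ k x, μ {y | c k y = c k x} = V k
  Vpos : ∀ k, V k ≠ 0
  Vtop : ∀ k, V k ≠ ∞
  Dtop : D ≠ ∞
  dbl : ∀ k, V k = D * V (k + 1)

set_option linter.unusedSectionVars false

namespace DS

variable {X : Type*} [MeasurableSpace X] {μ : Measure X} {ι : Type*} [Countable ι]
variable (S : DS μ ι)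

/-- The cell of generation `k` containing `x`. -/
def Q (k : ℤ) (x : X) : Set X := {y | S.c k y = S.c k x}

/-- Averages over cells. -/
noncomputable def E (k : ℤ) (g : X → ℝ≥0∞) (x : X) : ℝ≥0∞ :=
  (S.V k)⁻¹ * ∫⁻ y in S.Q k x, g y ∂μ

/-- Constant on cells of generation `k`. -/
def Lev {β : Type*} (k : ℤ) (f : X → β) : Prop := ∀ x y, S.c k x = S.c k y → f x = f y

lemma measQ (k x) : MeasurableSet (S.Q k x) := S.meas k _

lemma volQ (k x) : μ (S.Q k x) = S.V k := S.vol k x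

lemma nest_le {k l : ℤ} (h : k ≤ l) {x y : X} (hxy : S.c l x = S.c l y) : S.c k x = S.c k y := by
  obtain ⟨m, rfl⟩ := Int.exists_add_of_le h
  induction m with
  | zero => simpa using hxy
  | succ m ih =>
    apply ih (by omega)
    apply S.nest
    convert hxy using 2 <;> push_cast <;> ring

lemma Lev.mono {β : Type*} {k l : ℤ} (h : k ≤ l) {f : X → β} (hf : S.Lev k f) : S.Lev l f :=
  fun x y hxy => hf x y (S.nest_le h hxy)

lemma lev_Q (k : ℤ) : S.Lev k (S.Q k) := by
  intro x y h
  simp [Q, h]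

lemma lev_E (k : ℤ) (g : X → ℝ≥0∞) : S.Lev k (S.E k g) := by
  intro x y h
  simp [E, S.lev_Q k x y h]

lemma E_mono (k : ℤ) {f g : X → ℝ≥0∞} (h : ∀ᵐ x ∂μ, f x ≤ g x) (x) : S.E k f x ≤ S.E k g x := by
  unfold E
  gcongr 1
  exact lintegral_mono_ae (ae_restrict_of_ae h)

lemma E_const (k : ℤ) (a : ℝ≥0∞) (x) : S.E k (fun _ => a) x = a := by
  unfold E
  rw [setLIntegral_const, volQ, mul_comm a, ← mul_assoc, ENNReal.inv_mul_cancel (S.Vpos k) (S.Vtop k),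
    one_mul]

lemma E_add (k : ℤ) {f g : X → ℝ≥0∞} (hf : AEMeasurable f μ) (x) :
    S.E k (fun y => f y + g y) x = S.E k f x + S.E k g x := by
  unfold E
  rw [lintegral_add_left' hf.restrict, mul_add]

/-- Pulling out a function constant on cells. -/
lemma E_pull (k : ℤ) {φ g : X → ℝ≥0∞} (hφ : S.Lev k φ) (hg : AEMeasurable g μ) (x) :
    S.E k (fun y => φ y * g y) x = φ x * S.E k g x := by
  unfold E
  rw [setLIntegral_congr_fun (S.measQ k x) (g := fun y => φ x * g y)
    (fun y hy => by simp only [hφ y x hy]), lintegral_const_mul'' _ hg.restrict]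
  ring

lemma Lev.measurable {β : Type*} [MeasurableSpace β] {k : ℤ} {f : X → β} (hf : S.Lev k f) :
    Measurable f := by
  intro s _
  have : f ⁻¹' s = ⋃ m : {m : ι // ∃ x, S.c k x = m ∧ f x ∈ s}, {y | S.c k y = m.1} := by
    ext y
    simp only [mem_preimage, mem_iUnion]
    constructor
    · intro h
      exact ⟨⟨S.c k y, y, rfl, h⟩, rfl⟩
    · rintro ⟨⟨m, x, hx, hs⟩, hy⟩
      rw [hf y x]
      · exact hs
      · rw [hx]; exact hy
  rw [this]
  exact MeasurableSet.iUnion fun m => S.meas k _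

lemma lintegral_cells (k : ℤ) (g : X → ℝ≥0∞) :
    ∫⁻ x, g x ∂μ = ∑' m : ι, ∫⁻ x in {y | S.c k y = m}, g x ∂μ := by
  rw [← lintegral_iUnion (fun m => S.meas k m)]
  · have : (⋃ m, {y | S.c k y = m}) = univ := by
      ext y; simp
    rw [this, Measure.restrict_univ]
  · intro a b hab
    rw [Function.onFun, Set.disjoint_left]
    intro y hy hy'
    exact hab (hy.symm.trans hy')

/-- The fundamental identity of conditional expectations. -/
lemma lintegral_E (k : ℤ) {φ g : X → ℝ≥0∞} (hφ : S.Lev k φ) (hg : AEMeasurable g μ) :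
    ∫⁻ x, φ x * S.E k g x ∂μ = ∫⁻ x, φ x * g x ∂μ := by
  rw [S.lintegral_cells k, S.lintegral_cells k]
  congr 1
  ext m
  by_cases hm : ∃ x, S.c k x = m
  · obtain ⟨x, rfl⟩ := hm
    have hQ : {y | S.c k y = S.c k x} = S.Q k x := rfl
    rw [hQ]
    have e1 : ∫⁻ y in S.Q k x, φ y * S.E k g y ∂μ = φ x * S.E k g x * S.V k := by
      rw [setLIntegral_congr_fun (S.measQ k x) (g := fun y => φ x * S.E k g x)
        (fun y hy => by simp only [hφ y x hy, S.lev_E k g y x hy]), setLIntegral_const, volQ]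
    have e2 : ∫⁻ y in S.Q k x, φ y * g y ∂μ = φ x * ∫⁻ y in S.Q k x, g y ∂μ := by
      rw [setLIntegral_congr_fun (S.measQ k x) (g := fun y => φ x * g y)
        (fun y hy => by simp only [hφ y x hy]), lintegral_const_mul'' _ hg.restrict]
    rw [e1, e2]
    unfold E
    rw [mul_comm (S.V k)⁻¹, mul_assoc, mul_assoc, ENNReal.inv_mul_cancel (S.Vpos k) (S.Vtop k),
      mul_one]
  · have : {y | S.c k y = m} = ∅ := by
      ext y; simp; intro h; exact hm ⟨y, h⟩
    simp [this]

lemma setLIntegral_E (k : ℤ) {A : Set X} {g : X → ℝ≥0∞} (hA : S.Lev k (fun x => x ∈ A))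
    (hg : AEMeasurable g μ) : ∫⁻ x in A, S.E k g x ∂μ = ∫⁻ x in A, g x ∂μ := by
  have hm : MeasurableSet A := by
    have := Lev.measurable S hA
    exact measurableSet_setOfPred.mpr this
  have h := S.lintegral_E k (φ := A.indicator 1) (g := g) (fun x y hxy => by
    have := hA x y hxy
    simp only [eq_iff_iff] at this
    by_cases hx : x ∈ A
    · simp [hx, this.1 hx]
    · have hy : y ∉ A := fun h => hx (this.2 h)
      simp [hx, hy]) hg
  rw [← lintegral_indicator hm, ← lintegral_indicator hm]
  convert h using 2 <;> ext x <;> by_cases hx : x ∈ A <;> simp [hx]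

/-- Tower property. -/
lemma E_tower {l k : ℤ} (hlk : l ≤ k) {φ g : X → ℝ≥0∞} (hφ : S.Lev k φ) (hg : AEMeasurable g μ)
    (x) : S.E l (fun y => φ y * S.E k g y) x = S.E l (fun y => φ y * g y) x := by
  unfold E
  congr 1
  rw [← lintegral_indicator (S.measQ l x), ← lintegral_indicator (S.measQ l x)]
  have h := S.lintegral_E k (φ := (S.Q l x).indicator φ) (g := g) (fun y z hyz => by
    have h1 := S.nest_le hlk hyz
    have h2 := hφ y z hyz
    by_cases hy : S.c l y = S.c l x
    · rw [indicator_of_mem (by exact hy), indicator_of_mem (by exact h1.symm.trans hy), h2]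
    · rw [indicator_of_notMem (by exact hy),
        indicator_of_notMem (by exact fun h => hy (h1.trans h))]) hg
  convert h using 2
  · ext y
    by_cases hy : y ∈ S.Q l x <;> simp [hy, E]
  · ext y
    by_cases hy : y ∈ S.Q l x <;> simp [hy]

/-- Stopping sets. -/
def St (P : ℤ → X → Prop) (k0 k : ℤ) : Set X :=
  {x | k0 ≤ k ∧ P k x ∧ ∀ j, k0 ≤ j → j < k → ¬ P j x}

lemma lev_St {P : ℤ → X → Prop} (hP : ∀ k, S.Lev k (P k)) (k0 k : ℤ) :
    S.Lev k (fun x => x ∈ St P k0 k) := by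
  intro x y h
  have h1 := hP k x y h
  have h2 : ∀ j, j < k → (P j x = P j y) := fun j hj => hP j x y (S.nest_le hj.le h)
  simp only [St, mem_ofPred_eq, h1]
  apply propext
  constructor
  · rintro ⟨a, b, c⟩
    exact ⟨a, b, fun j hj hk => by rw [← h2 j hk]; exact c j hj hk⟩
  · rintro ⟨a, b, c⟩
    exact ⟨a, b, fun j hj hk => by rw [h2 j hk]; exact c j hj hk⟩

lemma meas_St {P : ℤ → X → Prop} (hP : ∀ k, S.Lev k (P k)) (k0 k : ℤ) :
    MeasurableSet (St P k0 k) :=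
  measurableSet_setOfPred.mpr (Lev.measurable S (S.lev_St hP k0 k))

lemma St_exists {P : ℤ → X → Prop} {k0 k : ℤ} {x : X} (hk : k0 ≤ k) (hP : P k x) :
    ∃ l, l ≤ k ∧ x ∈ St P k0 l := by
  obtain ⟨l, ⟨h1, h2⟩, h3⟩ := Int.exists_least_of_bdd (P := fun j => k0 ≤ j ∧ P j x)
    ⟨k0, fun z hz => hz.1⟩ ⟨k, hk, hP⟩
  refine ⟨l, h3 k ⟨hk, hP⟩, h1, h2, fun j hj hjl hPj => ?_⟩
  have := h3 j ⟨hj, hPj⟩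
  omega

lemma St_disj {P : ℤ → X → Prop} {k0 : ℤ} : Pairwise (Function.onFun Disjoint (St P k0)) := by
  intro a b hab
  rw [Function.onFun, Set.disjoint_left]
  rintro x ⟨h1, h2, h3⟩ ⟨h4, h5, h6⟩
  rcases lt_or_gt_of_ne hab with h | h
  · exact h6 a h1 h h2
  · exact h3 b h4 h h5

lemma St_sum {P : ℤ → X → Prop} (hP : ∀ k, S.Lev k (P k)) (k0 : ℤ) (g : X → ℝ≥0∞) :
    ∑' k, ∫⁻ x in St P k0 k, g x ∂μ = ∫⁻ x in ⋃ k, St P k0 k, g x ∂μ :=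
  (lintegral_iUnion (S.meas_St hP k0) St_disj g).symm

/-- The dyadic maximal function. -/
noncomputable def M (g : X → ℝ≥0∞) (x : X) : ℝ≥0∞ := ⨆ k, S.E k g x

lemma measurable_E (k : ℤ) (g : X → ℝ≥0∞) : Measurable (S.E k g) := Lev.measurable S (S.lev_E k g)

lemma measurable_M (g : X → ℝ≥0∞) : Measurable (S.M g) :=
  Measurable.iSup fun k => S.measurable_E k g

/-- Weak type bound. -/
lemma weak {g : X → ℝ≥0∞} (hg : AEMeasurable g μ) (t : ℝ≥0∞) :
    t * μ {x | t < S.M g x} ≤ ∫⁻ x, g x ∂μ := by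
  have key : ∀ N : ℕ, t * μ {x | ∃ k, -(N : ℤ) ≤ k ∧ t < S.E k g x} ≤ ∫⁻ x, g x ∂μ := by
    intro N
    set P : ℤ → X → Prop := fun k x => t < S.E k g x with hPdef
    have hP : ∀ k, S.Lev k (P k) := fun k x y h => by simp only [hPdef, S.lev_E k g x y h]
    have hsub : {x | ∃ k, -(N : ℤ) ≤ k ∧ t < S.E k g x} ⊆ ⋃ k, St P (-(N : ℤ)) k := by
      rintro x ⟨k, hk, hx⟩
      obtain ⟨l, _, hl⟩ := St_exists (P := P) hk hx
      exact mem_iUnion.2 ⟨l, hl⟩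
    calc t * μ {x | ∃ k, -(N : ℤ) ≤ k ∧ t < S.E k g x}
        ≤ t * μ (⋃ k, St P (-(N : ℤ)) k) := by gcongr
      _ = ∫⁻ x in ⋃ k, St P (-(N : ℤ)) k, t ∂μ := by rw [setLIntegral_const]
      _ = ∑' k, ∫⁻ x in St P (-(N : ℤ)) k, t ∂μ := (S.St_sum hP _ _).symm
      _ ≤ ∑' k, ∫⁻ x in St P (-(N : ℤ)) k, S.E k g x ∂μ := by
          refine ENNReal.tsum_le_tsum fun k => ?_
          refine setLIntegral_mono' (S.meas_St hP _ _) fun x hx => hx.2.1.le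
      _ = ∑' k, ∫⁻ x in St P (-(N : ℤ)) k, g x ∂μ := by
          congr 1; ext k
          exact S.setLIntegral_E k (S.lev_St hP _ _) hg
      _ = ∫⁻ x in ⋃ k, St P (-(N : ℤ)) k, g x ∂μ := S.St_sum hP _ _
      _ ≤ ∫⁻ x, g x ∂μ := setLIntegral_le_lintegral _ _
  have hU : {x | t < S.M g x} = ⋃ N : ℕ, {x | ∃ k, -(N : ℤ) ≤ k ∧ t < S.E k g x} := by
    ext x
    simp only [M, mem_ofPred_eq, lt_iSup_iff, mem_iUnion]
    constructor
    · rintro ⟨k, hk⟩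
      exact ⟨(-k).toNat, k, by omega, hk⟩
    · rintro ⟨N, k, _, hk⟩
      exact ⟨k, hk⟩
  have hmono : Monotone fun N : ℕ => {x | ∃ k, -(N : ℤ) ≤ k ∧ t < S.E k g x} := by
    intro a b hab x
    rintro ⟨k, hk, hx⟩
    exact ⟨k, by omega, hx⟩
  rw [hU, hmono.measure_iUnion, ENNReal.mul_iSup]
  exact iSup_le key

end DS

lemma dy_le (X : ℝ≥0∞) {a : ℝ} (ha : 0 < a) :
    X ^ a ≤ ∑' j : ℤ, if (2 : ℝ≥0∞) ^ j < X then ((2 : ℝ≥0∞) ^ (j + 1)) ^ a else 0 := by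
  rcases eq_or_ne X 0 with rfl | h0
  · simp [ha]
  rcases eq_or_ne X ∞ with rfl | ht
  · rw [ENNReal.top_rpow_of_pos ha]
    have : ∀ N : ℕ, (N : ℝ≥0∞) ≤
        ∑' j : ℤ, if (2 : ℝ≥0∞) ^ j < ∞ then ((2 : ℝ≥0∞) ^ (j + 1)) ^ a else 0 := by
      intro N
      calc (N : ℝ≥0∞) = ∑ j ∈ Finset.range N, 1 := by simp
        _ ≤ ∑ j ∈ (Finset.range N).map ⟨fun i : ℕ => (i : ℤ), Nat.cast_injective⟩,
            if (2 : ℝ≥0∞) ^ j < ∞ then ((2 : ℝ≥0∞) ^ (j + 1)) ^ a else 0 := by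
          rw [Finset.sum_map]
          refine Finset.sum_le_sum fun i _ => ?_
          have : (2 : ℝ≥0∞) ^ (i : ℤ) < ∞ := by
            rw [zpow_natCast]; exact ENNReal.pow_lt_top (by simp)
          simp only [Function.Embedding.coeFn_mk, this, if_true]
          refine ENNReal.one_le_rpow ?_ ha
          have : ((i : ℤ) + 1) = ((i + 1 : ℕ) : ℤ) := by push_cast; rfl
          rw [this, zpow_natCast]
          exact one_le_pow₀ (by norm_num)
        _ ≤ _ := ENNReal.sum_le_tsum _
    exact le_of_eq (ENNReal.eq_top_of_forall_nnreal_le fun r => by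
      obtain ⟨N, hN⟩ := exists_nat_ge r
      exact le_trans (by exact_mod_cast hN) (this N)).symm
  · obtain ⟨m, hm1, hm2⟩ := ENNReal.exists_mem_Ioc_zpow h0 ht (y := 2) (by norm_num) (by simp)
    refine le_trans ?_ (ENNReal.le_tsum m)
    rw [if_pos hm1]
    exact ENNReal.rpow_le_rpow hm2 ha.le

lemma dy_ge {a : ℝ} (ha : 0 < a) : ∃ C : ℝ≥0∞, C ≠ 0 ∧ C ≠ ∞ ∧ ∀ X : ℝ≥0∞,
    (∑' j : ℤ, if (2 : ℝ≥0∞) ^ j < X then ((2 : ℝ≥0∞) ^ j) ^ a else 0) ≤ C * X ^ a := by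
  have hr : (2 : ℝ≥0∞)⁻¹ ^ a < 1 := ENNReal.rpow_lt_one (by norm_num) ha
  refine ⟨(1 - (2 : ℝ≥0∞)⁻¹ ^ a)⁻¹, ?_, ?_, ?_⟩
  · simp
  · simp only [ne_eq, ENNReal.inv_eq_top, tsub_eq_zero_iff_le, not_le]; exact hr
  intro X
  rcases eq_or_ne X 0 with rfl | h0
  · simp
  rcases eq_or_ne X ∞ with rfl | ht
  · rw [ENNReal.top_rpow_of_pos ha, ENNReal.mul_top]
    · exact le_top
    · simp
  obtain ⟨m, hm1, hm2⟩ := ENNReal.exists_mem_Ioc_zpow h0 ht (y := 2) (by norm_num) (by simp)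
  have h2 : (2 : ℝ≥0∞) ≠ 0 := by norm_num
  have h2' : (2 : ℝ≥0∞) ≠ ∞ := by simp
  calc (∑' j : ℤ, if (2 : ℝ≥0∞) ^ j < X then ((2 : ℝ≥0∞) ^ j) ^ a else 0)
      ≤ ∑' i : ℕ, ((2 : ℝ≥0∞) ^ (m - (i : ℤ))) ^ a := by
        have hinj : Function.Injective (fun i : ℕ => m - (i : ℤ)) := by
          intro i j h; simp at h; exact h
        rw [← hinj.tsum_eq]
        · refine ENNReal.tsum_le_tsum fun i => ?_
          split_ifs <;> simp
        · intro j hj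
          simp only [Function.mem_support, ne_eq, ite_eq_right_iff, not_forall] at hj
          obtain ⟨hj, _⟩ := hj
          have : j < m + 1 := by
            by_contra hcon
            have := lt_of_lt_of_le hj (hm2.trans (ENNReal.zpow_le_of_le (by norm_num) (not_lt.1 hcon)))
            exact lt_irrefl _ this
          exact ⟨(m - j).toNat, by simp only; omega⟩
    _ = ∑' i : ℕ, ((2 : ℝ≥0∞) ^ m) ^ a * ((2 : ℝ≥0∞)⁻¹ ^ a) ^ i := by
        congr 1; ext i
        rw [← ENNReal.rpow_natCast (2⁻¹ ^ a) i, ← ENNReal.rpow_mul, mul_comm a, ENNReal.rpow_mul,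
          ← ENNReal.mul_rpow_of_nonneg _ _ ha.le, ENNReal.rpow_natCast, sub_eq_add_neg,
          ENNReal.zpow_add h2 h2', ENNReal.zpow_neg, zpow_natCast, ENNReal.inv_pow]
    _ = ((2 : ℝ≥0∞) ^ m) ^ a * (1 - (2 : ℝ≥0∞)⁻¹ ^ a)⁻¹ := by
        rw [ENNReal.tsum_mul_left, ENNReal.tsum_geometric]
    _ ≤ _ := by
        rw [mul_comm]
        gcongr

namespace DS

variable {X : Type*} [MeasurableSpace X] {μ : Measure X} {ι : Type*} [Countable ι]
variable (S : DS μ ι)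

lemma weak' {g : X → ℝ≥0∞} (hg : Measurable g) {t : ℝ≥0∞} (ht : t ≠ ∞) :
    t * μ {x | 2 * t < S.M g x} ≤ ∫⁻ x, (if t < g x then g x else 0) ∂μ := by
  set g1 : X → ℝ≥0∞ := fun x => if t < g x then g x else 0 with hg1
  have hm : Measurable g1 := Measurable.ite (measurableSet_lt measurable_const hg) hg measurable_const
  refine le_trans ?_ (S.weak hm.aemeasurable t)
  refine mul_le_mul' le_rfl (measure_mono fun x hx => ?_)
  simp only [mem_ofPred_eq] at hx ⊢
  have hle : S.M g x ≤ S.M g1 x + t := by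
    refine iSup_le fun k => ?_
    calc S.E k g x ≤ S.E k (fun y => g1 y + t) x := by
          apply S.E_mono
          refine Eventually.of_forall fun y => ?_
          simp only [hg1]
          split_ifs with h
          · exact le_self_add
          · simpa using h
      _ = S.E k g1 x + t := by rw [S.E_add k hm.aemeasurable, S.E_const]
      _ ≤ _ := by gcongr; exact le_iSup (fun k => S.E k g1 x) k
  have := lt_of_lt_of_le hx hle
  rw [two_mul] at this
  exact lt_of_add_lt_add_right this

lemma strong {p : ℝ} (hp : 1 < p) : ∃ C : ℝ≥0∞, C ≠ ∞ ∧ ∀ {X : Type*} [MeasurableSpace X]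
    {μ : Measure X} {ι : Type*} [Countable ι] (S : DS μ ι) (g : X → ℝ≥0∞),
    AEMeasurable g μ → ∫⁻ x, (S.M g x) ^ p ∂μ ≤ C * ∫⁻ x, (g x) ^ p ∂μ := by
  obtain ⟨C, hC0, hCt, hC⟩ := dy_ge (a := p - 1) (by linarith)
  have h2 : (2 : ℝ≥0∞) ≠ 0 := by norm_num
  have h2' : (2 : ℝ≥0∞) ≠ ∞ := by simp
  refine ⟨4 ^ p * C, ENNReal.mul_ne_top (by simp) hCt, ?_⟩
  intro X _ μ ι _ S g hgae
  -- reduce to measurable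
  have hMg : ∀ x, S.M g x = S.M (hgae.mk g) x := by
    intro x
    unfold M
    congr 1; ext k
    exact le_antisymm (S.E_mono k (hgae.ae_eq_mk.le) x) (S.E_mono k (hgae.ae_eq_mk.symm.le) x)
  have hI : ∫⁻ x, (g x) ^ p ∂μ = ∫⁻ x, (hgae.mk g x) ^ p ∂μ :=
    lintegral_congr_ae (hgae.ae_eq_mk.mono fun x hx => by simp only; rw [hx])
  simp_rw [hMg]
  rw [hI]
  have hg := hgae.measurable_mk
  generalize hgae.mk g = g at *
  have hM := S.measurable_M g
  have hcalc : ∀ j : ℤ, ∫⁻ x, (if (2 : ℝ≥0∞) ^ j < S.M g x then ((2 : ℝ≥0∞) ^ (j + 1)) ^ p else 0) ∂μ ≤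
      4 ^ p * ∫⁻ x, g x * (if (2 : ℝ≥0∞) ^ (j - 1) < g x then ((2 : ℝ≥0∞) ^ (j - 1)) ^ (p - 1) else 0) ∂μ := by
    intro j
    have hj0 : (2 : ℝ≥0∞) ^ (j - 1) ≠ 0 := (ENNReal.zpow_pos h2 h2' _).ne'
    have hjt : (2 : ℝ≥0∞) ^ (j - 1) ≠ ∞ := (ENNReal.zpow_lt_top h2 h2' _).ne
    have e1 : (2 : ℝ≥0∞) ^ j = 2 * 2 ^ (j - 1) := by
      conv_lhs => rw [show j = 1 + (j - 1) by ring]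
      rw [ENNReal.zpow_add h2 h2', zpow_one]
    have e2 : (2 : ℝ≥0∞) ^ (j + 1) = 4 * 2 ^ (j - 1) := by
      conv_lhs => rw [show j + 1 = 2 + (j - 1) by ring]
      rw [ENNReal.zpow_add h2 h2']
      norm_num [zpow_ofNat]
    have hs : MeasurableSet {x | (2 : ℝ≥0∞) ^ j < S.M g x} := measurableSet_lt measurable_const hM
    have e3 : ∫⁻ x, (if (2 : ℝ≥0∞) ^ j < S.M g x then ((2 : ℝ≥0∞) ^ (j + 1)) ^ p else 0) ∂μ =
        ((2 : ℝ≥0∞) ^ (j + 1)) ^ p * μ {x | (2 : ℝ≥0∞) ^ j < S.M g x} := by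
      rw [← setLIntegral_const, ← lintegral_indicator hs]
      congr 1; ext x
      simp only [indicator, mem_ofPred_eq]
    rw [e3, e2, ENNReal.mul_rpow_of_nonneg _ _ (by linarith), mul_assoc]
    gcongr
    have e4 : ((2 : ℝ≥0∞) ^ (j - 1)) ^ p = ((2 : ℝ≥0∞) ^ (j - 1)) ^ (p - 1) * (2 : ℝ≥0∞) ^ (j - 1) := by
      conv_lhs => rw [show p = (p - 1) + 1 by ring]
      rw [ENNReal.rpow_add _ _ hj0 hjt, ENNReal.rpow_one]
    rw [e4, mul_assoc, e1]
    calc _ ≤ ((2 : ℝ≥0∞) ^ (j - 1)) ^ (p - 1) *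
          ∫⁻ x, (if (2 : ℝ≥0∞) ^ (j - 1) < g x then g x else 0) ∂μ := by
          gcongr
          exact S.weak' hg hjt
      _ = _ := by
          rw [← lintegral_const_mul]
          · congr 1; ext x
            split_ifs <;> simp [mul_comm]
          · exact Measurable.ite (measurableSet_lt measurable_const hg) hg measurable_const
  calc ∫⁻ x, (S.M g x) ^ p ∂μ
      ≤ ∫⁻ x, ∑' j : ℤ, (if (2 : ℝ≥0∞) ^ j < S.M g x then ((2 : ℝ≥0∞) ^ (j + 1)) ^ p else 0) ∂μ :=
        lintegral_mono fun x => dy_le _ (by linarith)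
    _ = ∑' j : ℤ, ∫⁻ x, (if (2 : ℝ≥0∞) ^ j < S.M g x then ((2 : ℝ≥0∞) ^ (j + 1)) ^ p else 0) ∂μ := by
        rw [lintegral_tsum]
        intro j
        exact (Measurable.ite (measurableSet_lt measurable_const hM) measurable_const
          measurable_const).aemeasurable
    _ ≤ ∑' j : ℤ, 4 ^ p * ∫⁻ x, g x * (if (2 : ℝ≥0∞) ^ (j - 1) < g x then
          ((2 : ℝ≥0∞) ^ (j - 1)) ^ (p - 1) else 0) ∂μ := ENNReal.tsum_le_tsum hcalc
    _ = 4 ^ p * ∫⁻ x, g x * ∑' j : ℤ, (if (2 : ℝ≥0∞) ^ (j - 1) < g x then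
          ((2 : ℝ≥0∞) ^ (j - 1)) ^ (p - 1) else 0) ∂μ := by
        rw [ENNReal.tsum_mul_left, ← lintegral_tsum]
        · simp_rw [ENNReal.tsum_mul_left]
        · intro j
          exact (hg.mul (Measurable.ite (measurableSet_lt measurable_const hg) measurable_const
            measurable_const)).aemeasurable
    _ = 4 ^ p * ∫⁻ x, g x * ∑' j : ℤ, (if (2 : ℝ≥0∞) ^ j < g x then
          ((2 : ℝ≥0∞) ^ j) ^ (p - 1) else 0) ∂μ := by
        congr 2; ext x; congr 1
        exact (Equiv.subRight (1 : ℤ)).tsum_eq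
          (fun j : ℤ => (if (2 : ℝ≥0∞) ^ j < g x then ((2 : ℝ≥0∞) ^ j) ^ (p - 1) else 0))
    _ ≤ 4 ^ p * ∫⁻ x, g x * (C * g x ^ (p - 1)) ∂μ := by
        gcongr with x
        exact hC _
    _ = 4 ^ p * C * ∫⁻ x, (g x) ^ p ∂μ := by
        rw [mul_assoc, ← lintegral_const_mul _ (hg.pow_const p)]
        congr 2; ext x
        have : g x ^ p = g x * g x ^ (p - 1) := by
          conv_lhs => rw [show p = 1 + (p - 1) by ring]
          rw [ENNReal.rpow_add_of_nonneg _ _ (by norm_num) (by linarith), ENNReal.rpow_one]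
        rw [this]; ring

end DS

namespace DS

variable {X : Type*} [MeasurableSpace X] {μ : Measure X} {ι : Type*} [Countable ι]
variable (S : DS μ ι)

/-- Average of a real function on a cell. -/
noncomputable def bav (b : X → ℝ) (k : ℤ) (x : X) : ℝ :=
  (S.V k).toReal⁻¹ * ∫ y in S.Q k x, b y ∂μ

lemma lev_bav (b : X → ℝ) (k : ℤ) : S.Lev k (S.bav b k) := by
  intro x y h
  simp [bav, S.lev_Q k x y h]

lemma bav_sub_le {b : X → ℝ} (hb : ∀ k x, IntegrableOn b (S.Q k x) μ) (k : ℤ) (x : X) (c : ℝ) :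
    ‖S.bav b k x - c‖ₑ ≤ S.E k (fun y => ‖b y - c‖ₑ) x := by
  have hV : 0 < (S.V k).toReal := ENNReal.toReal_pos (S.Vpos k) (S.Vtop k)
  have h1 : S.bav b k x - c = (S.V k).toReal⁻¹ * ∫ y in S.Q k x, (b y - c) ∂μ := by
    rw [integral_sub (hb k x) (integrableOn_const (by rw [volQ]; exact S.Vtop k)),
      setIntegral_const, Measure.real, volQ, bav, smul_eq_mul]
    field_simp
  rw [h1, enorm_mul]
  unfold E
  have : ‖((S.V k).toReal)⁻¹‖ₑ = (S.V k)⁻¹ := by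
    rw [enorm_inv hV.ne', Real.enorm_eq_ofReal hV.le, ENNReal.ofReal_toReal (S.Vtop k)]
  rw [this]
  gcongr
  exact enorm_integral_le_lintegral_enorm _

lemma E_tsum (k : ℤ) {κ : Type*} [Countable κ] {f : κ → X → ℝ≥0∞} (hf : ∀ i, AEMeasurable (f i) μ)
    (x) : S.E k (fun y => ∑' i, f i y) x = ∑' i, S.E k (f i) x := by
  unfold E
  rw [lintegral_tsum fun i => (hf i).restrict, ENNReal.tsum_mul_left]

lemma E_const_mul (k : ℤ) (a : ℝ≥0∞) {f : X → ℝ≥0∞} (hf : AEMeasurable f μ)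
    (x) : S.E k (fun y => a * f y) x = a * S.E k f x :=
  S.E_pull k (φ := fun _ => a) (fun _ _ _ => rfl) hf x

lemma E_mono_on (k : ℤ) {f g : X → ℝ≥0∞} (x) (h : ∀ y ∈ S.Q k x, f y ≤ g y) :
    S.E k f x ≤ S.E k g x := by
  unfold E
  gcongr 1
  exact setLIntegral_mono' (S.measQ k x) h

/-- Bounded oscillation with respect to the dyadic system. -/
structure Osc (b : X → ℝ) (β : ℝ≥0∞) : Prop where
  meas : Measurable b
  int : ∀ k x, IntegrableOn b (S.Q k x) μ
  osc : ∀ k x, S.E k (fun y => ‖b y - S.bav b k x‖ₑ) x ≤ β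
  pos : β ≠ 0
  top : β ≠ ∞
  lim : ∀ᵐ x ∂μ, Tendsto (fun k : ℕ => S.bav b k x) atTop (nhds (b x))

/-- The martingale maximal function starting from generation `l`. -/
noncomputable def N (b : X → ℝ) (l : ℤ) (x : X) : ℝ≥0∞ :=
  ⨆ (k : ℤ) (_ : l ≤ k), ‖S.bav b k x - S.bav b l x‖ₑ

lemma measurable_bav (b : X → ℝ) (k : ℤ) : Measurable (S.bav b k) := Lev.measurable S (S.lev_bav b k)

lemma measurable_N (b : X → ℝ) (l : ℤ) : Measurable (S.N b l) := by
  refine Measurable.iSup fun k => Measurable.iSup fun _ => ?_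
  exact ((S.measurable_bav b k).sub (S.measurable_bav b l)).enorm

variable {S} {b : X → ℝ} {β : ℝ≥0∞}

lemma Osc.step (h : S.Osc b β) (k : ℤ) (x : X) :
    ‖S.bav b (k + 1) x - S.bav b k x‖ₑ ≤ S.D * β := by
  refine (S.bav_sub_le h.int (k + 1) x _).trans ?_
  have h1 := h.osc k x
  refine le_trans ?_ (mul_le_mul' le_rfl h1)
  unfold E
  have hsub : S.Q (k + 1) x ⊆ S.Q k x := fun y hy => S.nest k y x hy
  have : (S.V (k + 1))⁻¹ = S.D * (S.V k)⁻¹ := by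
    rw [S.dbl k]
    have hD : S.D ≠ 0 := fun h0 => S.Vpos k (by rw [S.dbl k, h0, zero_mul])
    rw [ENNReal.mul_inv (Or.inl hD) (Or.inl S.Dtop), ← mul_assoc,
      ENNReal.mul_inv_cancel hD S.Dtop, one_mul]
  rw [this, mul_assoc]
  gcongr

lemma Osc.N_tail (h : S.Osc b β) (j : ℕ) : ∀ (l : ℤ) (x : X),
    S.E l (fun y => if (j : ℝ≥0∞) * (2 * β + S.D * β) < S.N b l y then 1 else 0) x ≤ 2⁻¹ ^ j := by
  set Λ : ℝ≥0∞ := 2 * β + S.D * β with hΛ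
  have hΛt : Λ ≠ ∞ := ENNReal.add_ne_top.2
    ⟨ENNReal.mul_ne_top (by simp) h.top, ENNReal.mul_ne_top S.Dtop h.top⟩
  induction j with
  | zero =>
    intro l x
    rw [pow_zero]
    refine (S.E_mono l (g := fun _ => 1) (Eventually.of_forall fun y => ?_) x).trans
      (S.E_const l 1 x).le
    split_ifs <;> simp
  | succ j ih =>
    intro l x
    set P : ℤ → X → Prop := fun k y => l ≤ k ∧ 2 * β < ‖S.bav b k y - S.bav b l y‖ₑ with hPdef
    have hP : ∀ k, S.Lev k (P k) := by
      intro k y z hyz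
      simp only [hPdef]
      by_cases hlk : l ≤ k
      · rw [S.lev_bav b k y z hyz, S.lev_bav b l y z (S.nest_le hlk hyz)]
      · simp [hlk]
    set F : X → ℝ≥0∞ := fun y => ‖b y - S.bav b l y‖ₑ with hF
    have hFm : Measurable F := (h.meas.sub (S.measurable_bav b l)).enorm
    set T : ℤ → X → ℝ≥0∞ := fun m => (St P l m).indicator 1 with hT
    have hTlev : ∀ m, S.Lev m (T m) := by
      intro m y z hyz
      have := S.lev_St hP l m y z hyz
      simp only [eq_iff_iff] at this
      simp only [hT]
      by_cases hy : y ∈ St P l m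
      · simp [hy, this.1 hy]
      · have hz : z ∉ St P l m := fun h => hy (this.2 h)
        simp [hy, hz]
    have hTm : ∀ m, Measurable (T m) := fun m => Lev.measurable S (hTlev m)
    set I : ℤ → X → ℝ≥0∞ := fun m y => if (j : ℝ≥0∞) * Λ < S.N b m y then 1 else 0 with hI
    have hIm : ∀ m, Measurable (I m) := fun m =>
      Measurable.ite (measurableSet_lt measurable_const (S.measurable_N b m)) measurable_const
        measurable_const
    -- pointwise bound
    have hpt : ∀ y, (if ((j + 1 : ℕ) : ℝ≥0∞) * Λ < S.N b l y then (1 : ℝ≥0∞) else 0) ≤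
        ∑' m, T m y * I m y := by
      intro y
      split_ifs with hy
      · rw [N] at hy
        simp only [lt_iSup_iff] at hy
        obtain ⟨k, hlk, hk⟩ := hy
        have hPk : P k y := by
          refine ⟨hlk, lt_of_le_of_lt ?_ hk⟩
          push_cast
          rw [add_mul, one_mul]
          exact le_trans (by rw [hΛ]; exact le_self_add) le_add_self
        obtain ⟨m, hmk, hm⟩ := St_exists hlk hPk
        refine le_trans ?_ (ENNReal.le_tsum m)
        have hlm : l < m := by
          rcases hm.1.lt_or_eq with h1 | h1
          · exact h1
          · have := hm.2.1.2
            rw [← h1] at this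
            simp at this
        have hprev : ‖S.bav b (m - 1) y - S.bav b l y‖ₑ ≤ 2 * β := by
          have := hm.2.2 (m - 1) (by omega) (by omega)
          simp only [hPdef, not_and, not_lt] at this
          exact this (by omega)
        have hstep : ‖S.bav b m y - S.bav b (m - 1) y‖ₑ ≤ S.D * β := by
          have := h.step (m - 1) y
          rwa [sub_add_cancel] at this
        have hml : ‖S.bav b m y - S.bav b l y‖ₑ ≤ Λ := by
          calc ‖S.bav b m y - S.bav b l y‖ₑ
              = ‖(S.bav b (m - 1) y - S.bav b l y) + (S.bav b m y - S.bav b (m - 1) y)‖ₑ := by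
                congr 1; ring
            _ ≤ _ := (enorm_add_le _ _).trans (add_le_add hprev hstep)
        have hkm : (j : ℝ≥0∞) * Λ < ‖S.bav b k y - S.bav b m y‖ₑ := by
          have h3 : ‖S.bav b k y - S.bav b l y‖ₑ ≤ ‖S.bav b k y - S.bav b m y‖ₑ + Λ := by
            calc ‖S.bav b k y - S.bav b l y‖ₑ
                = ‖(S.bav b k y - S.bav b m y) + (S.bav b m y - S.bav b l y)‖ₑ := by
                  congr 1; ring
              _ ≤ _ := (enorm_add_le _ _).trans (add_le_add le_rfl hml)
          have h4 := lt_of_lt_of_le hk h3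
          push_cast at h4
          rw [add_mul, one_mul] at h4
          exact lt_of_add_lt_add_right h4
        have hN : (j : ℝ≥0∞) * Λ < S.N b m y := by
          refine lt_of_lt_of_le hkm ?_
          exact le_iSup₂ (f := fun (k : ℤ) (_ : m ≤ k) => ‖S.bav b k y - S.bav b m y‖ₑ) k hmk
        simp only [hT, hI, hN, if_true, indicator_of_mem hm]
        simp
      · exact zero_le
    have hmass : 2 * β * ∑' m, S.E l (T m) x ≤ β := by
      rw [← ENNReal.tsum_mul_left]
      calc ∑' m, 2 * β * S.E l (T m) x ≤ ∑' m, S.E l (fun y => T m y * F y) x := by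
            refine ENNReal.tsum_le_tsum fun m => ?_
            rw [← S.E_const_mul l _ (hTm m).aemeasurable]
            by_cases hlm : l ≤ m
            · rw [← S.E_tower hlm (hTlev m) hFm.aemeasurable]
              refine S.E_mono l (Eventually.of_forall fun y => ?_) x
              by_cases hy : y ∈ St P l m
              · simp only [hT, indicator_of_mem hy, Pi.one_apply, mul_one, one_mul]
                refine hy.2.1.2.le.trans ((S.bav_sub_le h.int m y _).trans ?_)
                refine S.E_mono_on m y fun z hz => ?_
                simp only [hF]
                rw [S.lev_bav b l z y (S.nest_le hlm hz)]
              · simp [hT, hy]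
            · have : T m = fun _ => 0 := by
                ext y
                simp only [hT]
                refine indicator_of_notMem (fun hy => hlm hy.1) _
              simp [this]
        _ = S.E l (fun y => ∑' m, T m y * F y) x := by
            rw [S.E_tsum]
            exact fun m => ((hTm m).mul hFm).aemeasurable
        _ ≤ S.E l F x := by
            refine S.E_mono l (Eventually.of_forall fun y => ?_) x
            rw [ENNReal.tsum_mul_right]
            refine mul_le_of_le_one_left' ?_
            by_cases hy : ∃ m, y ∈ St P l m
            · obtain ⟨m, hm⟩ := hy
              rw [tsum_eq_single m]
              · simp [hT, hm]
              · intro m' hm'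
                have : y ∉ St P l m' := fun h' =>
                  Set.disjoint_left.1 (St_disj hm') h' hm
                simp [hT, this]
            · have : ∀ m, T m y = 0 := fun m => by
                have : y ∉ St P l m := fun h => hy ⟨m, h⟩
                simp [hT, this]
              simp [this]
        _ ≤ β := by
            refine le_trans ?_ (h.osc l x)
            refine S.E_mono_on l x fun z hz => ?_
            simp only [hF]
            rw [S.lev_bav b l z x hz]
    have hmass' : ∑' m, S.E l (T m) x ≤ 2⁻¹ := by
      have h1 : 2 * β * ∑' m, S.E l (T m) x ≤ 2 * β * 2⁻¹ := by
        refine hmass.trans (le_of_eq ?_)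
        rw [mul_comm, ← mul_assoc, ENNReal.inv_mul_cancel (by norm_num) (by simp), one_mul]
      exact (ENNReal.mul_le_mul_iff_right (mul_ne_zero (by norm_num) h.pos)
        (ENNReal.mul_ne_top (by simp) h.top)).1 h1
    calc _ ≤ S.E l (fun y => ∑' m, T m y * I m y) x :=
          S.E_mono l (Eventually.of_forall hpt) x
      _ = ∑' m, S.E l (fun y => T m y * I m y) x := by
          rw [S.E_tsum]
          exact fun m => ((hTm m).mul (hIm m)).aemeasurable
      _ ≤ ∑' m, 2⁻¹ ^ j * S.E l (T m) x := by
          refine ENNReal.tsum_le_tsum fun m => ?_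
          by_cases hlm : l ≤ m
          · rw [← S.E_tower hlm (hTlev m) (hIm m).aemeasurable,
              ← S.E_const_mul l _ (hTm m).aemeasurable]
            refine S.E_mono l (Eventually.of_forall fun y => ?_) x
            rw [mul_comm]
            exact mul_le_mul' (ih m y) le_rfl
          · have : T m = fun _ => 0 := by
              ext y
              simp only [hT]
              refine indicator_of_notMem (fun hy => hlm hy.1) _
            simp [this, S.E_const]
      _ = 2⁻¹ ^ j * ∑' m, S.E l (T m) x := ENNReal.tsum_mul_left
      _ ≤ 2⁻¹ ^ j * 2⁻¹ := by gcongr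
      _ = _ := (pow_succ _ _).symm

lemma Osc.N_moment (h : S.Osc b β) (m : ℕ) (hm : m ≠ 0) :
    ∃ C : ℝ≥0∞, C ≠ ∞ ∧ ∀ l x, S.E l (fun y => S.N b l y ^ m) x ≤ C := by
  set Λ : ℝ≥0∞ := 2 * β + S.D * β with hΛ
  have hΛt : Λ ≠ ∞ := ENNReal.add_ne_top.2
    ⟨ENNReal.mul_ne_top (by simp) h.top, ENNReal.mul_ne_top S.Dtop h.top⟩
  have hΛ0 : Λ ≠ 0 := by
    rw [hΛ]; simp [h.pos]
  refine ⟨∑' j : ℕ, (((j + 1 : ℕ) : ℝ≥0∞) * Λ) ^ m * 2⁻¹ ^ j, ?_, ?_⟩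
  · have hs : Summable (fun j : ℕ => ((j : ℝ) + 1) ^ m * (2⁻¹ : ℝ) ^ j) := by
      have h1 := summable_pow_mul_geometric_of_norm_lt_one (R := ℝ) m (r := 2⁻¹) (by norm_num)
      have h2 := ((_root_.summable_nat_add_iff 1).2 h1).mul_right 2
      refine h2.congr fun j => ?_
      push_cast
      rw [pow_succ]; ring
    have e : ∀ j : ℕ, (((j + 1 : ℕ) : ℝ≥0∞) * Λ) ^ m * 2⁻¹ ^ j =
        Λ ^ m * ENNReal.ofReal (((j : ℝ) + 1) ^ m * (2⁻¹ : ℝ) ^ j) := by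
      intro j
      rw [ENNReal.ofReal_mul (by positivity), ENNReal.ofReal_pow (by positivity),
        ENNReal.ofReal_pow (by positivity), mul_pow, ENNReal.ofReal_inv_of_pos (by norm_num)]
      have : ENNReal.ofReal ((j : ℝ) + 1) = ((j + 1 : ℕ) : ℝ≥0∞) := by
        rw [← ENNReal.ofReal_natCast]; push_cast; rfl
      rw [this]; simp; ring
    simp_rw [e]
    rw [ENNReal.tsum_mul_left]
    exact ENNReal.mul_ne_top (ENNReal.pow_ne_top hΛt) hs.tsum_ofReal_ne_top
  · intro l x
    have hmeas : ∀ j : ℕ, Measurable (fun y => if (j : ℝ≥0∞) * Λ < S.N b l y then (1 : ℝ≥0∞) else 0) :=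
      fun j => Measurable.ite (measurableSet_lt measurable_const (S.measurable_N b l)) measurable_const
        measurable_const
    calc S.E l (fun y => S.N b l y ^ m) x
        ≤ S.E l (fun y => ∑' j : ℕ, (((j + 1 : ℕ) : ℝ≥0∞) * Λ) ^ m *
            (if (j : ℝ≥0∞) * Λ < S.N b l y then 1 else 0)) x := by
          refine S.E_mono l (Eventually.of_forall fun y => ?_) x
          by_cases htop : S.N b l y = ∞
          · have : ∀ j : ℕ, (1 : ℝ≥0∞) * Λ ^ m ≤ (((j + 1 : ℕ) : ℝ≥0∞) * Λ) ^ m *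
              (if (j : ℝ≥0∞) * Λ < S.N b l y then 1 else 0) := by
              intro j
              rw [htop, if_pos (ENNReal.mul_lt_top (by simp) hΛt.lt_top), mul_one, mul_pow]
              gcongr
              exact one_le_pow₀ (by simp)
            have h2 := ENNReal.tsum_le_tsum this
            rw [ENNReal.tsum_const_eq_top_of_ne_zero] at h2
            · exact le_trans le_top h2
            · simp [hΛ0]
          · by_cases h0 : S.N b l y = 0
            · simp [h0, hm]
            set a := S.N b l y / Λ with ha
            have hat : a ≠ ∞ := ENNReal.div_ne_top htop hΛ0
            have ha0 : a ≠ 0 := by rw [ha]; simp [h0, hΛt]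
            have haN : a * Λ = S.N b l y := ENNReal.div_mul_cancel hΛ0 hΛt
            have har : 0 < a.toReal := ENNReal.toReal_pos ha0 hat
            set j := ⌈a.toReal⌉₊ - 1 with hj
            have hc : 0 < ⌈a.toReal⌉₊ := Nat.ceil_pos.2 har
            have h1 : (j : ℝ) < a.toReal := by
              have := Nat.ceil_lt_add_one har.le
              have e : ((j : ℕ) : ℝ) + 1 = (⌈a.toReal⌉₊ : ℝ) := by
                rw [hj]; exact_mod_cast Nat.sub_add_cancel hc
              linarith
            have h2 : a.toReal ≤ ((j + 1 : ℕ) : ℝ) := by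
              have e : j + 1 = ⌈a.toReal⌉₊ := by rw [hj]; exact Nat.sub_add_cancel hc
              rw [e]; exact Nat.le_ceil _
            have h1' : (j : ℝ≥0∞) < a := by
              rw [← ENNReal.ofReal_toReal hat, ← ENNReal.ofReal_natCast]
              exact (ENNReal.ofReal_lt_ofReal_iff har).2 h1
            have h2' : a ≤ ((j + 1 : ℕ) : ℝ≥0∞) := by
              rw [← ENNReal.ofReal_toReal hat, ← ENNReal.ofReal_natCast]
              exact ENNReal.ofReal_le_ofReal h2
            refine le_trans ?_ (ENNReal.le_tsum j)
            rw [if_pos, mul_one, ← haN]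
            · gcongr
            · rw [← haN]
              exact ENNReal.mul_lt_mul_left hΛ0 hΛt h1'
      _ = ∑' j : ℕ, (((j + 1 : ℕ) : ℝ≥0∞) * Λ) ^ m *
            S.E l (fun y => if (j : ℝ≥0∞) * Λ < S.N b l y then 1 else 0) x := by
          rw [S.E_tsum]
          · congr 1; ext j
            rw [S.E_const_mul l _ (hmeas j).aemeasurable]
          · exact fun j => ((hmeas j).const_mul _).aemeasurable
      _ ≤ _ := by
          refine ENNReal.tsum_le_tsum fun j => ?_
          gcongr
          exact h.N_tail j l x

lemma Osc.le_N (h : S.Osc b β) : ∀ᵐ x ∂μ, ∀ l, ‖b x - S.bav b l x‖ₑ ≤ S.N b l x := by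
  filter_upwards [h.lim] with x hx l
  have h1 : Tendsto (fun k : ℕ => ‖S.bav b k x - S.bav b l x‖ₑ) atTop
      (nhds ‖b x - S.bav b l x‖ₑ) := ((continuous_enorm.tendsto _).comp (hx.sub_const _))
  refine le_of_tendsto h1 ?_
  filter_upwards [eventually_ge_atTop l.toNat] with k hk
  exact le_iSup₂ (f := fun (k : ℤ) (_ : l ≤ k) => ‖S.bav b k x - S.bav b l x‖ₑ) (k : ℤ) (by omega)

end DS

set_option linter.unusedVariables false

/-- A quantitative class of (inverse) Phi-functions. -/
structure Nice {X : Type*} [MeasurableSpace X] (μ : Measure X) (Fam : Set (Set X)) (h : X → ℝ)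
    (G : X → ℝ → ℝ) (a b C : ℝ) : Prop where
  one : 1 ≤ C
  a0 : 0 ≤ a
  b0 : 0 < b
  pos : ∀ x t, 0 < t → 0 < G x t
  up : ∀ x s t, 0 < s → s ≤ t → G x t ≤ C * (t / s) ^ b * G x s
  lo : ∀ x s t, 0 < s → s ≤ t → (t / s) ^ a * G x s ≤ C * G x t
  fam : ∀ E ∈ Fam, ∃ A : Set X, (∀ᵐ x ∂μ.restrict E, x ∈ A) ∧ ∀ x ∈ A, ∀ y ∈ A, ∀ t,
    h x ≤ t → h y ≤ t → t ≤ max 1 (1 / (μ E).toReal) → G x t ≤ C * G y t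

/-- The error function. -/
structure HOK {X : Type*} [MeasurableSpace X] (μ : Measure X) (h : X → ℝ) : Prop where
  meas : Measurable h
  pos : ∀ x, 0 < h x
  le_one : ∀ x, h x ≤ 1
  int : ∫⁻ x, ENNReal.ofReal (h x) ∂μ ≠ ∞

namespace Nice

variable {X : Type*} [MeasurableSpace X] {μ : Measure X} {Fam : Set (Set X)} {h : X → ℝ}
  {G : X → ℝ → ℝ} {a b C : ℝ}

lemma almost_inc (hG : Nice μ Fam h G a b C) {x s t} (hs : 0 < s) (hst : s ≤ t) :
    G x s ≤ C * G x t := by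
  refine le_trans ?_ (hG.lo x s t hs hst)
  have h1 : 1 ≤ (t / s) ^ a := Real.one_le_rpow ((one_le_div hs).2 hst) hG.a0
  have := (hG.pos x s hs).le
  nlinarith

lemma frac (hG : Nice μ Fam h G a b C) (hh : HOK μ h) {γ : ℝ} (h1 : γ ≤ a) (h2 : γ < b) :
    Nice μ Fam h (fun x t => t ^ (-γ) * G x t) (a - γ) (b - γ) C where
  one := hG.one
  a0 := by linarith
  b0 := by linarith
  pos x t ht := mul_pos (Real.rpow_pos_of_pos ht _) (hG.pos x t ht)
  up x s t hs hst := by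
    have ht : 0 < t := hs.trans_le hst
    have h3 := hG.up x s t hs hst
    have e : t ^ (-γ) = (t / s) ^ (-γ) * s ^ (-γ) := by
      rw [← Real.mul_rpow (by positivity) hs.le, div_mul_cancel₀ _ hs.ne']
    calc t ^ (-γ) * G x t ≤ t ^ (-γ) * (C * (t / s) ^ b * G x s) := by gcongr
      _ = C * ((t / s) ^ (b) * (t / s) ^ (-γ)) * (s ^ (-γ) * G x s) := by rw [e]; ring
      _ = _ := by rw [← Real.rpow_add (by positivity)]; rfl
  lo x s t hs hst := by
    have ht : 0 < t := hs.trans_le hst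
    have h3 := hG.lo x s t hs hst
    have e : t ^ (-γ) = (t / s) ^ (-γ) * s ^ (-γ) := by
      rw [← Real.mul_rpow (by positivity) hs.le, div_mul_cancel₀ _ hs.ne']
    calc (t / s) ^ (a - γ) * (s ^ (-γ) * G x s) = t ^ (-γ) * ((t / s) ^ a * G x s) := by
          rw [e, sub_eq_add_neg, Real.rpow_add (by positivity)]; ring
      _ ≤ t ^ (-γ) * (C * G x t) := by gcongr
      _ = _ := by ring
  fam E hE := by
    obtain ⟨A, hA, hA'⟩ := hG.fam E hE
    refine ⟨A, hA, fun x hx y hy t h3 h4 h5 => ?_⟩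
    have ht : 0 < t := (hh.pos x).trans_le h3
    have := hA' x hx y hy t h3 h4 h5
    calc t ^ (-γ) * G x t ≤ t ^ (-γ) * (C * G y t) := by gcongr
      _ = _ := by ring

lemma dual (hG : Nice μ Fam h G a b C) (hh : HOK μ h) (h1 : b ≤ 1) (h2 : a < 1) :
    Nice μ Fam h (fun x t => t / G x t) (1 - b) (1 - a) C where
  one := hG.one
  a0 := by linarith
  b0 := by linarith
  pos x t ht := div_pos ht (hG.pos x t ht)
  up x s t hs hst := by
    have ht : 0 < t := hs.trans_le hst
    have h3 := hG.lo x s t hs hst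
    have p1 := hG.pos x s hs
    have p2 := hG.pos x t ht
    have hC := hG.one
    rw [Real.rpow_sub (by positivity), Real.rpow_one]
    have p3 : 0 < (t / s) ^ a := by positivity
    rw [div_le_iff₀ p2]
    have : C * (t / s / (t / s) ^ a) * (s / G x s) * G x t = t * ((C * G x t) / ((t / s) ^ a * G x s)) := by
      field_simp
    rw [this]
    exact le_mul_of_one_le_right ht.le ((one_le_div (by positivity)).2 h3)
  lo x s t hs hst := by
    have ht : 0 < t := hs.trans_le hst
    have h3 := hG.up x s t hs hst
    have p1 := hG.pos x s hs
    have p2 := hG.pos x t ht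
    rw [Real.rpow_sub (by positivity), Real.rpow_one]
    have p3 : 0 < (t / s) ^ b := by positivity
    have : t / s / (t / s) ^ b * (s / G x s) = t / ((t / s) ^ b * G x s) := by
      field_simp
    rw [this, ← mul_div_assoc, div_le_div_iff₀ (by positivity) p2]
    nlinarith
  fam E hE := by
    obtain ⟨A, hA, hA'⟩ := hG.fam E hE
    refine ⟨A, hA, fun x hx y hy t h3 h4 h5 => ?_⟩
    have ht : 0 < t := (hh.pos x).trans_le h3
    have h6 := hA' y hy x hx t h4 h3 h5
    have p1 := hG.pos x t ht
    have p2 := hG.pos y t ht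
    rw [← mul_div_assoc, div_le_div_iff₀ p1 p2]
    nlinarith

lemma pow (hG : Nice μ Fam h G a b C) (hh : HOK μ h) {s : ℝ} (hs : 0 < s) :
    Nice μ Fam h (fun x t => G x t ^ s) (a * s) (b * s) (C ^ s) where
  one := Real.one_le_rpow hG.one hs.le
  a0 := mul_nonneg hG.a0 hs.le
  b0 := mul_pos hG.b0 hs
  pos x t ht := Real.rpow_pos_of_pos (hG.pos x t ht) _
  up x v t hv hvt := by
    have ht : 0 < t := hv.trans_le hvt
    have hC := hG.one
    have p1 := hG.pos x v hv
    have p2 := hG.pos x t ht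
    rw [Real.rpow_mul (by positivity), ← Real.mul_rpow (by positivity) (by positivity),
      ← Real.mul_rpow (by positivity) (by positivity)]
    exact Real.rpow_le_rpow p2.le (hG.up x v t hv hvt) hs.le
  lo x v t hv hvt := by
    have ht : 0 < t := hv.trans_le hvt
    have hC := hG.one
    have p1 := hG.pos x v hv
    have p2 := hG.pos x t ht
    rw [Real.rpow_mul (by positivity), ← Real.mul_rpow (by positivity) (by positivity),
      ← Real.mul_rpow (by positivity) (by positivity)]
    exact Real.rpow_le_rpow (by positivity) (hG.lo x v t hv hvt) hs.le
  fam E hE := by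
    obtain ⟨A, hA, hA'⟩ := hG.fam E hE
    refine ⟨A, hA, fun x hx y hy t h3 h4 h5 => ?_⟩
    have ht : 0 < t := (hh.pos x).trans_le h3
    have hC := hG.one
    have p1 := hG.pos x t ht
    have p2 := hG.pos y t ht
    rw [← Real.mul_rpow (by positivity) (by positivity)]
    exact Real.rpow_le_rpow p1.le (hA' x hx y hy t h3 h4 h5) hs.le

/-- Extended range in the family condition. -/
lemma fam' (hG : Nice μ Fam h G a b C) (hh : HOK μ h) {K : ℝ} (hK : 1 ≤ K) :
    ∀ E ∈ Fam, ∃ A : Set X, (∀ᵐ x ∂μ.restrict E, x ∈ A) ∧ ∀ x ∈ A, ∀ y ∈ A, ∀ t,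
    h x ≤ t → h y ≤ t → t ≤ K * max 1 (1 / (μ E).toReal) → G x t ≤ (C * K ^ b * C * C) * G y t := by
  intro E hE
  obtain ⟨A, hA, hA'⟩ := hG.fam E hE
  refine ⟨A, hA, fun x hx y hy t h3 h4 h5 => ?_⟩
  have ht : 0 < t := (hh.pos x).trans_le h3
  have hC := hG.one
  set m := max 1 (1 / (μ E).toReal) with hm
  have hm1 : 1 ≤ m := le_max_left _ _
  set t' := min t m with ht'
  have ht'0 : 0 < t' := lt_min ht (by linarith)
  have h6 : t' ≤ t := min_le_left _ _
  have h7 : t / t' ≤ K := by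
    rw [div_le_iff₀ ht'0, ht']
    rcases le_total t m with h | h
    · rw [min_eq_left h]; nlinarith
    · rw [min_eq_right h]; exact h5
  have p1 := hG.pos x t' ht'0
  have p2 := hG.pos y t' ht'0
  have p3 := hG.pos y t ht
  have q1 := hG.up x t' t ht'0 h6
  have q2 := hA' x hx y hy t' (le_min h3 ((hh.le_one x).trans hm1))
    (le_min h4 ((hh.le_one y).trans hm1)) (min_le_right _ _)
  have q3 := hG.almost_inc (x := y) ht'0 h6
  have q4 : (t / t') ^ b ≤ K ^ b := Real.rpow_le_rpow (by positivity) h7 hG.b0.le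
  have hKb : 0 < K ^ b := by positivity
  calc G x t ≤ C * (t / t') ^ b * G x t' := q1
    _ ≤ C * K ^ b * (C * (C * G y t)) := by gcongr; exact q2.trans (by gcongr)
    _ = _ := by ring

lemma avg (hG : Nice μ Fam h G a b C) (hh : HOK μ h) {γ : ℝ} (hγ : 0 ≤ γ) (hγa : γ ≤ a)
    (hb1 : b ≤ 1) {C0 Cf : ℝ} (hC0 : 0 < C0) (hCf : 0 ≤ Cf) :
    ∃ K : ℝ, 0 ≤ K ∧ ∀ E ∈ Fam, MeasurableSet E → μ E ≠ 0 → μ E ≠ ∞ → ∀ (f : X → ℝ≥0∞) (u : X → ℝ),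
      Measurable u → (∀ x, h x ≤ u x) → ∫⁻ x in E, ENNReal.ofReal (u x) ∂μ ≤ ENNReal.ofReal C0 →
      (∀ᵐ y ∂μ.restrict E, f y ≤ ENNReal.ofReal (Cf * G y (u y))) →
      ∀ᵐ x ∂μ.restrict E, ∀ τ : ℝ, h x ≤ τ →
        (μ E)⁻¹ * ∫⁻ y in E, ENNReal.ofReal (u y ^ b) ∂μ ≤ ENNReal.ofReal (τ ^ b) →
        μ E ^ (γ - 1) * ∫⁻ y in E, f y ∂μ ≤ ENNReal.ofReal (K * (τ ^ (-γ) * G x τ)) := by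
  have hC := hG.one
  have hb0 := hG.b0
  set C1 : ℝ := 2 ^ (1 / b) * C0 with hC1
  have hC1p : 0 < C1 := by positivity
  set C1' : ℝ := max 1 C1 with hC1'
  have hC1'1 : 1 ≤ C1' := le_max_left _ _
  set K2 : ℝ := C * C1' ^ b * C * C with hK2
  have hK2p : 0 < K2 := by positivity
  refine ⟨2 * (Cf * (C ^ 3 * K2)) * (C1 ^ γ * (C ^ 2 * K2)), by positivity, ?_⟩
  intro E hE hEm hE0 hEt f u hu hhu hint hf
  obtain ⟨A, hA, hA'⟩ := hG.fam' hh hC1'1 E hE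
  set m := (μ E).toReal with hm
  have hm0 : 0 < m := ENNReal.toReal_pos hE0 hEt
  have hEm' : μ E = ENNReal.ofReal m := (ENNReal.ofReal_toReal hEt).symm
  have hu0 : ∀ x, 0 < u x := fun x => (hh.pos x).trans_le (hhu x)
  set av := (μ E)⁻¹ * ∫⁻ y in E, ENNReal.ofReal (u y ^ b) ∂μ with hav
  -- upper bound for the average
  set A0 := C0 / m with hA0
  have hA0p : 0 < A0 := by positivity
  have hav_le : av ≤ ENNReal.ofReal (2 * A0 ^ b) := by
    have h1 : ∫⁻ y in E, ENNReal.ofReal (u y ^ b) ∂μ ≤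
        ∫⁻ y in E, (ENNReal.ofReal (A0 ^ b) + ENNReal.ofReal (A0 ^ b / A0) * ENNReal.ofReal (u y)) ∂μ := by
      refine lintegral_mono fun y => ?_
      rw [← ENNReal.ofReal_mul (by positivity), ← ENNReal.ofReal_add (by positivity)
        (by have := hu0 y; positivity)]
      refine ENNReal.ofReal_le_ofReal ?_
      have e : u y ^ b = A0 ^ b * (u y / A0) ^ b := by
        rw [← Real.mul_rpow hA0p.le (by have := hu0 y; positivity), mul_div_cancel₀ _ hA0p.ne']
      have h2 : (u y / A0) ^ b ≤ 1 + u y / A0 := by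
        have hp : 0 < u y / A0 := div_pos (hu0 y) hA0p
        rcases le_total (u y / A0) 1 with h | h
        · have := Real.rpow_le_one hp.le h hb0.le; linarith
        · have := Real.rpow_le_rpow_of_exponent_le h hb1
          rw [Real.rpow_one] at this; linarith
      rw [e]
      calc A0 ^ b * (u y / A0) ^ b ≤ A0 ^ b * (1 + u y / A0) := by gcongr
        _ = _ := by field_simp
    rw [lintegral_add_left measurable_const, lintegral_const_mul _ hu.ennreal_ofReal,
      setLIntegral_const, hEm'] at h1
    rw [hav, hEm']
    calc _ ≤ (ENNReal.ofReal m)⁻¹ * (ENNReal.ofReal (A0 ^ b) * ENNReal.ofReal m +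
          ENNReal.ofReal (A0 ^ b / A0) * ENNReal.ofReal C0) := by gcongr; exact h1.trans (by gcongr)
      _ = _ := by
        rw [← ENNReal.ofReal_inv_of_pos hm0, ← ENNReal.ofReal_mul (by positivity),
          ← ENNReal.ofReal_mul (by positivity), ← ENNReal.ofReal_add (by positivity) (by positivity),
          ← ENNReal.ofReal_mul (by positivity)]
        congr 1
        rw [hA0]; field_simp; ring
  have havt : av ≠ ∞ := ne_top_of_le_ne_top ENNReal.ofReal_ne_top hav_le
  -- a good point
  have hubm : AEMeasurable (fun y => ENNReal.ofReal (u y ^ b)) (μ.restrict E) :=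
    (hu.pow_const b).ennreal_ofReal.aemeasurable
  have hpos := measure_le_setLAverage_pos hE0 hEt hubm
  have hlav : ⨍⁻ y in E, ENNReal.ofReal (u y ^ b) ∂μ = av := by
    rw [setLAverage_eq, hav, ENNReal.div_eq_inv_mul]
  rw [hlav] at hpos
  obtain ⟨x', hx'A, hx'E, hx'u⟩ : ∃ x', x' ∈ A ∧ x' ∈ E ∧ ENNReal.ofReal (u x' ^ b) ≤ av := by
    by_contra hcon
    push Not at hcon
    refine hpos.ne' ?_
    rw [ae_restrict_iff' hEm] at hA
    refine measure_mono_null ?_ hA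
    rintro x ⟨hxE, hxu⟩ hx
    exact absurd hxu (not_le.2 (hcon x (hx hxE) hxE))
  set Tb := av.toReal with hTb
  have havr : av = ENNReal.ofReal Tb := (ENNReal.ofReal_toReal havt).symm
  have huTb : u x' ^ b ≤ Tb := by
    rw [havr] at hx'u
    exact (ENNReal.ofReal_le_ofReal_iff ENNReal.toReal_nonneg).1 hx'u
  have hTb0 : 0 < Tb := lt_of_lt_of_le (Real.rpow_pos_of_pos (hu0 x') b) huTb
  set T := Tb ^ (1 / b) with hT
  have hT0 : 0 < T := Real.rpow_pos_of_pos hTb0 _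
  have hTbT : T ^ b = Tb := by
    rw [hT, ← Real.rpow_mul hTb0.le, one_div_mul_cancel hb0.ne', Real.rpow_one]
  have huT : u x' ≤ T := by
    rw [← hTbT] at huTb
    exact (Real.rpow_le_rpow_iff (hu0 x').le hT0.le hb0).1 huTb
  have hTle : T ≤ C1 / m := by
    have h1 : Tb ≤ 2 * A0 ^ b := by
      rw [havr] at hav_le
      exact (ENNReal.ofReal_le_ofReal_iff (by positivity)).1 hav_le
    have h2 : T ≤ (2 * A0 ^ b) ^ (1 / b) := Real.rpow_le_rpow hTb0.le h1 (by positivity)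
    rw [Real.mul_rpow (by norm_num) (by positivity), ← Real.rpow_mul hA0p.le,
      mul_one_div_cancel hb0.ne', Real.rpow_one] at h2
    refine h2.trans (le_of_eq ?_)
    rw [hA0, hC1]; ring
  have hTle' : T ≤ C1' * max 1 (1 / m) := by
    calc T ≤ C1 * (1 / m) := by rw [mul_one_div]; exact hTle
      _ ≤ _ := by
        gcongr
        · exact le_max_right _ _
        · exact le_max_right _ _
  have h1le : 1 ≤ C1' * max 1 (1 / m) := one_le_mul_of_one_le_of_one_le hC1'1 (le_max_left _ _)
  have hGxT : 0 < G x' T := hG.pos _ _ hT0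
  -- bound on f
  have hfb : ∀ᵐ y ∂μ.restrict E, f y ≤
      ENNReal.ofReal (Cf * (C ^ 3 * K2) * G x' T) * (1 + ENNReal.ofReal (1 / Tb) * ENNReal.ofReal (u y ^ b)) := by
    filter_upwards [hf, hA] with y hy hyA
    refine hy.trans ?_
    have huy := hu0 y
    rw [← ENNReal.ofReal_mul (by positivity), ← ENNReal.ofReal_one,
      ← ENNReal.ofReal_add (by norm_num) (by positivity), ← ENNReal.ofReal_mul (by positivity)]
    refine ENNReal.ofReal_le_ofReal ?_
    set mx := max (u y) T with hmx
    have hmx0 : 0 < mx := lt_max_of_lt_left huy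
    set ty := max (h y) T with hty
    have hty0 : 0 < ty := lt_max_of_lt_right hT0
    have htymx : ty ≤ mx := max_le_max (hhu y) le_rfl
    have r1 := hG.almost_inc (x := y) huy (le_max_left (u y) T)
    have r2 := hG.up y ty mx hty0 htymx
    have r3 := hA' y hyA x' hx'A ty (le_max_left _ _) ((hhu x').trans (huT.trans (le_max_right _ _)))
      (max_le ((hh.le_one y).trans h1le) hTle')
    have r4 := hG.up x' T ty hT0 (le_max_right _ _)
    have r5 : (mx / ty) ^ b * (ty / T) ^ b = (mx / T) ^ b := by
      rw [← Real.mul_rpow (by positivity) (by positivity)]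
      congr 1; field_simp
    have r6 : (mx / T) ^ b ≤ 1 + 1 / Tb * u y ^ b := by
      rcases le_total (u y) T with h | h
      · rw [hmx, max_eq_right h, div_self hT0.ne', Real.one_rpow]
        have : 0 ≤ 1 / Tb * u y ^ b := by positivity
        linarith
      · rw [hmx, max_eq_left h, Real.div_rpow huy.le hT0.le, hTbT, div_eq_inv_mul, one_div]
        linarith
    have p1 := hG.pos y ty hty0
    have p2 := hG.pos x' ty hty0
    calc Cf * G y (u y) ≤ Cf * (C * (C * (mx / ty) ^ b * (K2 * (C * (ty / T) ^ b * G x' T)))) := by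
          gcongr
          refine r1.trans ?_
          gcongr
          refine r2.trans ?_
          gcongr
          refine r3.trans ?_
          gcongr
      _ = Cf * (C ^ 3 * K2) * G x' T * ((mx / ty) ^ b * (ty / T) ^ b) := by ring
      _ ≤ _ := by rw [r5]; gcongr
  have hfi : ∫⁻ y in E, f y ∂μ ≤ ENNReal.ofReal (2 * (Cf * (C ^ 3 * K2)) * G x' T * m) := by
    refine (lintegral_mono_ae hfb).trans ?_
    have hmm : Measurable fun y => 1 + ENNReal.ofReal (1 / Tb) * ENNReal.ofReal (u y ^ b) :=
      measurable_const.add ((hu.pow_const b).ennreal_ofReal.const_mul _)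
    rw [lintegral_const_mul _ hmm,
      lintegral_add_left measurable_const, lintegral_const_mul _ (hu.pow_const b).ennreal_ofReal,
      setLIntegral_const, one_mul]
    have e1 : ∫⁻ y in E, ENNReal.ofReal (u y ^ b) ∂μ = ENNReal.ofReal (m * Tb) := by
      rw [ENNReal.ofReal_mul hm0.le, ← havr, ← hEm', hav, ← mul_assoc,
        ENNReal.mul_inv_cancel hE0 hEt, one_mul]
    rw [e1, hEm', ← ENNReal.ofReal_mul (by positivity), ← ENNReal.ofReal_add (by positivity)
      (by positivity), ← ENNReal.ofReal_mul (by positivity)]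
    refine ENNReal.ofReal_le_ofReal (le_of_eq ?_)
    field_simp; ring
  filter_upwards [hA] with x hxA τ hxτ hτ
  have hτ0 : 0 < τ := (hh.pos x).trans_le hxτ
  have hTτ : T ≤ τ := by
    rw [havr, ← hTbT] at hτ
    have := (ENNReal.ofReal_le_ofReal_iff (by positivity)).1 hτ
    exact (Real.rpow_le_rpow_iff hT0.le hτ0.le hb0).1 this
  set t1 := max (h x) T with ht1
  have ht10 : 0 < t1 := lt_max_of_lt_right hT0
  have htτ : t1 ≤ τ := max_le hxτ hTτ
  have hH : ∀ z s t, 0 < s → s ≤ t → s ^ (-γ) * G z s ≤ C * (t ^ (-γ) * G z t) := by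
    intro z s t hs hst
    have ht : 0 < t := hs.trans_le hst
    have h3 := hG.lo z s t hs hst
    have e : t ^ (-γ) = (t / s) ^ (-γ) * s ^ (-γ) := by
      rw [← Real.mul_rpow (by positivity) hs.le, div_mul_cancel₀ _ hs.ne']
    have p := hG.pos z s hs
    have hone : 1 ≤ (t / s) ^ (a - γ) := Real.one_le_rpow ((one_le_div hs).2 hst) (by linarith)
    calc s ^ (-γ) * G z s ≤ (t / s) ^ (a - γ) * (s ^ (-γ) * G z s) :=
          le_mul_of_one_le_left (by positivity) hone
      _ = t ^ (-γ) * ((t / s) ^ a * G z s) := by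
          rw [e, sub_eq_add_neg, Real.rpow_add (by positivity)]; ring
      _ ≤ t ^ (-γ) * (C * G z t) := by gcongr
      _ = _ := by ring
  have s1 := hH x' T t1 hT0 (le_max_right _ _)
  have s2 := hA' x' hx'A x hxA t1 ((hhu x').trans (huT.trans (le_max_right _ _))) (le_max_left _ _)
      (max_le ((hh.le_one x).trans h1le) hTle')
  have s3 := hH x t1 τ ht10 htτ
  have s4 : m ^ γ * G x' T ≤ C1 ^ γ * (C ^ 2 * K2) * (τ ^ (-γ) * G x τ) := by
    have e : m ^ γ * G x' T = (m * T) ^ γ * (T ^ (-γ) * G x' T) := by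
      rw [Real.mul_rpow hm0.le hT0.le, Real.rpow_neg hT0.le]
      field_simp
    have hmT : m * T ≤ C1 := by
      rw [le_div_iff₀ hm0] at hTle; linarith
    have p1 := hG.pos x t1 ht10
    rw [e]
    calc (m * T) ^ γ * (T ^ (-γ) * G x' T) ≤ C1 ^ γ * (C * (K2 * (C * (τ ^ (-γ) * G x τ)))) := by
          refine mul_le_mul (Real.rpow_le_rpow (by positivity) hmT hγ) ?_ (by positivity)
            (by positivity)
          refine s1.trans ?_
          refine mul_le_mul_of_nonneg_left ?_ (by positivity)
          calc t1 ^ (-γ) * G x' t1 ≤ t1 ^ (-γ) * (K2 * G x t1) := by gcongr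
            _ = K2 * (t1 ^ (-γ) * G x t1) := by ring
            _ ≤ _ := by gcongr
      _ = _ := by ring
  calc μ E ^ (γ - 1) * ∫⁻ y in E, f y ∂μ
      ≤ ENNReal.ofReal (m ^ (γ - 1)) * ENNReal.ofReal (2 * (Cf * (C ^ 3 * K2)) * G x' T * m) := by
        rw [hEm', ENNReal.ofReal_rpow_of_pos hm0]; gcongr
    _ = ENNReal.ofReal (2 * (Cf * (C ^ 3 * K2)) * (m ^ γ * G x' T)) := by
        rw [← ENNReal.ofReal_mul (by positivity)]
        congr 1
        rw [Real.rpow_sub hm0, Real.rpow_one]; field_simp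
    _ ≤ _ := by
        refine ENNReal.ofReal_le_ofReal ?_
        calc 2 * (Cf * (C ^ 3 * K2)) * (m ^ γ * G x' T)
            ≤ 2 * (Cf * (C ^ 3 * K2)) * (C1 ^ γ * (C ^ 2 * K2) * (τ ^ (-γ) * G x τ)) := by gcongr
          _ = _ := by ring

end Nice

set_option linter.unusedVariables false

/-- `F` is dominated by `H(x, w(x))` with `w` integrable. -/
def Dom {X : Type*} [MeasurableSpace X] (μ : Measure X) (h : X → ℝ) (H : X → ℝ → ℝ) (C : ℝ)
    (F : X → ℝ≥0∞) : Prop :=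
  ∃ w : X → ℝ, Measurable w ∧ (∀ x, h x ≤ w x) ∧ ∫⁻ x, ENNReal.ofReal (w x) ∂μ ≤ ENNReal.ofReal C ∧
    ∀ᵐ x ∂μ, F x ≤ ENNReal.ofReal (C * H x (w x))

namespace Dom

variable {X : Type*} [MeasurableSpace X] {μ : Measure X} {Fam : Set (Set X)} {h : X → ℝ}
  {G H : X → ℝ → ℝ} {a b C C1 C2 : ℝ} {F F1 F2 : X → ℝ≥0∞}

lemma mono (hF : Dom μ h H C F2) (hle : ∀ᵐ x ∂μ, F1 x ≤ F2 x) : Dom μ h H C F1 := by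
  obtain ⟨w, h1, h2, h3, h4⟩ := hF
  refine ⟨w, h1, h2, h3, ?_⟩
  filter_upwards [h4, hle] with x hx hx'
  exact hx'.trans hx

lemma monoC (hh : HOK μ h) (hH : ∀ x t, 0 < t → 0 < H x t) (hF : Dom μ h H C1 F)
    (hC : C1 ≤ C2) : Dom μ h H C2 F := by
  obtain ⟨w, h1, h2, h3, h4⟩ := hF
  refine ⟨w, h1, h2, h3.trans (ENNReal.ofReal_le_ofReal hC), ?_⟩
  filter_upwards [h4] with x hx
  refine hx.trans (ENNReal.ofReal_le_ofReal ?_)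
  have := hH x (w x) ((hh.pos x).trans_le (h2 x))
  gcongr

lemma smul (hh : HOK μ h) (hH : ∀ x t, 0 < t → 0 < H x t) (hF : Dom μ h H C F) {c : ℝ}
    (hc : 1 ≤ c) (hC0 : 0 ≤ C) : Dom μ h H (c * C) (fun x => ENNReal.ofReal c * F x) := by
  obtain ⟨w, h1, h2, h3, h4⟩ := hF
  refine ⟨w, h1, h2, h3.trans (ENNReal.ofReal_le_ofReal (le_mul_of_one_le_left hC0 hc)), ?_⟩
  filter_upwards [h4] with x hx
  rw [mul_assoc, ENNReal.ofReal_mul (by linarith)]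
  gcongr

lemma add (hh : HOK μ h) (hH : Nice μ Fam h H a b C) (hC1 : 0 ≤ C1) (hC2 : 0 ≤ C2)
    (h1 : Dom μ h H C1 F1) (h2 : Dom μ h H C2 F2) :
    Dom μ h H (C * (C1 + C2)) (fun x => F1 x + F2 x) := by
  obtain ⟨w1, a1, a2, a3, a4⟩ := h1
  obtain ⟨w2, b1, b2, b3, b4⟩ := h2
  have hC := hH.one
  have p1 : ∀ x, 0 < w1 x := fun x => (hh.pos x).trans_le (a2 x)
  have p2 : ∀ x, 0 < w2 x := fun x => (hh.pos x).trans_le (b2 x)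
  refine ⟨fun x => w1 x + w2 x, a1.add b1, fun x => ?_, ?_, ?_⟩
  · have := a2 x; have := p2 x; linarith
  · have : ∀ x, ENNReal.ofReal (w1 x + w2 x) = ENNReal.ofReal (w1 x) + ENNReal.ofReal (w2 x) :=
      fun x => ENNReal.ofReal_add (p1 x).le (p2 x).le
    simp_rw [this]
    rw [lintegral_add_left a1.ennreal_ofReal]
    refine (add_le_add a3 b3).trans ?_
    rw [← ENNReal.ofReal_add hC1 hC2]
    exact ENNReal.ofReal_le_ofReal (le_mul_of_one_le_left (by positivity) hC)
  · filter_upwards [a4, b4] with x hx1 hx2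
    have q1 := hH.almost_inc (x := x) (p1 x) (show w1 x ≤ w1 x + w2 x by have := p2 x; linarith)
    have q2 := hH.almost_inc (x := x) (p2 x) (show w2 x ≤ w1 x + w2 x by have := p1 x; linarith)
    have r1 := hH.pos x _ (p1 x)
    have r2 := hH.pos x _ (p2 x)
    refine (add_le_add hx1 hx2).trans ?_
    rw [← ENNReal.ofReal_add (by positivity) (by positivity)]
    refine ENNReal.ofReal_le_ofReal ?_
    calc C1 * H x (w1 x) + C2 * H x (w2 x) ≤ C1 * (C * H x (w1 x + w2 x)) + C2 * (C * H x (w1 x + w2 x)) := by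
          gcongr
      _ = _ := by ring

lemma sum (hh : HOK μ h) (hH : Nice μ Fam h H a b C) {κ : Type*} (s : Finset κ) :
    ∀ (C1 : ℝ), 0 ≤ C1 → ∃ K : ℝ, 0 ≤ K ∧ ∀ F : κ → X → ℝ≥0∞, (∀ i, Dom μ h H C1 (F i)) →
      (s.Nonempty → Dom μ h H K (fun x => ∑ i ∈ s, F i x)) := by
  intro C1 hC1
  have hC := hH.one
  induction s using Finset.cons_induction with
  | empty => exact ⟨0, le_rfl, fun F hF hs => by simp at hs⟩
  | cons i s hi ih =>
    obtain ⟨K, hK, hK'⟩ := ih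
    refine ⟨C * (C1 + (C1 + K)), by positivity, fun F hF _ => ?_⟩
    rcases s.eq_empty_or_nonempty with rfl | hs
    · have : Dom μ h H C1 (fun x => ∑ j ∈ Finset.cons i ∅ hi, F j x) := by simpa using hF i
      exact this.monoC hh hH.pos (by nlinarith)
    · have := (Dom.add hh hH hC1 (by positivity) (hF i) ((hK' F hF hs).monoC hh hH.pos
        (show K ≤ C1 + K by linarith)))
      simpa [Finset.sum_cons] using this

end Dom

namespace DS

variable {X : Type*} [MeasurableSpace X] {μ : Measure X} {ι : Type*} [Countable ι]
variable (S : DS μ ι)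

lemma ae_cells {R : ℤ → Set X → X → Prop}
    (hR : ∀ k x0, ∀ᵐ x ∂μ.restrict (S.Q k x0), R k (S.Q k x0) x) : ∀ᵐ x ∂μ, ∀ k, R k (S.Q k x) x := by
  rw [ae_all_iff]
  intro k
  have h1 : ∀ m : ι, ∀ᵐ x ∂μ, S.c k x = m → R k (S.Q k x) x := by
    intro m
    by_cases hm : ∃ x0, S.c k x0 = m
    · obtain ⟨x0, rfl⟩ := hm
      have := hR k x0
      rw [ae_restrict_iff' (S.measQ k x0)] at this
      filter_upwards [this] with x hx hxm
      rw [S.lev_Q k x x0 hxm]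
      exact hx hxm
    · exact Eventually.of_forall fun x hx => absurd ⟨x, hx⟩ hm
  filter_upwards [ae_all_iff.2 h1] with x hx
  exact hx _ rfl

lemma E_holder {p q : ℝ} (hpq : p.HolderConjugate q) (k : ℤ) {f g : X → ℝ≥0∞}
    (hf : AEMeasurable f μ) (hg : AEMeasurable g μ) (x : X) :
    S.E k (fun y => f y * g y) x ≤
      S.E k (fun y => f y ^ p) x ^ (1 / p) * S.E k (fun y => g y ^ q) x ^ (1 / q) := by
  have e : ∀ F : X → ℝ≥0∞, S.E k F x = ∫⁻ y, F y ∂((S.V k)⁻¹ • μ.restrict (S.Q k x)) := by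
    intro F
    rw [lintegral_smul_measure]; rfl
  rw [e, e, e]
  exact ENNReal.lintegral_mul_le_Lp_mul_Lq _ hpq (hf.restrict.smul_measure _)
    (hg.restrict.smul_measure _)

/-- The fractional dyadic `s`-maximal function. -/
noncomputable def Ms (γ s : ℝ) (f : X → ℝ≥0∞) (x : X) : ℝ≥0∞ :=
  ⨆ k, S.V k ^ γ * S.E k (fun y => f y ^ s) x ^ (1 / s)

lemma measurable_Ms (γ s : ℝ) (f : X → ℝ≥0∞) : Measurable (S.Ms γ s f) :=
  Measurable.iSup fun k => ((S.measurable_E k _).pow_const _).const_mul _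

/-- Lemma A. -/
lemma dom_Ms {Fam : Set (Set X)} {h : X → ℝ} {G : X → ℝ → ℝ} {a b C : ℝ}
    (hG : Nice μ Fam h G a b C) (hh : HOK μ h) (hFam : ∀ k x, S.Q k x ∈ Fam)
    {γ s : ℝ} (hγ : 0 ≤ γ) (hγa : γ ≤ a) (hs : 1 ≤ s) (hbs : b * s < 1) {C0 : ℝ} (hC0 : 0 < C0) :
    ∃ K : ℝ, 0 ≤ K ∧ ∀ f : X → ℝ≥0∞, Dom μ h G C0 f →
      Dom μ h (fun x t => t ^ (-γ) * G x t) K (S.Ms γ s f) := by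
  have hs0 : 0 < s := by linarith
  have hGs := hG.pow hh hs0
  have hbs0 : 0 < b * s := hGs.b0
  obtain ⟨K, hK, hK'⟩ := hGs.avg hh (γ := γ * s) (by positivity) (by gcongr) hbs.le
    (C0 := C0) (Cf := C0 ^ s) hC0 (by positivity)
  obtain ⟨Cs, hCs, hstrong⟩ := strong (p := 1 / (b * s)) (by rw [lt_div_iff₀ hbs0]; linarith)
  set I : ℝ≥0∞ := ∫⁻ x, ENNReal.ofReal (h x) ∂μ + Cs * ENNReal.ofReal C0 with hI
  have hIt : I ≠ ∞ := ENNReal.add_ne_top.2 ⟨hh.int, ENNReal.mul_ne_top hCs ENNReal.ofReal_ne_top⟩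
  refine ⟨K ^ (1 / s) + I.toReal, by positivity, ?_⟩
  rintro f ⟨u, hu, hhu, hui, hfu⟩
  have hu0 : ∀ x, 0 < u x := fun x => (hh.pos x).trans_le (hhu x)
  set ub : X → ℝ≥0∞ := fun y => ENNReal.ofReal (u y ^ (b * s)) with hub
  have hubm : Measurable ub := (hu.pow_const _).ennreal_ofReal
  set W : X → ℝ≥0∞ := fun x => S.M ub x ^ (1 / (b * s)) with hW
  have hWm : Measurable W := (S.measurable_M ub).pow_const _
  have hWi : ∫⁻ x, W x ∂μ ≤ Cs * ENNReal.ofReal C0 := by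
    refine (hstrong S ub hubm.aemeasurable).trans ?_
    gcongr
    refine le_trans (le_of_eq ?_) hui
    congr 1; ext x
    simp only [hub]
    rw [ENNReal.ofReal_rpow_of_pos (Real.rpow_pos_of_pos (hu0 x) _), ← Real.rpow_mul (hu0 x).le,
      mul_one_div_cancel hbs0.ne', Real.rpow_one]
  have hWt : ∀ᵐ x ∂μ, W x < ∞ := ae_lt_top hWm (ne_top_of_le_ne_top
    (ENNReal.mul_ne_top hCs ENNReal.ofReal_ne_top) hWi)
  have hmain := S.ae_cells (R := fun k E x => ∀ τ : ℝ, h x ≤ τ →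
        (μ E)⁻¹ * ∫⁻ y in E, ENNReal.ofReal (u y ^ (b * s)) ∂μ ≤ ENNReal.ofReal (τ ^ (b * s)) →
        μ E ^ (γ * s - 1) * ∫⁻ y in E, f y ^ s ∂μ ≤ ENNReal.ofReal (K * (τ ^ (-(γ * s)) * G x τ ^ s)))
    (fun k x0 => hK' (S.Q k x0) (hFam k x0) (S.measQ k x0) (by rw [volQ]; exact S.Vpos k)
      (by rw [volQ]; exact S.Vtop k) (fun y => f y ^ s) u hu hhu
      ((setLIntegral_le_lintegral _ _).trans hui) (by
        filter_upwards [ae_restrict_of_ae hfu] with y hy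
        have := hG.pos y _ (hu0 y)
        rw [← Real.mul_rpow hC0.le this.le, ← ENNReal.ofReal_rpow_of_pos (by positivity)]
        exact ENNReal.rpow_le_rpow hy hs0.le))
  refine ⟨fun x => h x + (W x).toReal, hh.meas.add hWm.ennreal_toReal, fun x => by simp, ?_, ?_⟩
  · calc ∫⁻ x, ENNReal.ofReal (h x + (W x).toReal) ∂μ
        ≤ ∫⁻ x, (ENNReal.ofReal (h x) + W x) ∂μ := by
          refine lintegral_mono fun x => ?_
          refine ENNReal.ofReal_add_le.trans ?_
          gcongr
          exact ENNReal.ofReal_toReal_le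
      _ = ∫⁻ x, ENNReal.ofReal (h x) ∂μ + ∫⁻ x, W x ∂μ := lintegral_add_left hh.meas.ennreal_ofReal _
      _ ≤ I := add_le_add le_rfl hWi
      _ = ENNReal.ofReal I.toReal := (ENNReal.ofReal_toReal hIt).symm
      _ ≤ _ := ENNReal.ofReal_le_ofReal (by have : 0 ≤ K ^ (1 / s) := by positivity
                                            linarith)
  · filter_upwards [hmain, hWt] with x hx hxt
    set τ := h x + (W x).toReal with hτ
    have hτ0 : 0 < τ := by have := hh.pos x; positivity
    have p := hG.pos x τ hτ0
    refine iSup_le fun k => ?_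
    have h1 := hx k τ (by simp [hτ]) (by
      rw [volQ]
      calc (S.V k)⁻¹ * ∫⁻ y in S.Q k x, ENNReal.ofReal (u y ^ (b * s)) ∂μ = S.E k ub x := rfl
        _ ≤ S.M ub x := le_iSup (fun k => S.E k ub x) k
        _ = W x ^ (b * s) := by
          simp only [hW]
          rw [← ENNReal.rpow_mul, one_div_mul_cancel hbs0.ne', ENNReal.rpow_one]
        _ ≤ ENNReal.ofReal τ ^ (b * s) := by
          refine ENNReal.rpow_le_rpow ?_ hbs0.le
          rw [← ENNReal.ofReal_toReal hxt.ne]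
          exact ENNReal.ofReal_le_ofReal (by have := hh.pos x; linarith)
        _ = _ := ENNReal.ofReal_rpow_of_pos hτ0)
    rw [volQ] at h1
    have h2 : S.V k ^ γ * S.E k (fun y => f y ^ s) x ^ (1 / s) =
        (S.V k ^ (γ * s - 1) * ∫⁻ y in S.Q k x, f y ^ s ∂μ) ^ (1 / s) := by
      unfold E
      rw [← ENNReal.rpow_neg_one, sub_eq_add_neg, ENNReal.rpow_add _ _ (S.Vpos k) (S.Vtop k),
        mul_assoc, ENNReal.mul_rpow_of_nonneg (S.V k ^ (γ * s)) _ (by positivity : 0 ≤ 1 / s),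
        ← ENNReal.rpow_mul, mul_assoc γ, mul_one_div_cancel hs0.ne', mul_one]
    rw [h2]
    refine (ENNReal.rpow_le_rpow h1 (by positivity : 0 ≤ 1 / s)).trans ?_
    rw [ENNReal.ofReal_rpow_of_nonneg (by positivity) (by positivity)]
    refine ENNReal.ofReal_le_ofReal ?_
    rw [Real.mul_rpow hK (by positivity), ← neg_mul, Real.rpow_mul hτ0.le,
      ← Real.mul_rpow (by positivity) p.le, ← Real.rpow_mul (by positivity),
      mul_one_div_cancel hs0.ne', Real.rpow_one]
    gcongr
    have : 0 ≤ I.toReal := ENNReal.toReal_nonneg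
    linarith

/-- Lemma B. -/
lemma le_Ms_of_osc {b : X → ℝ} {β : ℝ≥0∞} (hb : S.Osc b β) {m : ℕ} (hm : 2 ≤ m) :
    ∃ K : ℝ≥0∞, K ≠ ∞ ∧ ∀ (γ : ℝ) (f : X → ℝ≥0∞), AEMeasurable f μ → ∀ k x,
      S.V k ^ γ * S.E k (fun y => ‖b y - S.bav b k x‖ₑ * f y) x ≤
        K * S.Ms γ ((m : ℝ) / ((m : ℝ) - 1)) f x := by
  obtain ⟨K, hK, hK'⟩ := hb.N_moment m (by omega)
  have hm1 : (1 : ℝ) < m := by exact_mod_cast (by omega : 1 < m)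
  have hpq : (m : ℝ).HolderConjugate ((m : ℝ) / ((m : ℝ) - 1)) := Real.HolderConjugate.conjExponent hm1
  refine ⟨K ^ (1 / (m : ℝ)), ENNReal.rpow_ne_top_of_nonneg (by positivity) hK, ?_⟩
  intro γ f hf k x
  have h1 : S.E k (fun y => ‖b y - S.bav b k x‖ₑ * f y) x ≤ S.E k (fun y => S.N b k y * f y) x := by
    unfold E
    gcongr 1
    refine lintegral_mono_ae ?_
    filter_upwards [ae_restrict_of_ae hb.le_N, ae_restrict_mem (S.measQ k x)] with y hy hyQ
    have := hy k
    rw [S.lev_bav b k y x hyQ] at this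
    gcongr
  have h2 := S.E_holder hpq k (S.measurable_N b k).aemeasurable hf x
  have h3 : S.E k (fun y => S.N b k y ^ (m : ℝ)) x ≤ K := by
    simp_rw [ENNReal.rpow_natCast]; exact hK' k x
  calc S.V k ^ γ * S.E k (fun y => ‖b y - S.bav b k x‖ₑ * f y) x
      ≤ S.V k ^ γ * (K ^ (1 / (m : ℝ)) * S.E k (fun y => f y ^ ((m : ℝ) / ((m : ℝ) - 1))) x ^
          (1 / ((m : ℝ) / ((m : ℝ) - 1)))) := by
        gcongr
        refine h1.trans (h2.trans ?_)
        gcongr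
    _ = K ^ (1 / (m : ℝ)) * (S.V k ^ γ * S.E k (fun y => f y ^ ((m : ℝ) / ((m : ℝ) - 1))) x ^
          (1 / ((m : ℝ) / ((m : ℝ) - 1)))) := by ring
    _ ≤ _ := by
        gcongr
        exact le_iSup (fun k => S.V k ^ γ * S.E k (fun y => f y ^ ((m : ℝ) / ((m : ℝ) - 1))) x ^
          (1 / ((m : ℝ) / ((m : ℝ) - 1)))) k

end DS

set_option linter.unusedVariables false

namespace DS

variable {X : Type*} [MeasurableSpace X] {μ : Measure X} {ι : Type*} [Countable ι]
variable (S : DS μ ι)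

/-- The first part of the commutator. -/
noncomputable def F1 (γ : ℝ) (b : X → ℝ) (f : X → ℝ≥0∞) (N : ℕ) (x : X) : ℝ≥0∞ :=
  ⨆ (k : ℤ) (_ : -(N : ℤ) ≤ k), ‖b x - S.bav b k x‖ₑ * (S.V k ^ γ * S.E k f x)

lemma measurable_F1 (γ : ℝ) {b : X → ℝ} (hb : Measurable b) (f : X → ℝ≥0∞) (N : ℕ) :
    Measurable (S.F1 γ b f N) := by
  refine Measurable.iSup fun k => Measurable.iSup fun _ => ?_
  exact (hb.sub (S.measurable_bav b k)).enorm.mul ((S.measurable_E k f).const_mul _)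

lemma Ms_one (γ : ℝ) (f : X → ℝ≥0∞) (x : X) : S.Ms γ 1 f x = ⨆ k, S.V k ^ γ * S.E k f x := by
  unfold Ms; simp

/-- Lemma C. -/
lemma F1_dual {b : X → ℝ} {β : ℝ≥0∞} (hb : S.Osc b β) {m : ℕ} (hm : 2 ≤ m) :
    ∃ K : ℝ≥0∞, K ≠ ∞ ∧ ∀ (γ : ℝ) (f : X → ℝ≥0∞), (∀ᵐ x ∂μ, S.Ms γ 1 f x < ∞) →
      ∀ (N : ℕ) (g : X → ℝ≥0∞), AEMeasurable g μ →
      ∫⁻ x, S.F1 γ b f N x * g x ∂μ ≤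
        K * ∫⁻ x, S.Ms γ 1 f x * S.Ms 0 ((m : ℝ) / ((m : ℝ) - 1)) g x ∂μ := by
  obtain ⟨K, hK, hK'⟩ := hb.N_moment m (by omega)
  obtain ⟨C, hC0, hC, hC'⟩ := dy_ge (a := 1) one_pos
  have hm1 : (1 : ℝ) < m := by exact_mod_cast (by omega : 1 < m)
  set s : ℝ := (m : ℝ) / ((m : ℝ) - 1) with hs
  have hpq : (m : ℝ).HolderConjugate s := Real.HolderConjugate.conjExponent hm1
  refine ⟨4 * K ^ (1 / (m : ℝ)) * C, ENNReal.mul_ne_top (ENNReal.mul_ne_top (by simp)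
    (ENNReal.rpow_ne_top_of_nonneg (by positivity) hK)) hC, ?_⟩
  intro γ f hfin N g hg
  set A := S.Ms γ 1 f with hA
  set Mg := S.Ms 0 s g with hMg
  have hAm : Measurable A := S.measurable_Ms _ _ _
  have hMgm : Measurable Mg := S.measurable_Ms _ _ _
  set P : ℤ → ℤ → X → Prop := fun j k x => (2 : ℝ≥0∞) ^ j < S.V k ^ γ * S.E k f x with hPdef
  have hP : ∀ j k, S.Lev k (P j k) := fun j k x y hxy => by
    simp only [hPdef, S.lev_E k f x y hxy]
  set T : ℤ → ℤ → X → ℝ≥0∞ := fun j l => (St (P j) (-(N : ℤ)) l).indicator 1 with hT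
  have hTlev : ∀ j l, S.Lev l (T j l) := by
    intro j m y z hyz
    have := S.lev_St (hP j) (-(N : ℤ)) m y z hyz
    simp only [eq_iff_iff] at this
    simp only [hT]
    by_cases hy : y ∈ St (P j) (-(N : ℤ)) m
    · simp [hy, this.1 hy]
    · have hz : z ∉ St (P j) (-(N : ℤ)) m := fun h => hy (this.2 h)
      simp [hy, hz]
  have hTm : ∀ j m, Measurable (T j m) := fun j m => Lev.measurable S (hTlev j m)
  have h2 : (2 : ℝ≥0∞) ≠ 0 := by norm_num
  have h2' : (2 : ℝ≥0∞) ≠ ∞ := by simp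
  -- pointwise
  have hpt : ∀ᵐ x ∂μ, S.F1 γ b f N x ≤ ∑' j, ∑' l, 4 * 2 ^ j * (T j l x * S.N b l x) := by
    filter_upwards [hfin, hb.le_N] with x hx hN
    refine iSup₂_le fun k hk => ?_
    set ak := S.V k ^ γ * S.E k f x with hak
    have hakA : ak ≤ A x := by
      rw [hA, S.Ms_one]; exact le_iSup (fun k => S.V k ^ γ * S.E k f x) k
    by_cases h0 : ak = 0
    · rw [h0, mul_zero]; exact zero_le
    obtain ⟨j, hj1, hj2⟩ := ENNReal.exists_mem_Ioc_zpow h0 (hakA.trans_lt hx).ne (y := 2)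
      (by norm_num) (by simp)
    obtain ⟨l, hlk, hl⟩ := St_exists (P := P j) hk hj1
    refine le_trans ?_ ((ENNReal.le_tsum l).trans (ENNReal.le_tsum j))
    have hbk : ‖b x - S.bav b k x‖ₑ ≤ 2 * S.N b l x := by
      calc ‖b x - S.bav b k x‖ₑ = ‖(b x - S.bav b l x) - (S.bav b k x - S.bav b l x)‖ₑ := by
            congr 1; ring
        _ ≤ ‖b x - S.bav b l x‖ₑ + ‖S.bav b k x - S.bav b l x‖ₑ := enorm_sub_le
        _ ≤ S.N b l x + S.N b l x := by
            gcongr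
            · exact hN l
            · exact le_iSup₂ (f := fun (k : ℤ) (_ : l ≤ k) => ‖S.bav b k x - S.bav b l x‖ₑ) k hlk
        _ = _ := (two_mul _).symm
    have hT1 : T j l x = 1 := by simp [hT, hl]
    rw [hT1, one_mul]
    have e2 : (2 : ℝ≥0∞) ^ (j + 1) = 2 * 2 ^ j := by
      rw [ENNReal.zpow_add h2 h2', zpow_one, mul_comm]
    calc ‖b x - S.bav b k x‖ₑ * ak ≤ (2 * S.N b l x) * (2 * 2 ^ j) := by
          rw [← e2]; gcongr
      _ = _ := by ring
  have hterm : ∀ j l, ∫⁻ x, 4 * 2 ^ j * (T j l x * S.N b l x) * g x ∂μ ≤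
      4 * 2 ^ j * K ^ (1 / (m : ℝ)) * ∫⁻ x, T j l x * Mg x ∂μ := by
    intro j l
    have hNg : AEMeasurable (fun x => S.N b l x * g x) μ := (S.measurable_N b l).aemeasurable.mul hg
    calc ∫⁻ x, 4 * 2 ^ j * (T j l x * S.N b l x) * g x ∂μ
        = 4 * 2 ^ j * ∫⁻ x, T j l x * (S.N b l x * g x) ∂μ := by
          have h9 : AEMeasurable (fun x => T j l x * (S.N b l x * g x)) μ :=
            (hTm j l).aemeasurable.mul hNg
          rw [← lintegral_const_mul'' _ h9]
          congr 1; ext x; ring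
      _ = 4 * 2 ^ j * ∫⁻ x, T j l x * S.E l (fun y => S.N b l y * g y) x ∂μ := by
          rw [S.lintegral_E l (hTlev j l) hNg]
      _ ≤ 4 * 2 ^ j * ∫⁻ x, T j l x * (K ^ (1 / (m : ℝ)) * Mg x) ∂μ := by
          gcongr with x
          refine (S.E_holder hpq l (S.measurable_N b l).aemeasurable hg x).trans ?_
          have h3 : S.E l (fun y => S.N b l y ^ (m : ℝ)) x ≤ K := by
            simp_rw [ENNReal.rpow_natCast]; exact hK' l x
          gcongr
          refine le_trans ?_ (le_iSup (fun k => S.V k ^ (0 : ℝ) *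
            S.E k (fun y => g y ^ s) x ^ (1 / s)) l)
          simp
      _ = _ := by
          have h9 : Measurable (fun x => T j l x * Mg x) := (hTm j l).mul hMgm
          rw [mul_assoc _ (K ^ (1 / (m : ℝ))), ← lintegral_const_mul _ h9]
          congr 2; ext x; ring
  have hsumT : ∀ j x, ∑' l, T j l x ≤ if (2 : ℝ≥0∞) ^ j < A x then 1 else 0 := by
    intro j x
    by_cases hy : ∃ l, x ∈ St (P j) (-(N : ℤ)) l
    · obtain ⟨l, hl⟩ := hy
      rw [tsum_eq_single l]
      · have : (2 : ℝ≥0∞) ^ j < A x := by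
          refine lt_of_lt_of_le hl.2.1 ?_
          rw [hA, S.Ms_one]; exact le_iSup (fun k => S.V k ^ γ * S.E k f x) l
        simp [hT, hl, this]
      · intro m' hm'
        have : x ∉ St (P j) (-(N : ℤ)) m' := fun h' =>
          Set.disjoint_left.1 (St_disj hm') h' hl
        simp [hT, this]
    · have : ∀ m, T j m x = 0 := fun m => by
        have : x ∉ St (P j) (-(N : ℤ)) m := fun h => hy ⟨m, h⟩
        simp [hT, this]
      simp [this]
  have hmeas1 : ∀ j l, AEMeasurable (fun x => 4 * 2 ^ j * (T j l x * S.N b l x) * g x) μ :=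
    fun j l => ((((hTm j l).mul (S.measurable_N b l)).const_mul _).aemeasurable).mul hg
  calc ∫⁻ x, S.F1 γ b f N x * g x ∂μ
      ≤ ∫⁻ x, ∑' j, ∑' l, 4 * 2 ^ j * (T j l x * S.N b l x) * g x ∂μ := by
        refine lintegral_mono_ae ?_
        filter_upwards [hpt] with x hx
        simp_rw [ENNReal.tsum_mul_right]
        gcongr
    _ = ∑' j, ∑' l, ∫⁻ x, 4 * 2 ^ j * (T j l x * S.N b l x) * g x ∂μ := by
        rw [lintegral_tsum fun j => AEMeasurable.tsum (hmeas1 j)]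
        congr 1; ext j
        rw [lintegral_tsum (hmeas1 j)]
    _ ≤ ∑' j, ∑' l, 4 * 2 ^ j * K ^ (1 / (m : ℝ)) * ∫⁻ x, T j l x * Mg x ∂μ :=
        ENNReal.tsum_le_tsum fun j => ENNReal.tsum_le_tsum fun l => hterm j l
    _ = ∑' j, 4 * 2 ^ j * K ^ (1 / (m : ℝ)) * ∫⁻ x, ∑' l, T j l x * Mg x ∂μ := by
        congr 1; ext j
        have h9 : ∀ l, AEMeasurable (fun x => T j l x * Mg x) μ :=
          fun l => ((hTm j l).mul hMgm).aemeasurable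
        rw [ENNReal.tsum_mul_left, lintegral_tsum h9]
    _ ≤ ∑' j : ℤ, 4 * 2 ^ j * K ^ (1 / (m : ℝ)) *
          ∫⁻ x, (if (2 : ℝ≥0∞) ^ j < A x then 1 else 0) * Mg x ∂μ := by
        refine ENNReal.tsum_le_tsum fun j => ?_
        gcongr with x
        rw [ENNReal.tsum_mul_right]
        gcongr
        exact hsumT j x
    _ = ∑' j : ℤ, 4 * K ^ (1 / (m : ℝ)) *
          ∫⁻ x, (if (2 : ℝ≥0∞) ^ j < A x then ((2 : ℝ≥0∞) ^ j) ^ (1 : ℝ) else 0) * Mg x ∂μ := by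
        congr 1; ext j
        rw [show 4 * 2 ^ j * K ^ (1 / (m : ℝ)) = (4 * K ^ (1 / (m : ℝ))) * 2 ^ j by ring, mul_assoc,
          ← lintegral_const_mul]
        · congr 2; ext x
          split_ifs <;> simp
        · exact (Measurable.ite (measurableSet_lt measurable_const hAm) measurable_const
            measurable_const).mul hMgm
    _ = 4 * K ^ (1 / (m : ℝ)) * ∫⁻ x,
          (∑' j : ℤ, if (2 : ℝ≥0∞) ^ j < A x then ((2 : ℝ≥0∞) ^ j) ^ (1 : ℝ) else 0) * Mg x ∂μ := by
        rw [ENNReal.tsum_mul_left, ← lintegral_tsum]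
        · simp_rw [ENNReal.tsum_mul_right]
        · intro j
          exact ((Measurable.ite (measurableSet_lt measurable_const hAm) measurable_const
            measurable_const).mul hMgm).aemeasurable
    _ ≤ 4 * K ^ (1 / (m : ℝ)) * ∫⁻ x, (C * A x) * Mg x ∂μ := by
        gcongr with x
        simpa using hC' (A x)
    _ = _ := by
        simp_rw [mul_assoc C]
        have h9 : Measurable (fun x => A x * Mg x) := hAm.mul hMgm
        rw [lintegral_const_mul _ h9]; ring

end DS

set_option linter.unusedVariables false

/-- Relation between a Φ-function and (a regular version of) its inverse. -/
structure Link {X : Type*} [MeasurableSpace X] (μ : Measure X) (ψ : X → ℝ≥0 → ℝ≥0∞)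
    (H : X → ℝ → ℝ) (c Cl : ℝ) : Prop where
  meas : ∀ f : X → ℝ≥0, Measurable f → AEMeasurable (fun x => ψ x (f x)) μ
  mono : ∀ x, Monotone (ψ x)
  zero : ∀ x, ψ x 0 = 0
  c0 : 0 < c
  cl0 : 0 < Cl
  L1 : ∀ x t (τ : ℝ≥0), 0 < t → (τ : ℝ) < c * H x t → ψ x τ ≤ ENNReal.ofReal t
  L2 : ∀ x t (τ : ℝ≥0), 0 < t → ψ x τ ≤ ENNReal.ofReal t → (τ : ℝ) ≤ Cl * H x t
  one : ∃ β : ℝ, 0 < β ∧ ∀ᵐ x ∂μ, β ≤ H x 1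

namespace Link

variable {X : Type*} [MeasurableSpace X] {μ : Measure X} {Fam : Set (Set X)} {h : X → ℝ}
  {H : X → ℝ → ℝ} {a b C c Cl : ℝ} {ψ : X → ℝ≥0 → ℝ≥0∞}

lemma eq_zero (hl : Link μ ψ H c Cl) (hH : Nice μ Fam h H a b C) (ha : 0 < a) {x : X} {τ : ℝ≥0}
    (hτ : ψ x τ = 0) : τ = 0 := by
  have hC := hH.one
  have hcl := hl.cl0
  have h1 := hH.pos x 1 one_pos
  have key : ∀ t : ℝ, 0 < t → t ≤ 1 → (τ : ℝ) ≤ Cl * (C * t ^ a * H x 1) := by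
    intro t ht ht1
    refine (hl.L2 x t τ ht (by rw [hτ]; exact zero_le)).trans ?_
    have := hH.lo x t 1 ht ht1
    have h2 : (1 / t) ^ a = (t ^ a)⁻¹ := by rw [one_div, Real.inv_rpow ht.le]
    have h3 : 0 < t ^ a := by positivity
    rw [h2] at this
    have h4 : H x t ≤ C * t ^ a * H x 1 := by
      rw [inv_mul_le_iff₀ h3] at this
      linarith
    gcongr
  have lim : Tendsto (fun t : ℝ => Cl * (C * t ^ a * H x 1)) (nhdsWithin 0 (Ioi 0)) (nhds 0) := by
    have : Tendsto (fun t : ℝ => t ^ a) (nhdsWithin 0 (Ioi 0)) (nhds 0) := by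
      have := (Real.continuousAt_rpow_const 0 a (Or.inr ha.le)).tendsto
      rw [Real.zero_rpow ha.ne'] at this
      exact this.mono_left nhdsWithin_le_nhds
    have := ((this.const_mul C).mul_const (H x 1)).const_mul Cl
    simpa using this
  have : (τ : ℝ) ≤ 0 := by
    refine ge_of_tendsto lim ?_
    filter_upwards [Ioc_mem_nhdsGT (show (0 : ℝ) < 1 by norm_num)] with t ht
    exact key t ht.1 ht.2
  exact_mod_cast le_antisymm this τ.2

lemma doubling (hl : Link μ ψ H c Cl) (hH : Nice μ Fam h H a b C) (ha : 0 < a) :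
    ∃ K : ℝ, 1 ≤ K ∧ ∀ x τ, ψ x (2 * τ) ≤ ENNReal.ofReal K * ψ x τ := by
  have hC := hH.one
  have hcl := hl.cl0
  have hc := hl.c0
  set K : ℝ := (2 * Cl * C / c + 1) ^ (1 / a) with hK
  have hKa : K ^ a = 2 * Cl * C / c + 1 := by
    rw [hK, ← Real.rpow_mul (by positivity), one_div_mul_cancel ha.ne', Real.rpow_one]
  have hK1 : 1 ≤ K := Real.one_le_rpow (by have : 0 < 2 * Cl * C / c := by positivity
                                           linarith) (by positivity)
  refine ⟨K, hK1, fun x τ => ?_⟩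
  rcases eq_or_ne (ψ x τ) 0 with h0 | h0
  · have := hl.eq_zero hH ha h0
    simp [this, hl.zero]
  rcases eq_or_ne (ψ x τ) ∞ with h1 | h1
  · rw [h1, ENNReal.mul_top]; · exact le_top
    simp; linarith
  set t := (ψ x τ).toReal with ht
  have ht0 : 0 < t := ENNReal.toReal_pos h0 h1
  have e : ψ x τ = ENNReal.ofReal t := (ENNReal.ofReal_toReal h1).symm
  have e1 := hl.L2 x t τ ht0 e.le
  have e2 := hH.lo x t (K * t) ht0 (by nlinarith)
  rw [mul_div_cancel_right₀ _ ht0.ne', hKa] at e2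
  rw [e, ← ENNReal.ofReal_mul (by linarith)]
  refine hl.L1 x _ _ (by positivity) ?_
  have p := hH.pos x t ht0
  push_cast
  have e3 : (2 * Cl * C + c) * H x t ≤ C * (c * H x (K * t)) := by
    have : (2 * Cl * C / c + 1) * H x t * c = (2 * Cl * C + c) * H x t := by field_simp
    nlinarith
  have e4 : C * (2 * Cl * H x t) < C * (c * H x (K * t)) := by nlinarith [mul_pos hc p]
  have e5 : 2 * Cl * H x t < c * H x (K * t) := lt_of_mul_lt_mul_left e4 (by linarith)
  linarith

end Link

lemma Nice.mul_dual_le {X : Type*} [MeasurableSpace X] {μ : Measure X} {Fam : Set (Set X)} {h : X → ℝ}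
    {H : X → ℝ → ℝ} {a b C : ℝ} (hH : Nice μ Fam h H a b C) (hh : HOK μ h) (hb : b ≤ 1) (ha : a < 1)
    {x : X} {w w' : ℝ} (hw : 0 < w) (hw' : 0 < w') :
    H x w * (w' / H x w') ≤ C * (w + w') := by
  have hC := hH.one
  have p := hH.pos x w hw
  have p' := hH.pos x w' hw'
  rcases le_total w w' with hle | hle
  · have := hH.almost_inc (x := x) hw hle
    calc H x w * (w' / H x w') ≤ (C * H x w') * (w' / H x w') := by gcongr
      _ = C * w' := by field_simp
      _ ≤ _ := by nlinarith
  · have := (hH.dual hh hb ha).almost_inc (x := x) hw' hle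
    calc H x w * (w' / H x w') ≤ H x w * (C * (w / H x w)) := by gcongr
      _ = C * w := by field_simp
      _ ≤ _ := by nlinarith

namespace DS

variable {X : Type*} [MeasurableSpace X] {μ : Measure X} {ι : Type*} [Countable ι]
variable (S : DS μ ι) {Fam : Set (Set X)} {h : X → ℝ}
  {H : X → ℝ → ℝ} {a b C c Cl : ℝ} {ψ : X → ℝ≥0 → ℝ≥0∞}

lemma dual_key (hl : Link μ ψ H c Cl) (hH : Nice μ Fam h H a b C) (hh : HOK μ h)
    (hFam : ∀ k x, S.Q k x ∈ Fam) (ha : 0 < a) (ha1 : a < 1) (hb : b ≤ 1) {s : ℝ} (hs : 1 ≤ s)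
    (has : (1 - a) * s < 1) {KA : ℝ} (hKA : 0 ≤ KA) {Kp : ℝ≥0∞} (hKp : Kp ≠ ∞) :
    ∃ K : ℝ, 0 ≤ K ∧ ∀ (F : X → ℝ≥0), Measurable F → ∫⁻ x, ψ x (F x) ∂μ ≤ 1 →
      ∀ A, Dom μ h H KA A → ∀ l : ℝ≥0, (∀ g, AEMeasurable g μ →
        ∫⁻ x, (l * F x : ℝ≥0∞) * g x ∂μ ≤ Kp * ∫⁻ x, A x * S.Ms 0 s g x ∂μ) →
      l * ∫⁻ x, ψ x (F x) ∂μ ≤ ENNReal.ofReal K := by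
  have hC := hH.one
  have hc := hl.c0
  have hθ := hH.dual hh hb ha1
  set Ih := (∫⁻ x, ENNReal.ofReal (h x) ∂μ).toReal with hIh
  set C0 : ℝ := 1 + Ih + C * (C * 2 ^ b / c) with hC0
  have hIh0 : 0 ≤ Ih := ENNReal.toReal_nonneg
  have hC0p : 0 < C0 := by positivity
  obtain ⟨K, hK, hK'⟩ := S.dom_Ms hθ hh hFam (γ := 0) le_rfl hθ.a0 hs has hC0p
  refine ⟨Kp.toReal * (KA * K * C * (KA + K)), by positivity, ?_⟩
  intro F hF hI A hA l hdual
  set v : X → ℝ≥0∞ := fun x => ψ x (F x) with hv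
  have hvm : AEMeasurable v μ := hl.meas F hF
  set g : X → ℝ≥0∞ := fun x => if F x = 0 then 0 else v x / F x with hg
  have hgm : AEMeasurable g μ := by
    have : g = fun x => ({x | F x = 0}ᶜ : Set X).indicator (fun x => v x / F x) x := by
      ext x; simp only [hg, Set.indicator]; by_cases hx : F x = 0 <;> simp [hx]
    rw [this]
    refine AEMeasurable.indicator (hvm.div hF.coe_nnreal_ennreal.aemeasurable) ?_
    exact (hF (measurableSet_singleton 0)).compl
  have hvfin : ∀ᵐ x ∂μ, v x < ∞ := ae_lt_top' hvm (ne_top_of_le_ne_top (by simp) hI)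
  have hFg : ∀ᵐ x ∂μ, (l * F x : ℝ≥0∞) * g x = l * v x := by
    filter_upwards [hvfin] with x hx
    simp only [hg]
    split_ifs with h0
    · simp [hv, h0, hl.zero]
    · rw [mul_assoc, ENNReal.mul_div_cancel (by simpa using h0) (by simp)]
  have hgdom : Dom μ h (fun x t => t / H x t) C0 g := by
    refine ⟨fun x => h x + (hvm.mk v x).toReal, hh.meas.add hvm.measurable_mk.ennreal_toReal,
      fun x => by simp, ?_, ?_⟩
    · have e : ∀ x, ENNReal.ofReal (h x + (hvm.mk v x).toReal) =
          ENNReal.ofReal (h x) + ENNReal.ofReal ((hvm.mk v x).toReal) := fun x =>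
        ENNReal.ofReal_add (hh.pos x).le ENNReal.toReal_nonneg
      simp_rw [e]
      rw [lintegral_add_left hh.meas.ennreal_ofReal]
      have e2 : ∫⁻ x, ENNReal.ofReal ((hvm.mk v x).toReal) ∂μ ≤ 1 := by
        refine le_trans (lintegral_mono_ae ?_) hI
        filter_upwards [hvm.ae_eq_mk] with x hx
        rw [← hx]; exact ENNReal.ofReal_toReal_le
      calc _ ≤ ENNReal.ofReal Ih + ENNReal.ofReal 1 := by
            rw [hIh, ENNReal.ofReal_toReal hh.int]; simpa using add_le_add le_rfl e2
        _ = ENNReal.ofReal (Ih + 1) := (ENNReal.ofReal_add hIh0 (by norm_num)).symm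
        _ ≤ _ := ENNReal.ofReal_le_ofReal (by
            have : 0 ≤ C * (C * 2 ^ b / c) := by positivity
            linarith)
    · filter_upwards [hvm.ae_eq_mk, hvfin] with x hx hfin
      rw [← hx]
      simp only [hg]
      split_ifs with h0
      · simp
      rcases eq_or_ne (v x) 0 with hv0 | hv0
      · simp [hv0]
      set t := (v x).toReal with ht
      have ht0 : 0 < t := ENNReal.toReal_pos hv0 hfin.ne
      have e : v x = ENNReal.ofReal t := (ENNReal.ofReal_toReal hfin.ne).symm
      have e1 : c * H x (t / 2) ≤ F x := by
        by_contra! hcon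
        have := hl.L1 x (t / 2) (F x) (by positivity) hcon
        change v x ≤ _ at this
        rw [e, ENNReal.ofReal_le_ofReal_iff (by positivity)] at this
        linarith
      have e2 := hH.up x (t / 2) t (by positivity) (by linarith)
      rw [show t / (t / 2) = 2 by field_simp] at e2
      have p1 := hH.pos x t ht0
      have p2 := hH.pos x (t / 2) (by positivity)
      have pF : (0 : ℝ) < F x := by positivity
      have e3 : t / F x ≤ C * 2 ^ b / c * (t / H x t) := by
        rw [div_mul_div_comm, div_le_div_iff₀ pF (by positivity)]
        have : c * H x t ≤ C * 2 ^ b * F x := by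
          calc c * H x t ≤ c * (C * 2 ^ b * H x (t / 2)) := by gcongr
            _ = C * 2 ^ b * (c * H x (t / 2)) := by ring
            _ ≤ _ := by gcongr
        nlinarith
      have e4 := hθ.almost_inc (x := x) ht0 (show t ≤ h x + t by have := hh.pos x; linarith)
      have e5 : v x / F x = ENNReal.ofReal (t / F x) := by
        rw [e, ENNReal.ofReal_div_of_pos pF]; simp
      rw [e5]
      refine ENNReal.ofReal_le_ofReal (e3.trans ?_)
      have p3 : 0 ≤ (h x + t) / H x (h x + t) := (hθ.pos x (h x + t) (by have := hh.pos x; linarith)).le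
      calc C * 2 ^ b / c * (t / H x t) ≤ C * 2 ^ b / c * (C * ((h x + t) / H x (h x + t))) := by gcongr
        _ = (C * (C * 2 ^ b / c)) * ((h x + t) / H x (h x + t)) := by ring
        _ ≤ _ := by gcongr; linarith
  obtain ⟨w', w1', w2', w3', w4'⟩ := hK' g hgdom
  obtain ⟨w, w1, w2, w3, w4⟩ := hA
  have hmain : ∫⁻ x, A x * S.Ms 0 s g x ∂μ ≤ ENNReal.ofReal (KA * K * C * (KA + K)) := by
    calc ∫⁻ x, A x * S.Ms 0 s g x ∂μ
        ≤ ∫⁻ x, ENNReal.ofReal (KA * K * C) * (ENNReal.ofReal (w x) + ENNReal.ofReal (w' x)) ∂μ := by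
          refine lintegral_mono_ae ?_
          filter_upwards [w4, w4'] with x hx hx'
          have q : 0 < w x := (hh.pos x).trans_le (w2 x)
          have q' : 0 < w' x := (hh.pos x).trans_le (w2' x)
          refine (mul_le_mul' hx hx').trans ?_
          have p1 := hH.pos x _ q
          rw [← ENNReal.ofReal_mul (by positivity), ← ENNReal.ofReal_add q.le q'.le,
            ← ENNReal.ofReal_mul (by positivity)]
          refine ENNReal.ofReal_le_ofReal ?_
          have := hH.mul_dual_le hh hb ha1 (x := x) q q'
          rw [neg_zero, Real.rpow_zero, one_mul]
          calc KA * H x (w x) * (K * (w' x / H x (w' x)))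
              = KA * K * (H x (w x) * (w' x / H x (w' x))) := by ring
            _ ≤ KA * K * (C * (w x + w' x)) := by gcongr
            _ = _ := by ring
      _ = ENNReal.ofReal (KA * K * C) * (∫⁻ x, ENNReal.ofReal (w x) ∂μ + ∫⁻ x, ENNReal.ofReal (w' x) ∂μ) := by
          have h9 : Measurable (fun x => ENNReal.ofReal (w x) + ENNReal.ofReal (w' x)) :=
            w1.ennreal_ofReal.add w1'.ennreal_ofReal
          rw [lintegral_const_mul _ h9,
            lintegral_add_left w1.ennreal_ofReal]
      _ ≤ ENNReal.ofReal (KA * K * C) * (ENNReal.ofReal KA + ENNReal.ofReal K) := by gcongr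
      _ = _ := by
          rw [← ENNReal.ofReal_add hKA hK, ← ENNReal.ofReal_mul (by positivity)]
  calc l * ∫⁻ x, ψ x (F x) ∂μ = ∫⁻ x, (l * F x : ℝ≥0∞) * g x ∂μ := by
        rw [lintegral_congr_ae hFg, lintegral_const_mul'' _ hvm]
    _ ≤ _ := hdual g hgm
    _ ≤ Kp * ENNReal.ofReal (KA * K * C * (KA + K)) := by gcongr
    _ = _ := by rw [ENNReal.ofReal_mul ENNReal.toReal_nonneg, ENNReal.ofReal_toReal hKp]

/-- Duality lemma. -/
lemma dual_dom (hl : Link μ ψ H c Cl) (hH : Nice μ Fam h H a b C) (hh : HOK μ h)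
    (hFam : ∀ k x, S.Q k x ∈ Fam) (ha : 0 < a) (ha1 : a < 1) (hb : b ≤ 1) {s : ℝ} (hs : 1 ≤ s)
    (has : (1 - a) * s < 1) {KA : ℝ} (hKA : 0 ≤ KA) {Kp : ℝ≥0∞} (hKp : Kp ≠ ∞) :
    ∃ K : ℝ, 0 ≤ K ∧ ∀ (F : ℕ → X → ℝ≥0), (∀ N, Measurable (F N)) → Monotone F →
      (∀ N x, F N x ≤ N) → (∀ N, ∃ T : Set X, MeasurableSet T ∧ μ T ≠ ∞ ∧ ∀ x ∉ T, F N x = 0) →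
      ∀ A, Dom μ h H KA A → (∀ N g, AEMeasurable g μ →
        ∫⁻ x, F N x * g x ∂μ ≤ Kp * ∫⁻ x, A x * S.Ms 0 s g x ∂μ) →
      Dom μ h H K (fun x => ⨆ N, (F N x : ℝ≥0∞)) := by
  have hC := hH.one
  have hc := hl.c0
  have hcl := hl.cl0
  obtain ⟨K5, hK5, key⟩ := S.dual_key hl hH hh hFam ha ha1 hb hs has hKA hKp
  obtain ⟨K3, hK3, dbl⟩ := hl.doubling hH ha
  obtain ⟨β, hβ, hβ'⟩ := hl.one
  set l0 : ℝ≥0 := ⟨K3 * K5 + 1, by positivity⟩ with hl0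
  have hl0p : (0 : ℝ) < l0 := by change (0 : ℝ) < K3 * K5 + 1; positivity
  have hl0p' : 0 < l0 := hl0p
  set Ih := (∫⁻ x, ENNReal.ofReal (h x) ∂μ).toReal with hIh
  have hIh0 : 0 ≤ Ih := ENNReal.toReal_nonneg
  refine ⟨1 + Ih + l0 * Cl, by positivity, ?_⟩
  intro F hFm hFmono hFN hFT A hA hdual
  have main : ∀ N, ∫⁻ x, ψ x (F N x / l0) ∂μ ≤ 1 := by
    intro N
    have hex : ∃ j : ℕ, ∫⁻ x, ψ x (F N x / (2 ^ j * l0)) ∂μ ≤ 1 := by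
      obtain ⟨T, hT, hTt, hT0⟩ := hFT N
      set t : ℝ := 1 / ((μ T).toReal + 1) with ht
      have hT0' : 0 ≤ (μ T).toReal := ENNReal.toReal_nonneg
      have ht0 : 0 < t := by positivity
      have ht1 : t ≤ 1 := by rw [ht, div_le_one (by positivity)]; linarith
      obtain ⟨j, hj⟩ := pow_unbounded_of_one_lt (N * C / (c * β * t ^ b) / l0) (one_lt_two)
      refine ⟨j, ?_⟩
      have hp : ∀ᵐ x ∂μ, ψ x (F N x / (2 ^ j * l0)) ≤ T.indicator (fun _ => ENNReal.ofReal t) x := by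
        filter_upwards [hβ'] with x hx
        by_cases hxT : x ∈ T
        · rw [Set.indicator_of_mem hxT]
          refine hl.L1 x t _ ht0 ?_
          have e1 := hH.up x t 1 ht0 ht1
          have e2 : (1 / t) ^ b = (t ^ b)⁻¹ := by rw [one_div, Real.inv_rpow ht0.le]
          have tb : 0 < t ^ b := by positivity
          have e3 : β * t ^ b ≤ C * H x t := by
            rw [e2] at e1
            have : β ≤ C * (t ^ b)⁻¹ * H x t := hx.trans e1
            calc β * t ^ b ≤ (C * (t ^ b)⁻¹ * H x t) * t ^ b := by gcongr
              _ = _ := by field_simp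
          have e4 : (N : ℝ) * C < c * β * t ^ b * (2 ^ j * l0) := by
            rw [div_div, div_lt_iff₀ (by positivity)] at hj
            linarith
          have e5 : (F N x : ℝ) ≤ N := by exact_mod_cast hFN N x
          push_cast
          rw [div_lt_iff₀ (by positivity)]
          have e6 : C * (F N x : ℝ) < C * (c * H x t * (2 ^ j * l0)) := by
            calc C * (F N x : ℝ) ≤ N * C := by rw [mul_comm]; gcongr
              _ < _ := e4
              _ = c * (2 ^ j * l0) * (β * t ^ b) := by ring
              _ ≤ c * (2 ^ j * l0) * (C * H x t) := by gcongr
              _ = _ := by ring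
          exact lt_of_mul_lt_mul_left e6 (by linarith)
        · simp [hxT, hT0 x hxT, hl.zero]
      refine (lintegral_mono_ae hp).trans ?_
      rw [lintegral_indicator hT, lintegral_const, Measure.restrict_apply_univ,
        ← ENNReal.ofReal_toReal hTt, ← ENNReal.ofReal_mul ht0.le]
      rw [← ENNReal.ofReal_one]
      refine ENNReal.ofReal_le_ofReal ?_
      rw [ht, div_mul_eq_mul_div, div_le_one (by positivity)]
      linarith
    classical
    have hj1 := Nat.find_spec hex
    have hjmin := fun m => Nat.find_min hex (m := m)
    set j := Nat.find hex with hj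
    rcases Nat.eq_zero_or_pos j with h0 | h0
    · rw [h0] at hj1; simpa using hj1
    exfalso
    have h2 := hjmin (j - 1) (by omega)
    obtain ⟨i, hi⟩ : ∃ i, j = i + 1 := ⟨j - 1, by omega⟩
    rw [hi] at hj1 h2
    simp only [add_tsub_cancel_right] at h2
    push Not at h2
    set J := ∫⁻ x, ψ x (F N x / (2 ^ (i + 1) * l0)) ∂μ with hJ
    have h3 : ∫⁻ x, ψ x (F N x / (2 ^ i * l0)) ∂μ ≤ ENNReal.ofReal K3 * J := by
      rw [hJ, ← lintegral_const_mul'' _ (hl.meas _ ((hFm N).div_const _))]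
      refine lintegral_mono fun x => ?_
      refine le_trans (le_of_eq ?_) (dbl x _)
      congr 1
      rw [pow_succ]; field_simp
    have h4 := key (fun x => F N x / (2 ^ (i + 1) * l0)) ((hFm N).div_const _) hj1 A hA
      (2 ^ (i + 1) * l0) (by
        intro g hg
        refine le_trans (le_of_eq ?_) (hdual N g hg)
        congr 1; ext x; congr 1
        rw [← ENNReal.coe_mul]
        congr 1
        field_simp)
    have h5 : (l0 : ℝ≥0∞) * J ≤ ENNReal.ofReal K5 := by
      refine le_trans ?_ h4
      gcongr
      refine le_mul_of_one_le_left (by positivity) (one_le_pow₀ (by norm_num))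
    have h6 : (l0 : ℝ≥0∞) ≤ ENNReal.ofReal (K3 * K5) := by
      calc (l0 : ℝ≥0∞) = l0 * 1 := by simp
        _ ≤ l0 * (ENNReal.ofReal K3 * J) := by gcongr; exact h2.le.trans h3
        _ = ENNReal.ofReal K3 * (l0 * J) := by ring
        _ ≤ ENNReal.ofReal K3 * ENNReal.ofReal K5 := by gcongr
        _ = _ := (ENNReal.ofReal_mul (by linarith)).symm
    have h7 : (l0 : ℝ≥0∞) = ENNReal.ofReal (K3 * K5 + 1) := by
      rw [← ENNReal.ofReal_coe_nnreal]; rfl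
    rw [h7, ENNReal.ofReal_le_ofReal_iff (by positivity)] at h6
    linarith
  set v : X → ℝ≥0∞ := fun x => ⨆ N, ψ x (F N x / l0) with hv
  have hvNm : ∀ N, AEMeasurable (fun x => ψ x (F N x / l0)) μ := fun N =>
    hl.meas _ ((hFm N).div_const _)
  have hvm : AEMeasurable v μ := AEMeasurable.iSup hvNm
  have hvi : ∫⁻ x, v x ∂μ ≤ 1 := by
    rw [hv, lintegral_iSup' hvNm]
    · exact iSup_le main
    · refine Eventually.of_forall fun x N M hNM => hl.mono x ?_
      have := hFmono hNM x
      gcongr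
  have hvfin : ∀ᵐ x ∂μ, v x < ∞ := ae_lt_top' hvm (ne_top_of_le_ne_top (by simp) hvi)
  refine ⟨fun x => h x + (hvm.mk v x).toReal, hh.meas.add hvm.measurable_mk.ennreal_toReal,
      fun x => by simp, ?_, ?_⟩
  · have e : ∀ x, ENNReal.ofReal (h x + (hvm.mk v x).toReal) =
        ENNReal.ofReal (h x) + ENNReal.ofReal ((hvm.mk v x).toReal) := fun x =>
      ENNReal.ofReal_add (hh.pos x).le ENNReal.toReal_nonneg
    simp_rw [e]
    rw [lintegral_add_left hh.meas.ennreal_ofReal]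
    have e2 : ∫⁻ x, ENNReal.ofReal ((hvm.mk v x).toReal) ∂μ ≤ 1 := by
      refine le_trans (lintegral_mono_ae ?_) hvi
      filter_upwards [hvm.ae_eq_mk] with x hx
      rw [← hx]; exact ENNReal.ofReal_toReal_le
    calc _ ≤ ENNReal.ofReal Ih + ENNReal.ofReal 1 := by
          rw [hIh, ENNReal.ofReal_toReal hh.int]; simpa using add_le_add le_rfl e2
      _ = ENNReal.ofReal (Ih + 1) := (ENNReal.ofReal_add hIh0 (by norm_num)).symm
      _ ≤ _ := ENNReal.ofReal_le_ofReal (by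
          have : 0 ≤ l0 * Cl := by positivity
          linarith)
  · filter_upwards [hvm.ae_eq_mk, hvfin] with x hx hfin
    rw [← hx]
    refine iSup_le fun N => ?_
    have hp := hh.pos x
    have htp : 0 < h x + (v x).toReal := by positivity
    have e1 := hl.L2 x (h x + (v x).toReal) (F N x / l0) htp (by
      refine (le_iSup (fun N => ψ x (F N x / l0)) N).trans ?_
      change v x ≤ _
      rw [← ENNReal.ofReal_toReal hfin.ne]
      refine ENNReal.ofReal_le_ofReal ?_
      rw [ENNReal.toReal_ofReal ENNReal.toReal_nonneg]
      linarith)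
    push_cast at e1
    rw [div_le_iff₀ hl0p] at e1
    rw [← ENNReal.ofReal_coe_nnreal]
    refine ENNReal.ofReal_le_ofReal (e1.trans ?_)
    have p := hH.pos x _ htp
    calc Cl * H x (h x + (v x).toReal) * l0 = (l0 * Cl) * H x (h x + (v x).toReal) := by ring
      _ ≤ _ := by gcongr; linarith

end DS

set_option linter.unusedVariables false

lemma exists_m {a b : ℝ} (ha : 0 < a) (ha1 : a < 1) (hb : b < 1) (hb0 : 0 < b) :
    ∃ m : ℕ, 2 ≤ m ∧ b * ((m : ℝ) / (m - 1)) < 1 ∧ (1 - a) * ((m : ℝ) / (m - 1)) < 1 ∧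
      1 ≤ (m : ℝ) / (m - 1) := by
  obtain ⟨m, hm⟩ := exists_nat_gt (max 2 (max (1 / (1 - b)) (1 / a)))
  have h1 : (2 : ℝ) < m := (le_max_left _ _).trans_lt hm
  have h2 : 1 / (1 - b) < m := ((le_max_left _ _).trans (le_max_right _ _)).trans_lt hm
  have h3 : 1 / a < m := ((le_max_right _ _).trans (le_max_right _ _)).trans_lt hm
  rw [div_lt_iff₀ (by linarith)] at h2
  rw [div_lt_iff₀ ha] at h3
  refine ⟨m, by exact_mod_cast h1.le, ?_, ?_, ?_⟩
  · rw [← mul_div_assoc, div_lt_one (by linarith)]; nlinarith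
  · rw [← mul_div_assoc, div_lt_one (by linarith)]; nlinarith
  · rw [le_div_iff₀ (by linarith)]; linarith

namespace DS

variable {X : Type*} [MeasurableSpace X] {μ : Measure X} {ι : Type*} [Countable ι]
variable (S : DS μ ι) {Fam : Set (Set X)} {h : X → ℝ}
  {G : X → ℝ → ℝ} {a b C c Cl : ℝ} {ψ : X → ℝ≥0 → ℝ≥0∞}

/-- Dyadic maximal commutator. -/
noncomputable def Cm (γ : ℝ) (b : X → ℝ) (f : X → ℝ≥0∞) (x : X) : ℝ≥0∞ :=
  ⨆ k, S.V k ^ γ * S.E k (fun y => ‖b x - b y‖ₑ * f y) x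

lemma F1_mono (γ : ℝ) (b : X → ℝ) (f : X → ℝ≥0∞) {N M : ℕ} (hNM : N ≤ M) (x : X) :
    S.F1 γ b f N x ≤ S.F1 γ b f M x := by
  refine iSup₂_le fun k hk => ?_
  exact le_iSup₂ (f := fun (k : ℤ) (_ : -(M : ℤ) ≤ k) =>
    ‖b x - S.bav b k x‖ₑ * (S.V k ^ γ * S.E k f x)) k (by omega)

lemma dom_Cm [SigmaFinite μ] {γ : ℝ} (hγ : 0 ≤ γ) (hγa : γ < a) (hab : a - γ < 1) (hb1 : b < 1)
    (hγb : γ < b)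
    (hG : Nice μ Fam h G a b C) (hh : HOK μ h)
    (hl : Link μ ψ (fun x t => t ^ (-γ) * G x t) c Cl)
    (hFam : ∀ k x, S.Q k x ∈ Fam) {b0 : X → ℝ} {β : ℝ≥0∞} (hb0 : S.Osc b0 β)
    {C0 : ℝ} (hC0 : 0 < C0) :
    ∃ K : ℝ, 0 ≤ K ∧ ∀ f : X → ℝ≥0∞, AEMeasurable f μ → Dom μ h G C0 f →
      Dom μ h (fun x t => t ^ (-γ) * G x t) K (S.Cm γ b0 f) := by
  have hH := hG.frac hh hγa.le hγb
  obtain ⟨m, hm2, hms1, hms2, hs1⟩ := exists_m (sub_pos.2 hγa) hab hb1 hG.b0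
  set s : ℝ := (m : ℝ) / (m - 1) with hs
  obtain ⟨KA, hKA, hA⟩ := S.dom_Ms hG hh hFam hγ hγa.le (le_refl (1 : ℝ)) (by linarith) hC0
  obtain ⟨KB, hKB, hB⟩ := S.dom_Ms hG hh hFam hγ hγa.le hs1 hms1 hC0
  obtain ⟨Kp, hKp, hdual⟩ := S.F1_dual hb0 hm2
  obtain ⟨Ko, hKo, hosc⟩ := S.le_Ms_of_osc hb0 hm2
  obtain ⟨Kd, hKd, hdom⟩ := S.dual_dom hl hH hh hFam (sub_pos.2 hγa) hab (by linarith) hs1 hms2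
    hKA hKp
  have hC := hG.one
  refine ⟨C * (Kd + (Ko.toReal + 1) * KB), by positivity, ?_⟩
  intro f hfm hf
  have hAf := hA f hf
  have hBf := hB f hf
  have hfin : ∀ᵐ x ∂μ, S.Ms γ 1 f x < ∞ := by
    obtain ⟨w, _, _, _, hw⟩ := hAf
    filter_upwards [hw] with x hx
    exact hx.trans_lt ENNReal.ofReal_lt_top
  have hd1 := hdom (fun N x => ((spanningSets μ N).indicator
    (fun x => min (N : ℝ≥0∞) (S.F1 γ b0 f N x)) x).toNNReal)
    (by
      intro N
      refine Measurable.ennreal_toNNReal ?_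
      exact (measurable_const.min (S.measurable_F1 γ hb0.meas f N)).indicator
        (measurableSet_spanningSets μ N))
    (by
      intro N M hNM x
      dsimp only
      refine ENNReal.toNNReal_mono ?_ ?_
      · by_cases hx : x ∈ spanningSets μ M <;> simp [hx]
      · by_cases hx : x ∈ spanningSets μ N
        · have hx' := monotone_spanningSets μ hNM hx
          simp only [hx, hx', Set.indicator_of_mem]
          exact min_le_min (by exact_mod_cast hNM) (S.F1_mono γ b0 f hNM x)
        · simp [hx])
    (by
      intro N x
      by_cases hx : x ∈ spanningSets μ N
      · simp only [hx, Set.indicator_of_mem]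
        have := ENNReal.toNNReal_mono (by simp) (min_le_left (N : ℝ≥0∞) (S.F1 γ b0 f N x))
        simpa using this
      · simp [hx])
    (by
      intro N
      exact ⟨spanningSets μ N, measurableSet_spanningSets μ N, (measure_spanningSets_lt_top μ N).ne,
        fun x hx => by simp [hx]⟩)
    _ hAf
    (by
      intro N g hg
      refine le_trans ?_ (hdual γ f hfin N g hg)
      gcongr with x
      refine ENNReal.coe_toNNReal_le_self.trans ?_
      by_cases hx : x ∈ spanningSets μ N <;> simp [hx])
  have hsup : ∀ x k, ‖b0 x - S.bav b0 k x‖ₑ * (S.V k ^ γ * S.E k f x) ≤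
      ⨆ N : ℕ, ((((spanningSets μ N).indicator
        (fun x => min (N : ℝ≥0∞) (S.F1 γ b0 f N x)) x).toNNReal : ℝ≥0) : ℝ≥0∞) := by
    intro x k
    refine le_of_forall_lt fun z hz => ?_
    have hzt : z ≠ ∞ := hz.ne_top
    obtain ⟨N1, hN1⟩ := ENNReal.exists_nat_gt hzt
    have hx : x ∈ ⋃ i, spanningSets μ i := by rw [iUnion_spanningSets]; trivial
    obtain ⟨N2, hN2⟩ := mem_iUnion.1 hx
    set N := max (max N1 N2) (-k).toNat with hN
    have hx' := monotone_spanningSets μ ((le_max_right N1 N2).trans (le_max_left _ (-k).toNat)) hN2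
    rw [← hN] at hx'
    refine lt_of_lt_of_le ?_ (le_iSup _ N)
    rw [ENNReal.coe_toNNReal (by simp [hx']), Set.indicator_of_mem hx']
    refine lt_min (hN1.trans_le ?_) (hz.trans_le ?_)
    · exact_mod_cast (le_max_left N1 N2).trans (le_max_left _ (-k).toNat)
    · refine le_iSup₂ (f := fun (k : ℤ) (_ : -(N : ℤ) ≤ k) =>
        ‖b0 x - S.bav b0 k x‖ₑ * (S.V k ^ γ * S.E k f x)) k ?_
      have := Int.self_le_toNat (-k)
      have : ((-k).toNat : ℤ) ≤ N := by exact_mod_cast le_max_right _ _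
      omega
  have hd2 := hBf.smul hh hH.pos (c := Ko.toReal + 1) (by simp) hKB
  refine (Dom.add hh hH hKd (by positivity) hd1 hd2).mono (Eventually.of_forall fun x => ?_)
  refine iSup_le fun k => ?_
  calc S.V k ^ γ * S.E k (fun y => ‖b0 x - b0 y‖ₑ * f y) x
      ≤ S.V k ^ γ * S.E k (fun y => ‖b0 x - S.bav b0 k x‖ₑ * f y + ‖b0 y - S.bav b0 k x‖ₑ * f y) x := by
        gcongr
        refine S.E_mono k (Eventually.of_forall fun y => ?_) x
        rw [← add_mul]
        gcongr
        calc ‖b0 x - b0 y‖ₑ = ‖(b0 x - S.bav b0 k x) - (b0 y - S.bav b0 k x)‖ₑ := by congr 1; ring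
          _ ≤ _ := enorm_sub_le
    _ = ‖b0 x - S.bav b0 k x‖ₑ * (S.V k ^ γ * S.E k f x) +
        S.V k ^ γ * S.E k (fun y => ‖b0 y - S.bav b0 k x‖ₑ * f y) x := by
        rw [S.E_add k (hfm.const_mul _), S.E_const_mul k _ hfm]
        ring
    _ ≤ _ := by
        refine add_le_add ?_ ?_
        · exact hsup x k
        · refine (hosc γ f hfm k x).trans ?_
          gcongr
          rw [ENNReal.ofReal_add ENNReal.toReal_nonneg (by norm_num), ENNReal.ofReal_toReal hKo]
          exact le_self_add

end DS

set_option linter.unusedVariables false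

section boxes
variable {n : ℕ}

lemma vol_box (l u : Fin n → ℝ) (B : Set (RSp n)) (I : Fin n → Set ℝ)
    (hI : ∀ i, MeasurableSet (I i)) (hB : B = {y | ∀ i, y i ∈ I i}) :
    MeasurableSet B ∧ volume B = ∏ i, volume (I i) := by
  have h1 : B = (@WithLp.ofLp 2 (Fin n → ℝ)) ⁻¹' (Set.univ.pi I) := by
    ext y; simp [hB]
  have h2 : MeasurableSet (Set.univ.pi I) := MeasurableSet.univ_pi hI
  refine ⟨?_, ?_⟩
  · rw [h1]; exact (PiLp.volume_preserving_ofLp (Fin n)).measurable h2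
  · rw [h1, (PiLp.volume_preserving_ofLp (Fin n)).measure_preimage h2.nullMeasurableSet,
      volume_pi_pi]

/-- A closed box around `x`. -/
def bx (x : RSp n) (r : ℝ) : Set (RSp n) := {y | ∀ i, |y i - x i| ≤ r}

lemma Cube.set_eq (Q : Cube n) : Q.set = bx Q.c Q.r := rfl

lemma bx_aux (x : RSp n) (r : ℝ) : bx x r = {y | ∀ i, y i ∈ Icc (x i - r) (x i + r)} := by
  ext y
  simp only [bx, Set.mem_ofPred_eq, mem_Icc, abs_le]
  refine forall_congr' fun i => ?_
  constructor <;> intro h <;> constructor <;> linarith [h.1, h.2]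

lemma meas_bx (x : RSp n) (r : ℝ) : MeasurableSet (bx x r) :=
  (vol_box 0 0 _ _ (fun i => measurableSet_Icc) (bx_aux x r)).1

lemma vol_bx (x : RSp n) (r : ℝ) : volume (bx x r) = ENNReal.ofReal (2 * r) ^ n := by
  rw [(vol_box 0 0 _ _ (fun i => measurableSet_Icc) (bx_aux x r)).2]
  simp only [Real.volume_Icc]
  have : ∀ i, x i + r - (x i - r) = 2 * r := fun i => by ring
  simp only [this, Finset.prod_const, Finset.card_univ, Fintype.card_fin]

lemma Cube.meas (Q : Cube n) : MeasurableSet Q.set := meas_bx _ _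
lemma Cube.vol (Q : Cube n) : volume Q.set = ENNReal.ofReal (2 * Q.r) ^ n := vol_bx _ _
lemma Cube.vol_ne_zero (Q : Cube n) : volume Q.set ≠ 0 := by
  rw [Q.vol]; exact pow_ne_zero _ (by simp [Q.r_pos])
lemma Cube.vol_ne_top (Q : Cube n) : volume Q.set ≠ ∞ := by
  rw [Q.vol]; exact ENNReal.pow_ne_top ENNReal.ofReal_ne_top

lemma bx_subset_ball (x : RSp n) {r : ℝ} (hr : 0 ≤ r) :
    bx x r ⊆ Metric.closedBall x (Real.sqrt n * r) := by
  intro y hy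
  rw [Metric.mem_closedBall, EuclideanSpace.dist_eq]
  rw [show Real.sqrt n * r = Real.sqrt (n * r ^ 2) by
    rw [Real.sqrt_mul (by positivity), Real.sqrt_sq hr]]
  refine Real.sqrt_le_sqrt ?_
  calc ∑ i, dist (y i) (x i) ^ 2 ≤ ∑ i : Fin n, r ^ 2 := by
        refine Finset.sum_le_sum fun i _ => ?_
        have := hy i
        rw [Real.dist_eq]
        gcongr
    _ = _ := by simp

lemma ball_subset_bx (x : RSp n) (r : ℝ) : Metric.closedBall x r ⊆ bx x r := by
  intro y hy i
  rw [Metric.mem_closedBall, dist_eq_norm] at hy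
  exact (PiLp.norm_apply_le (y - x) i).trans hy

lemma isCompact_bx (x : RSp n) {r : ℝ} (hr : 0 ≤ r) : IsCompact (bx x r) := by
  refine (isCompact_closedBall x (Real.sqrt n * r)).of_isClosed_subset ?_ (bx_subset_ball x hr)
  have : bx x r = ⋂ i, {y : RSp n | |y i - x i| ≤ r} := by ext y; simp [bx]
  rw [this]
  exact isClosed_iInter fun i => isClosed_le (by fun_prop) continuous_const

/-- Lebesgue differentiation along shrinking sets. -/
lemma lebesgue_diff (hn : 0 < n) {b : RSp n → ℝ} (hb : LocallyIntegrable b volume) :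
    ∀ᵐ x ∂(volume : Measure (RSp n)), ∀ (E : ℕ → Set (RSp n)) (r : ℕ → ℝ), (∀ j, 0 < r j) →
      Tendsto r atTop (nhds 0) → (∀ j, E j ⊆ bx x (r j)) →
      (∀ j, ENNReal.ofReal (r j) ^ n ≤ volume (E j)) →
      Tendsto (fun j => (volume (E j))⁻¹ * ∫⁻ y in E j, ‖b y - b x‖ₑ) atTop (nhds 0) := by
  filter_upwards [(IsUnifLocDoublingMeasure.vitaliFamily (volume : Measure (RSp n)) 1).ae_tendsto_lintegral_enorm_sub_div hb]
    with x hx E r hr0 hr hE hvol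
  have hsn : 0 < Real.sqrt n := by positivity
  have h1 : Tendsto (fun j => Real.sqrt n * r j) atTop (nhdsWithin 0 (Ioi 0)) := by
    rw [tendsto_nhdsWithin_iff]
    refine ⟨by simpa using hr.const_mul (Real.sqrt n), Eventually.of_forall fun j => ?_⟩
    exact mul_pos hsn (hr0 j)
  have h2 := hx.comp (IsUnifLocDoublingMeasure.tendsto_closedBall_filterAt volume
    (fun _ => x) _ h1 (Eventually.of_forall fun j => Metric.mem_closedBall_self (by have := hr0 j; positivity)))
  set c : ℝ≥0∞ := ENNReal.ofReal (2 * Real.sqrt n) ^ n with hc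
  have hct : c ≠ ∞ := ENNReal.pow_ne_top ENNReal.ofReal_ne_top
  have h3 := ENNReal.Tendsto.const_mul h2 (Or.inr hct) (a := c)
  rw [mul_zero] at h3
  refine tendsto_of_tendsto_of_tendsto_of_le_of_le tendsto_const_nhds h3 (fun j => zero_le) fun j => ?_
  dsimp only [Function.comp]
  have hrp : ENNReal.ofReal (r j) ^ n ≠ 0 := pow_ne_zero _ (by simpa using hr0 j)
  have hrt : ENNReal.ofReal (r j) ^ n ≠ ∞ := ENNReal.pow_ne_top ENNReal.ofReal_ne_top
  have hB : volume (Metric.closedBall x (Real.sqrt n * r j)) ≤ c * ENNReal.ofReal (r j) ^ n := by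
    refine (measure_mono (ball_subset_bx x _)).trans ?_
    rw [vol_bx, hc, ← mul_pow, ← ENNReal.ofReal_mul (by positivity)]
    rw [mul_assoc]
  have hsub : E j ⊆ Metric.closedBall x (Real.sqrt n * r j) := (hE j).trans (bx_subset_ball x (hr0 j).le)
  have hB0 : volume (Metric.closedBall x (Real.sqrt n * r j)) ≠ 0 := by
    have := (hvol j).trans (measure_mono hsub)
    intro h; rw [h] at this; exact hrp (le_antisymm this zero_le)
  have hBt : volume (Metric.closedBall x (Real.sqrt n * r j)) ≠ ∞ :=
    ne_top_of_le_ne_top (ENNReal.mul_ne_top hct hrt) hB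
  rw [ENNReal.div_eq_inv_mul, ← mul_assoc]
  refine mul_le_mul' ?_ (lintegral_mono_set hsub)
  refine (ENNReal.inv_le_inv.2 (hvol j)).trans ?_
  rw [ENNReal.inv_le_iff_le_mul (by simp [hrp]) (by simp [hrt])]
  rw [← mul_assoc, mul_comm _ c]
  calc (1 : ℝ≥0∞) = volume (Metric.closedBall x (Real.sqrt n * r j)) * (volume (Metric.closedBall x (Real.sqrt n * r j)))⁻¹ :=
        (ENNReal.mul_inv_cancel hB0 hBt).symm
    _ ≤ _ := by gcongr

end boxes

set_option linter.unusedVariables false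

section grids

/-- The shift of a grid. -/
noncomputable def gsh (s : Bool) (k : ℤ) : ℝ := if s then (if Even k then 1 / 3 else 2 / 3) else 0

lemma floor_half (u : ℝ) (d : ℤ) : ⌊(u + d) / 2⌋ = (⌊u⌋ + d) / 2 := by
  rw [Int.floor_eq_iff]
  have h1 := Int.floor_le u
  have h2 := Int.lt_floor_add_one u
  set m := (⌊u⌋ + d) / 2 with hm
  have h3 : 2 * m ≤ ⌊u⌋ + d := by omega
  have h4 : ⌊u⌋ + d ≤ 2 * m + 1 := by omega
  have h3' : 2 * (m : ℝ) ≤ ⌊u⌋ + d := by exact_mod_cast h3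
  have h4' : (⌊u⌋ : ℝ) + d ≤ 2 * m + 1 := by exact_mod_cast h4
  constructor <;> linarith

lemma gsh_nest (s : Bool) (k : ℤ) : ∃ d : ℤ, ∀ x : ℝ,
    2 ^ k * x + gsh s k = ((2 ^ (k + 1) * x + gsh s (k + 1)) + d) / 2 := by
  have h2 : (2 : ℝ) ^ (k + 1) = 2 * 2 ^ k := by rw [zpow_add_one₀ (by norm_num)]; ring
  unfold gsh
  by_cases hk : Even k
  · have hk' : ¬ Even (k + 1) := by rw [Int.even_add_one]; simpa using hk
    exact ⟨0, fun x => by cases s <;> simp [hk, hk', h2] <;> ring⟩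
  · have hk' : Even (k + 1) := by rw [Int.even_add_one]; simpa using hk
    cases s
    · exact ⟨0, fun x => by simp [h2]; ring⟩
    · exact ⟨1, fun x => by simp [hk, hk', h2]; ring⟩

lemma gsh_mem (k : ℤ) : 1 / 3 ≤ gsh true k ∧ gsh true k ≤ 2 / 3 := by
  unfold gsh; rw [if_pos rfl]; split_ifs <;> norm_num

/-- One-third trick. -/
lemma third {k : ℤ} {c r : ℝ} (hr : 2 ^ k * (6 * r) < 1) :
    ∃ s : Bool, ∀ y, |y - c| ≤ r → ⌊2 ^ k * y + gsh s k⌋ = ⌊2 ^ k * c + gsh s k⌋ := by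
  by_cases h : ∃ m : ℤ, 2 ^ k * (c - r) < m ∧ (m : ℝ) ≤ 2 ^ k * (c + r)
  · obtain ⟨m, h1, h2⟩ := h
    refine ⟨true, ?_⟩
    obtain ⟨g1, g2⟩ := gsh_mem k
    have hp : (0 : ℝ) < 2 ^ k := by positivity
    have key : ∀ y, |y - c| ≤ r → ⌊2 ^ k * y + gsh true k⌋ = m := by
      intro y hy
      rw [abs_le] at hy
      have e1 : 2 ^ k * (c - r) ≤ 2 ^ k * y := by gcongr; linarith
      have e2 : 2 ^ k * y ≤ 2 ^ k * (c + r) := by gcongr; linarith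
      rw [Int.floor_eq_iff]
      constructor <;> nlinarith
    by_cases hr0 : 0 ≤ r
    · intro y hy; rw [key y hy, key c (by simpa using hr0)]
    · intro y hy; exact absurd ((abs_nonneg _).trans hy) hr0
  · push Not at h
    refine ⟨false, ?_⟩
    have hp : (0 : ℝ) < 2 ^ k := by positivity
    have key : ∀ y, |y - c| ≤ r → ⌊2 ^ k * y + gsh false k⌋ = ⌊2 ^ k * (c - r)⌋ := by
      intro y hy
      rw [abs_le] at hy
      have e1 : 2 ^ k * (c - r) ≤ 2 ^ k * y := by gcongr; linarith
      have e2 : 2 ^ k * y ≤ 2 ^ k * (c + r) := by gcongr; linarith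
      have e3 := h (⌊2 ^ k * (c - r)⌋ + 1) (by push_cast; exact Int.lt_floor_add_one _)
      push_cast at e3
      have e4 := Int.floor_le (2 ^ k * (c - r))
      rw [Int.floor_eq_iff]
      simp only [gsh]
      constructor <;> simp <;> linarith
    by_cases hr0 : 0 ≤ r
    · intro y hy; rw [key y hy, key c (by simpa using hr0)]
    · intro y hy; exact absurd ((abs_nonneg _).trans hy) hr0

variable {n : ℕ}

/-- Family of cube-like sets. -/
def cubeFam (n : ℕ) : Set (Set (RSp n)) :=
  {E | MeasurableSet E ∧ ∃ Q : Cube n, E ⊆ Q.set ∧ volume E = volume Q.set}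

/-- cell index -/
noncomputable def gcell (σ : Fin n → Bool) (k : ℤ) (x : RSp n) : Fin n → ℤ :=
  fun i => ⌊2 ^ k * x i + gsh (σ i) k⌋

lemma gcell_set (σ : Fin n → Bool) (k : ℤ) (m : Fin n → ℤ) :
    {y : RSp n | gcell σ k y = m} =
      {y | ∀ i, y i ∈ Ico ((m i - gsh (σ i) k) * 2 ^ (-k)) ((m i + 1 - gsh (σ i) k) * 2 ^ (-k))} := by
  have hp : (0 : ℝ) < 2 ^ k := by positivity
  ext y
  simp only [Set.mem_ofPred_eq, funext_iff, gcell, Int.floor_eq_iff, mem_Ico]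
  refine forall_congr' fun i => ?_
  rw [zpow_neg, ← div_eq_mul_inv, ← div_eq_mul_inv, div_le_iff₀ hp, lt_div_iff₀ hp]
  constructor <;> rintro ⟨h1, h2⟩ <;> constructor <;> nlinarith

lemma gcell_meas_vol (σ : Fin n → Bool) (k : ℤ) (m : Fin n → ℤ) :
    MeasurableSet {y : RSp n | gcell σ k y = m} ∧
    volume {y : RSp n | gcell σ k y = m} = ENNReal.ofReal (2 ^ (-k)) ^ n := by
  have := vol_box 0 0 _ _ (fun i => measurableSet_Ico) (gcell_set σ k m)
  refine ⟨this.1, this.2.trans ?_⟩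
  simp only [Real.volume_Ico]
  have : ∀ i, (m i + 1 - gsh (σ i) k) * 2 ^ (-k) - (m i - gsh (σ i) k) * 2 ^ (-k) = (2 : ℝ) ^ (-k) :=
    fun i => by ring
  simp only [this, Finset.prod_const, Finset.card_univ, Fintype.card_fin]

/-- The dyadic system. -/
noncomputable def grid (σ : Fin n → Bool) : DS (volume : Measure (RSp n)) (Fin n → ℤ) where
  c := gcell σ
  V := fun k => ENNReal.ofReal (2 ^ (-k)) ^ n
  D := 2 ^ n
  meas := fun k m => (gcell_meas_vol σ k m).1
  nest := by
    intro k x y h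
    ext i
    have := congrFun h i
    simp only [gcell] at this ⊢
    obtain ⟨d, hd⟩ := gsh_nest (σ i) k
    rw [hd, hd, floor_half, floor_half, this]
  vol := fun k x => (gcell_meas_vol σ k _).2
  Vpos := fun k => pow_ne_zero _ (by
    have : (0 : ℝ) < 2 ^ (-k) := by positivity
    rw [Ne, ENNReal.ofReal_eq_zero, not_le]; exact this)
  Vtop := fun k => ENNReal.pow_ne_top ENNReal.ofReal_ne_top
  Dtop := ENNReal.pow_ne_top (by simp)
  dbl := by
    intro k
    rw [← mul_pow]
    congr 1
    rw [show (2 : ℝ≥0∞) = ENNReal.ofReal 2 by simp, ← ENNReal.ofReal_mul (by norm_num)]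
    congr 1
    rw [show -k = -(k + 1) + 1 by ring, zpow_add_one₀ (by norm_num)]; ring

lemma grid_V (σ : Fin n → Bool) (k : ℤ) : (grid σ).V k = ENNReal.ofReal (2 ^ (-k)) ^ n := rfl

lemma grid_Q (σ : Fin n → Bool) (k : ℤ) (x : RSp n) :
    (grid σ).Q k x = {y | gcell σ k y = gcell σ k x} := rfl

lemma grid_Q_subset (σ : Fin n → Bool) (k : ℤ) (x : RSp n) : (grid σ).Q k x ⊆ bx x (2 ^ (-k)) := by
  intro y hy i
  have h1 := (gcell_set σ k (gcell σ k x)).subset (show y ∈ {y | gcell σ k y = gcell σ k x} from hy) i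
  have h2 := (gcell_set σ k (gcell σ k x)).subset (show x ∈ {y | gcell σ k y = gcell σ k x} from rfl) i
  simp only [mem_Ico] at h1 h2
  rw [abs_le]
  constructor <;> nlinarith

lemma grid_cube (σ : Fin n → Bool) (k : ℤ) (x : RSp n) :
    ∃ Q : Cube n, (grid σ).Q k x ⊆ Q.set ∧ volume ((grid σ).Q k x) = volume Q.set := by
  have hp : (0 : ℝ) < 2 ^ (-k) := by positivity
  refine ⟨⟨WithLp.toLp 2 fun i => (gcell σ k x i + 1 / 2 - gsh (σ i) k) * 2 ^ (-k), 2 ^ (-k) / 2,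
    by positivity⟩, ?_, ?_⟩
  · intro y hy i
    have h1 := (gcell_set σ k (gcell σ k x)).subset (show y ∈ {y | gcell σ k y = gcell σ k x} from hy) i
    simp only [mem_Ico] at h1
    simp only
    rw [abs_le]
    constructor <;> linarith [h1.1, h1.2]
  · rw [(grid σ).volQ, grid_V, Cube.vol]
    congr 2
    ring

lemma grid_fam (σ : Fin n → Bool) (k : ℤ) (x : RSp n) : (grid σ).Q k x ∈ cubeFam n :=
  ⟨(grid σ).measQ k x, grid_cube σ k x⟩

lemma Cube.fam (Q : Cube n) : Q.set ∈ cubeFam n := ⟨Q.meas, Q, subset_rfl, rfl⟩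

lemma cube_le (Q : Cube n) : ∃ (σ : Fin n → Bool) (k : ℤ), ∀ x ∈ Q.set, ∀ (γ : ℝ), 0 ≤ γ →
    ∀ F : RSp n → ℝ≥0∞, volume Q.set ^ (γ - 1) * ∫⁻ y in Q.set, F y ≤
      6 ^ n * ((grid σ).V k ^ γ * (grid σ).E k F x) := by
  obtain ⟨j, hj1, hj2⟩ := exists_mem_Ico_zpow (show 0 < 6 * Q.r by have := Q.r_pos; positivity) one_lt_two
  set k := -(j + 1) with hk
  have hkj : -k = j + 1 := by omega
  have hp : (0 : ℝ) < 2 ^ k := by positivity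
  have h1 : (2 : ℝ) ^ k * (6 * Q.r) < 1 := by
    calc (2 : ℝ) ^ k * (6 * Q.r) < 2 ^ k * 2 ^ (j + 1) := by gcongr
      _ = 1 := by rw [← zpow_add₀ (by norm_num), hk]; simp
  have h2 : (2 : ℝ) ^ (-k) ≤ 6 * (2 * Q.r) := by
    rw [hkj, zpow_add_one₀ (by norm_num)]; linarith
  have h3 : 2 * Q.r ≤ (2 : ℝ) ^ (-k) := by
    rw [hkj]; have := Q.r_pos; linarith
  have ht : ∀ i, ∃ s : Bool, ∀ y, |y - Q.c i| ≤ Q.r → ⌊2 ^ k * y + gsh s k⌋ = ⌊2 ^ k * Q.c i + gsh s k⌋ :=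
    fun i => third h1
  choose σ hσ using ht
  refine ⟨σ, k, fun x hx γ hγ F => ?_⟩
  have hsub : Q.set ⊆ (grid σ).Q k x := by
    intro y hy
    rw [grid_Q]
    ext i
    exact (hσ i _ (hy i)).trans (hσ i _ (hx i)).symm
  have hv1 : volume Q.set ≤ (grid σ).V k := by
    rw [Q.vol, grid_V]; gcongr
  have hv2 : (grid σ).V k ≤ 6 ^ n * volume Q.set := by
    rw [Q.vol, grid_V, ← mul_pow]; gcongr
    rw [show (6 : ℝ≥0∞) = ENNReal.ofReal 6 by simp, ← ENNReal.ofReal_mul (by norm_num)]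
    exact ENNReal.ofReal_le_ofReal h2
  have h0 := Q.vol_ne_zero
  have h0' := Q.vol_ne_top
  have hinv : (volume Q.set)⁻¹ ≤ 6 ^ n * ((grid σ).V k)⁻¹ := by
    rw [ENNReal.inv_le_iff_le_mul (by simp [h0]) (by simp [h0'])]
    rw [← mul_assoc, mul_comm (volume Q.set)]
    calc (1 : ℝ≥0∞) = (grid σ).V k * ((grid σ).V k)⁻¹ :=
          (ENNReal.mul_inv_cancel ((grid σ).Vpos k) ((grid σ).Vtop k)).symm
      _ ≤ _ := by gcongr
  rw [sub_eq_add_neg, ENNReal.rpow_add _ _ h0 h0', ENNReal.rpow_neg_one]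
  calc volume Q.set ^ γ * (volume Q.set)⁻¹ * ∫⁻ y in Q.set, F y
      ≤ (grid σ).V k ^ γ * (6 ^ n * ((grid σ).V k)⁻¹) * ∫⁻ y in (grid σ).Q k x, F y := by
        gcongr
    _ = _ := by unfold DS.E; ring

lemma fracMaximal_le {α : ℝ} (hα : 0 ≤ α / n) (f : RSp n → ℝ) (x : RSp n) :
    fracMaximal α f x ≤ 6 ^ n * ∑ σ : Fin n → Bool, (grid σ).Ms (α / n) 1 (fun y => ‖f y‖ₑ) x := by
  refine iSup₂_le fun Q hx => ?_
  obtain ⟨σ, k, h⟩ := cube_le Q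
  refine (h x hx _ hα _).trans ?_
  gcongr
  refine le_trans ?_ (Finset.single_le_sum (f := fun σ => (grid σ).Ms (α / n) 1 (fun y => ‖f y‖ₑ) x)
    (fun _ _ => zero_le) (Finset.mem_univ σ))
  rw [DS.Ms_one]
  exact le_iSup (fun k => (grid σ).V k ^ (α / n : ℝ) * (grid σ).E k (fun y => ‖f y‖ₑ) x) k

lemma fracMaximalComm_le {α : ℝ} (hα : 0 ≤ α / n) (b f : RSp n → ℝ) (x : RSp n) :
    fracMaximalComm α b f x ≤ 6 ^ n * ∑ σ : Fin n → Bool, (grid σ).Cm (α / n) b (fun y => ‖f y‖ₑ) x := by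
  refine iSup₂_le fun Q hx => ?_
  obtain ⟨σ, k, h⟩ := cube_le Q
  refine (h x hx _ hα _).trans ?_
  gcongr
  refine le_trans ?_ (Finset.single_le_sum (f := fun σ => (grid σ).Cm (α / n) b (fun y => ‖f y‖ₑ) x)
    (fun _ _ => zero_le) (Finset.mem_univ σ))
  exact le_iSup (fun k => (grid σ).V k ^ (α / n : ℝ) *
    (grid σ).E k (fun y => ‖b x - b y‖ₑ * ‖f y‖ₑ) x) k

lemma ae_eq_of_fam {E : Set (RSp n)} (hE : MeasurableSet E) {Q : Cube n} (h : E ⊆ Q.set)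
    (hv : volume E = volume Q.set) : E =ᵐ[volume] Q.set :=
  ae_eq_of_subset_of_measure_ge h hv.ge hE.nullMeasurableSet Q.vol_ne_top

lemma grid_osc (hn : 0 < n) {b : RSp n → ℝ} (hbm : Measurable b) (hb : IsBMO b) (σ : Fin n → Bool) :
    (grid σ).Osc b (bmoNorm b + 1) where
  meas := hbm
  int := by
    intro k x
    obtain ⟨Q, h1, h2⟩ := grid_cube σ k x
    exact (hb.1.integrableOn_isCompact (isCompact_bx Q.c Q.r_pos.le)).mono_set h1
  osc := by
    intro k x
    obtain ⟨Q, h1, h2⟩ := grid_cube σ k x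
    have hae := ae_eq_of_fam ((grid σ).measQ k x) h1 h2
    have hV : (grid σ).V k = volume Q.set := by rw [← h2, (grid σ).volQ]
    have hav : (grid σ).bav b k x = cubeAvg Q b := by
      unfold DS.bav cubeAvg
      rw [setIntegral_congr_set hae, hV, setAverage_eq]; rfl
    rw [hav]
    unfold DS.E
    rw [setLIntegral_congr hae, hV]
    refine le_trans ?_ le_self_add
    exact le_iSup (fun Q : Cube n => (volume Q.set)⁻¹ * ∫⁻ x in Q.set, ‖b x - cubeAvg Q b‖₊) Q
  pos := by simp
  top := by simpa using hb.2.ne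
  lim := by
    filter_upwards [lebesgue_diff hn hb.1] with x hx
    have h1 := hx (fun k : ℕ => (grid σ).Q k x) (fun k : ℕ => 2 ^ (-(k : ℤ))) (fun j => by positivity)
      (by
        have := tendsto_pow_atTop_nhds_zero_of_lt_one (r := (1 / 2 : ℝ)) (by norm_num) (by norm_num)
        refine this.congr fun k => ?_
        simp [zpow_neg])
      (fun j => grid_Q_subset σ j x)
      (fun j => by rw [(grid σ).volQ, grid_V])
    rw [tendsto_iff_edist_tendsto_0]
    refine tendsto_of_tendsto_of_tendsto_of_le_of_le tendsto_const_nhds h1 (fun j => zero_le) fun j => ?_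
    dsimp only
    have hint : IntegrableOn b ((grid σ).Q j x) volume := by
      obtain ⟨Q, h1, h2⟩ := grid_cube σ j x
      exact (hb.1.integrableOn_isCompact (isCompact_bx Q.c Q.r_pos.le)).mono_set h1
    have hV0 := (grid σ).Vpos j
    have hVt := (grid σ).Vtop j
    have hvq := (grid σ).volQ j x
    have e1 : (grid σ).bav b j x - b x = ((grid σ).V j).toReal⁻¹ * ∫ y in (grid σ).Q j x, (b y - b x) := by
      rw [integral_sub hint (integrableOn_const (by rw [hvq]; exact hVt)), setIntegral_const]
      unfold DS.bav
      rw [measureReal_def, hvq, mul_sub, smul_eq_mul, ← mul_assoc,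
        inv_mul_cancel₀ (ENNReal.toReal_ne_zero.2 ⟨hV0, hVt⟩), one_mul]
    rw [edist_eq_enorm_sub, e1, enorm_mul, hvq]
    refine mul_le_mul' ?_ (enorm_integral_le_lintegral_enorm _)
    rw [Real.enorm_eq_ofReal (by positivity), ENNReal.ofReal_inv_of_pos (ENNReal.toReal_pos hV0 hVt),
      ENNReal.ofReal_toReal hVt]

end grids

set_option linter.unusedVariables false

section inv

variable {n : ℕ} {φ : RSp n → ℝ≥0 → ℝ≥0∞}

lemma phiInv_le {x : RSp n} {t : ℝ≥0∞} {τ : ℝ≥0} (h : t ≤ φ x τ) : phiInv φ x t ≤ τ :=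
  sInf_le ⟨τ, h, rfl⟩

lemma lt_of_lt_phiInv {x : RSp n} {t : ℝ≥0∞} {τ : ℝ≥0} (h : (τ : ℝ≥0∞) < phiInv φ x t) : φ x τ < t := by
  by_contra! h'
  exact absurd (phiInv_le h') (not_le.2 h)

lemma le_phiInv (hφ : IsWeakPhi Set.univ φ) {x : RSp n} {t : ℝ≥0∞} {τ : ℝ≥0} (h : φ x τ < t) :
    (τ : ℝ≥0∞) ≤ phiInv φ x t := by
  refine le_sInf ?_
  rintro _ ⟨s, hs, rfl⟩
  have hs' : t ≤ φ x s := hs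
  by_contra! h'
  have : s ≤ τ := by exact_mod_cast h'.le
  exact absurd (hs'.trans (hφ.mono x trivial this)) (not_le.2 h)

lemma phiInv_mono {x : RSp n} {s t : ℝ≥0∞} (h : s ≤ t) : phiInv φ x s ≤ phiInv φ x t := by
  refine le_sInf ?_
  rintro _ ⟨τ, hτ, rfl⟩
  exact phiInv_le (h.trans hτ)

lemma phiInv_ne_top (hφ : IsWeakPhi Set.univ φ) {x : RSp n} {t : ℝ≥0∞} (ht : t ≠ ∞) :
    phiInv φ x t ≠ ∞ := by
  obtain ⟨τ, hτ⟩ := ((hφ.lim_top x trivial).eventually (lt_mem_nhds (lt_top_iff_ne_top.2 ht))).exists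
  exact ne_top_of_le_ne_top ENNReal.coe_ne_top (phiInv_le hτ.le)

lemma phiInv_ne_zero (hφ : IsWeakPhi Set.univ φ) {x : RSp n} {t : ℝ≥0∞} (ht : t ≠ 0) :
    phiInv φ x t ≠ 0 := by
  have h1 := (hφ.lim_zero x trivial).eventually (gt_mem_nhds (pos_iff_ne_zero.2 ht))
  obtain ⟨τ, hτ, hτ0⟩ := (h1.and self_mem_nhdsWithin).exists
  have := le_phiInv hφ hτ
  intro h0
  rw [h0] at this
  have h2 : τ = 0 := by simpa using this
  exact absurd hτ0 (by simp [h2])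

/-- Real version of the inverse. -/
noncomputable def Gi (φ : RSp n → ℝ≥0 → ℝ≥0∞) (x : RSp n) (t : ℝ) : ℝ :=
  (phiInv φ x (ENNReal.ofReal t)).toReal

lemma Gi_pos (hφ : IsWeakPhi Set.univ φ) (x : RSp n) {t : ℝ} (ht : 0 < t) : 0 < Gi φ x t :=
  ENNReal.toReal_pos (phiInv_ne_zero hφ (by simpa using ht)) (phiInv_ne_top hφ ENNReal.ofReal_ne_top)

lemma ofReal_Gi (hφ : IsWeakPhi Set.univ φ) (x : RSp n) (t : ℝ) :
    ENNReal.ofReal (Gi φ x t) = phiInv φ x (ENNReal.ofReal t) :=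
  ENNReal.ofReal_toReal (phiInv_ne_top hφ ENNReal.ofReal_ne_top)

lemma lt_of_lt_Gi (hφ : IsWeakPhi Set.univ φ) {x : RSp n} {t : ℝ} {τ : ℝ≥0} (h : (τ : ℝ) < Gi φ x t) :
    φ x τ < ENNReal.ofReal t := by
  refine lt_of_lt_phiInv ?_
  rw [← ofReal_Gi hφ, ← ENNReal.ofReal_coe_nnreal]
  exact (ENNReal.ofReal_lt_ofReal_iff (τ.2.trans_lt h)).2 h

lemma le_Gi (hφ : IsWeakPhi Set.univ φ) {x : RSp n} {t : ℝ} {τ : ℝ≥0} (h : φ x τ < ENNReal.ofReal t) :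
    (τ : ℝ) ≤ Gi φ x t := by
  have := le_phiInv hφ h
  exact ENNReal.toReal_mono (phiInv_ne_top hφ ENNReal.ofReal_ne_top) this

lemma Gi_le (hφ : IsWeakPhi Set.univ φ) {x : RSp n} {t : ℝ} {τ : ℝ≥0} (h : ENNReal.ofReal t ≤ φ x τ) :
    Gi φ x t ≤ τ := by
  have := phiInv_le h
  exact ENNReal.toReal_mono ENNReal.coe_ne_top this

lemma Gi_mono (hφ : IsWeakPhi Set.univ φ) {x : RSp n} {s t : ℝ} (h : s ≤ t) : Gi φ x s ≤ Gi φ x t :=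
  ENNReal.toReal_mono (phiInv_ne_top hφ ENNReal.ofReal_ne_top)
    (phiInv_mono (ENNReal.ofReal_le_ofReal h))

lemma AInc.scale {p : ℝ} (hp : 0 < p) (h : AInc p Set.univ φ) : ∃ L : ℝ, 1 ≤ L ∧ ∀ x (τ k : ℝ≥0), 0 < τ →
    1 ≤ k → ENNReal.ofReal ((k : ℝ) ^ p) * φ x τ ≤ ENNReal.ofReal L * φ x (k * τ) := by
  obtain ⟨L, hL, h⟩ := h
  refine ⟨L, by exact_mod_cast hL, fun x τ k hτ hk => ?_⟩
  rw [ENNReal.ofReal_coe_nnreal]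
  rcases hk.eq_or_lt with rfl | hk
  · simp only [NNReal.coe_one, Real.one_rpow, ENNReal.ofReal_one, one_mul]
    exact le_mul_of_one_le_left zero_le (by exact_mod_cast hL)
  have hk0 : 0 < k := zero_lt_one.trans hk
  have := h x trivial τ (k * τ) hτ (by nth_rewrite 1 [← one_mul τ]; gcongr)
  have e1 : ENNReal.ofReal ((k : ℝ) ^ p) = (k : ℝ≥0∞) ^ p := by
    rw [← ENNReal.ofReal_rpow_of_nonneg k.coe_nonneg hp.le, ENNReal.ofReal_coe_nnreal]
  rw [e1]
  have e2 : ((k * τ : ℝ≥0) : ℝ≥0∞) ^ p = (k : ℝ≥0∞) ^ p * (τ : ℝ≥0∞) ^ p := by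
    rw [ENNReal.coe_mul, ENNReal.mul_rpow_of_nonneg _ _ hp.le]
  rw [e2] at this
  have k0 : (k : ℝ≥0∞) ^ p ≠ 0 := by simp [hk0.ne', hp.le, hp]
  have k1 : (k : ℝ≥0∞) ^ p ≠ ∞ := ENNReal.rpow_ne_top_of_nonneg hp.le (by simp)
  have t0 : (τ : ℝ≥0∞) ^ p ≠ 0 := by simp [hτ.ne', hp.le, hp]
  have t1 : (τ : ℝ≥0∞) ^ p ≠ ∞ := ENNReal.rpow_ne_top_of_nonneg hp.le (by simp)
  calc (k : ℝ≥0∞) ^ p * φ x τ = (k : ℝ≥0∞) ^ p * (φ x τ / (τ : ℝ≥0∞) ^ p * (τ : ℝ≥0∞) ^ p) := by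
        rw [ENNReal.div_mul_cancel t0 t1]
    _ ≤ (k : ℝ≥0∞) ^ p * (L * (φ x (k * τ) / ((k : ℝ≥0∞) ^ p * (τ : ℝ≥0∞) ^ p)) * (τ : ℝ≥0∞) ^ p) := by
        gcongr
    _ = L * (φ x (k * τ) / ((k : ℝ≥0∞) ^ p * (τ : ℝ≥0∞) ^ p) * ((k : ℝ≥0∞) ^ p * (τ : ℝ≥0∞) ^ p)) := by ring
    _ = _ := by rw [ENNReal.div_mul_cancel (mul_ne_zero k0 t0) (ENNReal.mul_ne_top k1 t1)]

lemma ADec.scale {p : ℝ} (hp : 0 < p) (h : ADec p Set.univ φ) : ∃ L : ℝ, 1 ≤ L ∧ ∀ x (τ k : ℝ≥0), 0 < τ →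
    1 ≤ k → φ x (k * τ) ≤ ENNReal.ofReal (L * (k : ℝ) ^ p) * φ x τ := by
  obtain ⟨L, hL, h⟩ := h
  refine ⟨L, by exact_mod_cast hL, fun x τ k hτ hk => ?_⟩
  rw [ENNReal.ofReal_mul L.coe_nonneg, ENNReal.ofReal_coe_nnreal]
  rcases hk.eq_or_lt with rfl | hk
  · simp only [NNReal.coe_one, Real.one_rpow, ENNReal.ofReal_one, one_mul, mul_one]
    exact le_mul_of_one_le_left zero_le (by exact_mod_cast hL)
  have hk0 : 0 < k := zero_lt_one.trans hk
  have := h x trivial τ (k * τ) hτ (by nth_rewrite 1 [← one_mul τ]; gcongr)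
  have e1 : ENNReal.ofReal ((k : ℝ) ^ p) = (k : ℝ≥0∞) ^ p := by
    rw [← ENNReal.ofReal_rpow_of_nonneg k.coe_nonneg hp.le, ENNReal.ofReal_coe_nnreal]
  rw [e1]
  have e2 : ((k * τ : ℝ≥0) : ℝ≥0∞) ^ p = (k : ℝ≥0∞) ^ p * (τ : ℝ≥0∞) ^ p := by
    rw [ENNReal.coe_mul, ENNReal.mul_rpow_of_nonneg _ _ hp.le]
  rw [e2] at this
  have k0 : (k : ℝ≥0∞) ^ p ≠ 0 := by simp [hk0.ne', hp.le, hp]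
  have k1 : (k : ℝ≥0∞) ^ p ≠ ∞ := ENNReal.rpow_ne_top_of_nonneg hp.le (by simp)
  have t0 : (τ : ℝ≥0∞) ^ p ≠ 0 := by simp [hτ.ne', hp.le, hp]
  have t1 : (τ : ℝ≥0∞) ^ p ≠ ∞ := ENNReal.rpow_ne_top_of_nonneg hp.le (by simp)
  calc φ x (k * τ) = (φ x (k * τ) / ((k : ℝ≥0∞) ^ p * (τ : ℝ≥0∞) ^ p) * ((k : ℝ≥0∞) ^ p * (τ : ℝ≥0∞) ^ p)) := by
        rw [ENNReal.div_mul_cancel (mul_ne_zero k0 t0) (ENNReal.mul_ne_top k1 t1)]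
    _ ≤ L * (φ x τ / (τ : ℝ≥0∞) ^ p) * ((k : ℝ≥0∞) ^ p * (τ : ℝ≥0∞) ^ p) := by gcongr
    _ = L * (k : ℝ≥0∞) ^ p * (φ x τ / (τ : ℝ≥0∞) ^ p * (τ : ℝ≥0∞) ^ p) := by ring
    _ = _ := by rw [ENNReal.div_mul_cancel t0 t1]

lemma Gi_up {p : ℝ} (hp : 0 < p) (hφ : IsWeakPhi Set.univ φ) (h : AInc p Set.univ φ) :
    ∃ C : ℝ, 1 ≤ C ∧ ∀ x s t, 0 < s → s ≤ t → Gi φ x t ≤ C * (t / s) ^ (1 / p) * Gi φ x s := by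
  obtain ⟨L, hL, h⟩ := h.scale hp
  refine ⟨L ^ (1 / p), Real.one_le_rpow hL (by positivity), fun x s t hs hst => ?_⟩
  have ht : 0 < t := hs.trans_le hst
  have h1 : 1 ≤ t / s := (one_le_div hs).2 hst
  rw [← Real.mul_rpow (by positivity) (by positivity)]
  set k : ℝ := (L * (t / s)) ^ (1 / p) with hk
  have hk1 : 1 ≤ k := Real.one_le_rpow (by nlinarith) (by positivity)
  have hkp : k ^ p = L * (t / s) := by
    rw [hk, ← Real.rpow_mul (by positivity), one_div_mul_cancel hp.ne', Real.rpow_one]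
  have key : ∀ τ : ℝ, Gi φ x s < τ → Gi φ x t / k ≤ τ := by
    intro τ hτ
    have hG := Gi_pos hφ x hs
    have hτ0 : 0 < τ := hG.trans hτ
    rw [div_le_iff₀ (by positivity)]
    lift τ to ℝ≥0 using hτ0.le
    have h2 : ENNReal.ofReal s ≤ φ x τ := by
      by_contra! h'
      exact absurd (le_Gi hφ h') (not_le.2 hτ)
    have hτ0' : 0 < τ := by exact_mod_cast hτ0
    have h3 := h x τ ⟨k, by linarith⟩ hτ0' (by exact_mod_cast hk1)
    have h4 : ENNReal.ofReal t ≤ φ x (⟨k, by linarith⟩ * τ) := by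
      change ENNReal.ofReal (k ^ p) * _ ≤ _ at h3
      rw [hkp] at h3
      have h5 : ENNReal.ofReal L * ENNReal.ofReal t ≤ ENNReal.ofReal L * φ x (⟨k, by linarith⟩ * τ) := by
        refine le_trans ?_ h3
        calc ENNReal.ofReal L * ENNReal.ofReal t = ENNReal.ofReal (L * (t / s)) * ENNReal.ofReal s := by
              rw [← ENNReal.ofReal_mul (by linarith), ← ENNReal.ofReal_mul (by positivity)]
              congr 1; field_simp
          _ ≤ _ := by gcongr
      rwa [ENNReal.mul_le_mul_iff_right (by simp; linarith) ENNReal.ofReal_ne_top] at h5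
    have := Gi_le hφ h4
    push_cast at this
    change _ ≤ k * τ at this
    linarith
  have := le_of_forall_gt_imp_ge_of_dense key
  rw [div_le_iff₀ (by positivity)] at this
  linarith

lemma Gi_lo {r : ℝ} (hr : 0 < r) (hφ : IsWeakPhi Set.univ φ) (h : ADec (1 / r) Set.univ φ) :
    ∃ C : ℝ, 1 ≤ C ∧ ∀ x s t, 0 < s → s ≤ t → (t / s) ^ r * Gi φ x s ≤ C * Gi φ x t := by
  obtain ⟨L, hL, h⟩ := h.scale (by positivity)
  refine ⟨L ^ r, Real.one_le_rpow hL (by positivity), fun x s t hs hst => ?_⟩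
  have ht : 0 < t := hs.trans_le hst
  have h1 : 1 ≤ t / s := (one_le_div hs).2 hst
  have hG := Gi_pos hφ x hs
  rcases le_total L (t / s) with hLe | hLe
  swap
  · have := Gi_mono hφ (x := x) hst
    gcongr
  set k : ℝ := (t / s / L) ^ r with hk
  have hk1 : 1 ≤ k := Real.one_le_rpow (by rw [le_div_iff₀ (by linarith)]; linarith) hr.le
  have hkp : L * k ^ (1 / r) = t / s := by
    rw [hk, ← Real.rpow_mul (by positivity), mul_one_div_cancel hr.ne', Real.rpow_one]
    field_simp
  have hkL : (t / s) ^ r = k * L ^ r := by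
    rw [hk, ← Real.mul_rpow (by positivity) (by positivity)]
    congr 1; field_simp
  have key : ∀ τ : ℝ, 0 < τ → τ < Gi φ x s → k * τ ≤ Gi φ x t := by
    intro τ hτ0 hτ
    lift τ to ℝ≥0 using hτ0.le
    have h2 := lt_of_lt_Gi hφ hτ
    have hτ0' : 0 < τ := by exact_mod_cast hτ0
    have h3 := h x τ ⟨k, by linarith⟩ hτ0' (by exact_mod_cast hk1)
    change _ ≤ ENNReal.ofReal (L * k ^ (1 / r)) * _ at h3
    rw [hkp] at h3
    have h4 : φ x (⟨k, by linarith⟩ * τ) < ENNReal.ofReal t := by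
      refine h3.trans_lt ?_
      calc ENNReal.ofReal (t / s) * φ x τ < ENNReal.ofReal (t / s) * ENNReal.ofReal s := by
            refine (ENNReal.mul_lt_mul_iff_right ?_ ENNReal.ofReal_ne_top).2 h2
            simp; positivity
        _ = _ := by rw [← ENNReal.ofReal_mul (by positivity)]; congr 1; field_simp
    have := le_Gi hφ h4
    push_cast at this
    exact this
  have : Gi φ x s ≤ Gi φ x t / k := by
    refine le_of_forall_lt_imp_le_of_dense fun τ hτ => ?_
    rcases le_or_gt τ 0 with h0 | h0
    · exact h0.trans (by have := Gi_pos hφ x ht; positivity)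
    · rw [le_div_iff₀ (by positivity)]; linarith [key τ h0 hτ]
  rw [le_div_iff₀ (by positivity)] at this
  rw [hkL]
  have hLr : 0 < L ^ r := by positivity
  nlinarith

lemma link_of {ψ : RSp n → ℝ≥0 → ℝ≥0∞} (hψ : IsWeakPhi Set.univ ψ) {Fam : Set (Set (RSp n))}
    {h : RSp n → ℝ} {H : RSp n → ℝ → ℝ} {a b C κ1 κ2 : ℝ}
    (hH : Nice volume Fam h H a b C) (h1 : 0 < κ1) (h2 : 0 < κ2)
    (hκ : ∀ x t, 0 < t → κ1 * H x t ≤ Gi ψ x t ∧ Gi ψ x t ≤ κ2 * H x t)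
    (hone : ∃ β : ℝ, 0 < β ∧ ∀ᵐ x ∂volume, β ≤ H x 1) :
    Link volume ψ H κ1 (κ2 * (C * 2 ^ b)) where
  meas := fun f hf => by simpa using hψ.meas f hf
  mono := fun x => hψ.mono x trivial
  zero := fun x => hψ.zero x trivial
  c0 := h1
  cl0 := by have := hH.one; positivity
  L1 := fun x t τ ht hτ => (lt_of_lt_Gi hψ (hτ.trans_le (hκ x t ht).1)).le
  L2 := by
    intro x t τ ht hτ
    have e1 : (τ : ℝ) ≤ Gi ψ x (2 * t) := by
      refine le_Gi hψ (hτ.trans_lt ?_)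
      rw [ENNReal.ofReal_lt_ofReal_iff (by positivity)]; linarith
    have e2 := (hκ x (2 * t) (by positivity)).2
    have e3 := hH.up x t (2 * t) ht (by linarith)
    rw [mul_div_cancel_right₀ _ ht.ne'] at e3
    calc (τ : ℝ) ≤ κ2 * H x (2 * t) := e1.trans e2
      _ ≤ κ2 * (C * 2 ^ b * H x t) := by gcongr
      _ = _ := by ring
  one := hone

end inv

set_option linter.unusedVariables false

section fam

variable {n : ℕ} {φ : RSp n → ℝ≥0 → ℝ≥0∞}

lemma IsWeakPhi.aInc_one (hφ : IsWeakPhi Set.univ φ) : AInc 1 Set.univ φ := by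
  obtain ⟨L, hL, h⟩ := hφ.almost_inc
  refine ⟨L, hL, fun x hx s t hs hst => ?_⟩
  simpa using h x hx s t hs hst

lemma shrink {p : ℝ} (hp : 0 < p) (h : AInc p Set.univ φ) {ε : ℝ} (hε : 0 < ε) :
    ∃ k : ℕ, 0 < k ∧ ∀ x (τ : ℝ≥0), φ x (τ / k) ≤ ENNReal.ofReal ε * φ x τ ∨ τ = 0 := by
  obtain ⟨L, hL, h⟩ := h.scale hp
  obtain ⟨k, hk⟩ := exists_nat_gt (max 1 ((L / ε) ^ (1 / p)))
  have hk1 : (1 : ℝ) < k := (le_max_left _ _).trans_lt hk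
  have hk2 : (L / ε) ^ (1 / p) < k := (le_max_right _ _).trans_lt hk
  have hk0 : 0 < k := by exact_mod_cast zero_lt_one.trans hk1
  refine ⟨k, hk0, fun x τ => ?_⟩
  rcases eq_or_ne τ 0 with h0 | h0
  · exact Or.inr h0
  left
  have hkn : (0 : ℝ≥0) < k := by exact_mod_cast hk0
  have hτ : 0 < τ / k := div_pos (pos_iff_ne_zero.2 h0) hkn
  have h1 := h x (τ / k) k hτ (by exact_mod_cast hk0)
  rw [mul_div_cancel₀ _ hkn.ne'] at h1
  have h2 : L / ε ≤ (k : ℝ) ^ p := by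
    calc L / ε = ((L / ε) ^ (1 / p)) ^ p := by
          rw [← Real.rpow_mul (by positivity), one_div_mul_cancel hp.ne', Real.rpow_one]
      _ ≤ _ := by gcongr
  have h3 : ENNReal.ofReal (L / ε) * φ x (τ / k) ≤ ENNReal.ofReal L * φ x τ := by
    refine le_trans ?_ h1
    gcongr
    simpa using h2
  have h4 : ENNReal.ofReal L = ENNReal.ofReal (L / ε) * ENNReal.ofReal ε := by
    rw [← ENNReal.ofReal_mul (by positivity)]; congr 1; field_simp
  rw [h4, mul_assoc, ENNReal.mul_le_mul_iff_right (by simp; positivity) ENNReal.ofReal_ne_top] at h3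
  exact h3

lemma A2_err (hφ : IsWeakPhi Set.univ φ) (h : A2 φ) : ∃ φi : ℝ≥0 → ℝ≥0∞,
    IsWeakPhi Set.univ (fun _ : RSp n => φi) ∧ ∃ (hf : RSp n → ℝ) (M : ℝ) (m : ℕ) (s : ℝ),
    HOK volume hf ∧ 0 ≤ M ∧ 0 < m ∧ 0 < s ∧ ∀ᵐ x ∂(volume : Measure (RSp n)), ∀ τ : ℚ≥0,
      (φi τ ≤ ENNReal.ofReal s → φ x ((τ : ℝ≥0) / m) ≤ φi τ + ENNReal.ofReal (M * hf x)) ∧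
      (φ x τ ≤ ENNReal.ofReal s → φi ((τ : ℝ≥0) / m) ≤ φ x τ + ENNReal.ofReal (M * hf x)) := by
  obtain ⟨φi, hφi, h0, hint, ⟨M, hM⟩, β, hβ, hβ1, s, hs, h⟩ := h
  obtain ⟨m, hm⟩ := exists_nat_gt (1 / β)
  have hm0 : (0 : ℝ≥0) < m := (by positivity : 0 < 1 / β).trans hm
  have hmβ : ∀ τ : ℝ≥0, τ / m ≤ β * τ := by
    intro τ
    rw [div_le_iff₀ hm0]
    have : 1 ≤ β * m := by
      rw [div_lt_iff₀ hβ] at hm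
      rw [mul_comm]; exact hm.le
    calc τ = 1 * τ := (one_mul _).symm
      _ ≤ (β * m) * τ := by gcongr
      _ = _ := by ring
  set k1 : ℚ≥0 → RSp n → ℝ≥0∞ := fun τ x => if φi τ ≤ s then φ x ((τ : ℝ≥0) / m) - φi τ else 0 with hk1
  set k2 : ℚ≥0 → RSp n → ℝ≥0∞ := fun τ => {x | φ x τ ≤ s}.indicator (fun x => φi ((τ : ℝ≥0) / m) - φ x τ) with hk2
  have hmc : ∀ τ : ℝ≥0, AEMeasurable (fun x => φ x τ) volume := fun τ => by
    simpa using hφ.meas (fun _ => τ) measurable_const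
  have hm1 : ∀ τ, AEMeasurable (k1 τ) volume := by
    intro τ
    by_cases hτ : φi τ ≤ s
    · have : k1 τ = fun x => φ x ((τ : ℝ≥0) / m) - φi τ := by
        ext x; simp only [hk1]; rw [if_pos hτ]
      rw [this]
      exact (hmc _).sub aemeasurable_const
    · have : k1 τ = fun x => 0 := by
        ext x; simp only [hk1]; rw [if_neg hτ]
      rw [this]; exact aemeasurable_const
  have hm2 : ∀ τ, AEMeasurable (k2 τ) volume := by
    intro τ
    refine AEMeasurable.indicator₀ (aemeasurable_const.sub (hmc _)) ?_
    exact nullMeasurableSet_le (hmc _) aemeasurable_const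
  set h1 : RSp n → ℝ≥0∞ := fun x => ⨆ τ, max (k1 τ x) (k2 τ x) with hh1
  have hm3 : AEMeasurable h1 volume := AEMeasurable.iSup fun τ => (hm1 τ).sup (hm2 τ)
  have hle : ∀ᵐ x ∂(volume : Measure (RSp n)), h1 x ≤ h0 x := by
    filter_upwards [h] with x hx
    refine iSup_le fun τ => max_le ?_ ?_
    · simp only [hk1]
      split_ifs with hτ
      · rw [tsub_le_iff_left]
        exact (hφ.mono x trivial (hmβ _)).trans ((hx _).1 hτ)
      · exact zero_le
    · simp only [hk2, indicator_apply, Set.mem_ofPred_eq]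
      split_ifs with hτ
      · rw [tsub_le_iff_left]
        exact (hφi.mono x trivial (hmβ _)).trans ((hx _).2 hτ)
      · exact zero_le
  obtain ⟨g, hg0, hgm, hgi⟩ := exists_pos_lintegral_lt_of_sigmaFinite (volume : Measure (RSp n)) one_ne_zero
  set h2 : RSp n → ℝ := fun x => ((min (hm3.mk h1 x) M).toReal + min (g x : ℝ) 1) / (M + 1) with hh2
  have hMp : (0 : ℝ) < M + 1 := by positivity
  have hmin : ∀ x, min (hm3.mk h1 x) (M : ℝ≥0∞) ≠ ∞ := fun x => ne_top_of_le_ne_top ENNReal.coe_ne_top (min_le_right _ _)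
  refine ⟨φi, hφi, h2, M + 1, m, s, ⟨?_, ?_, ?_, ?_⟩, hMp.le, by exact_mod_cast hm0, by exact_mod_cast hs, ?_⟩
  · refine Measurable.div_const ?_ _
    refine Measurable.add ?_ ?_
    · exact (hm3.measurable_mk.min measurable_const).ennreal_toReal
    · exact (measurable_coe_nnreal_real.comp hgm).min measurable_const
  · intro x
    have := hg0 x
    have : (0 : ℝ) < min (g x : ℝ) 1 := lt_min (by exact_mod_cast this) one_pos
    simp only [hh2]; positivity
  · intro x
    simp only [hh2]
    rw [div_le_one hMp]
    have e1 : (min (hm3.mk h1 x) (M : ℝ≥0∞)).toReal ≤ M := by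
      have := ENNReal.toReal_mono ENNReal.coe_ne_top (min_le_right (hm3.mk h1 x) (M : ℝ≥0∞))
      simpa using this
    have e2 := min_le_right (g x : ℝ) 1
    linarith
  · have : ∀ᵐ x ∂(volume : Measure (RSp n)), ENNReal.ofReal (h2 x) ≤ h0 x + g x := by
      filter_upwards [hm3.ae_eq_mk, hle] with x hx1 hx2
      have : h2 x ≤ (min (hm3.mk h1 x) M).toReal + g x := by
        simp only [hh2]
        have e2 := min_le_left (g x : ℝ) 1
        have e0 : 0 ≤ min (g x : ℝ) 1 := le_min (by positivity) zero_le_one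
        have e3 : 0 ≤ (min (hm3.mk h1 x) (M : ℝ≥0∞)).toReal := ENNReal.toReal_nonneg
        calc _ ≤ (min (hm3.mk h1 x) (M : ℝ≥0∞)).toReal + min (g x : ℝ) 1 :=
              div_le_self (by positivity) (by have := M.coe_nonneg; linarith)
          _ ≤ _ := by gcongr
      refine (ENNReal.ofReal_le_ofReal this).trans ?_
      rw [ENNReal.ofReal_add ENNReal.toReal_nonneg (by positivity), ENNReal.ofReal_toReal (hmin x),
        ENNReal.ofReal_coe_nnreal]
      gcongr
      exact (min_le_left _ _).trans (hx1 ▸ hx2)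
    refine ne_top_of_le_ne_top ?_ (lintegral_mono_ae this)
    rw [lintegral_add_right _ hgm.coe_nnreal_ennreal]
    exact ENNReal.add_ne_top.2 ⟨hint.ne, (hgi.trans ENNReal.one_lt_top).ne⟩
  · filter_upwards [hm3.ae_eq_mk, hle, hM] with x hx1 hx2 hx3
    have key : h1 x ≤ ENNReal.ofReal ((M + 1) * h2 x) := by
      have e : (M + 1) * h2 x = (min (hm3.mk h1 x) M).toReal + min (g x : ℝ) 1 := by
        simp only [hh2]; field_simp
      rw [e]
      have e0 : 0 ≤ min (g x : ℝ) 1 := le_min (by positivity) zero_le_one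
      calc h1 x = ENNReal.ofReal ((min (hm3.mk h1 x) M).toReal) := by
            rw [ENNReal.ofReal_toReal (hmin x), ← hx1, min_eq_left (hx2.trans hx3)]
        _ ≤ _ := ENNReal.ofReal_le_ofReal (by linarith)
    intro τ
    rw [ENNReal.ofReal_coe_nnreal]
    constructor
    · intro hτ
      rw [← tsub_le_iff_left]
      refine le_trans ?_ key
      refine le_trans ?_ (le_iSup (fun τ => max (k1 τ x) (k2 τ x)) τ)
      refine le_trans ?_ (le_max_left _ _)
      simp only [hk1]; rw [if_pos hτ]
    · intro hτ
      rw [← tsub_le_iff_left]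
      refine le_trans ?_ key
      refine le_trans ?_ (le_iSup (fun τ => max (k1 τ x) (k2 τ x)) τ)
      refine le_trans ?_ (le_max_right _ _)
      simp only [hk2, indicator_apply, Set.mem_ofPred_eq]; rw [if_pos hτ]

lemma A2_comp {p C : ℝ} (hp : 0 < p) (hφ : IsWeakPhi Set.univ φ) (hi : AInc p Set.univ φ) (h : A2 φ) 
    (hC : 1 ≤ C) (hup : ∀ x s t, 0 < s → s ≤ t → Gi φ x t ≤ C * (t / s) ^ (1 / p) * Gi φ x s) :
    ∃ h : RSp n → ℝ, HOK volume h ∧ ∃ K : ℝ, 1 ≤ K ∧ ∃ A : Set (RSp n), 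
      (∀ᵐ x ∂(volume : Measure (RSp n)), x ∈ A) ∧ ∀ x ∈ A, ∀ y ∈ A, ∀ t, h x ≤ t → h y ≤ t → t ≤ 1 → 
        Gi φ x t ≤ K * Gi φ y t := by
  obtain ⟨φi, hφi, hf, M, m, s, hh, hM, hm, hs, hA⟩ := A2_err hφ h
  obtain ⟨k, hk, hk'⟩ := shrink hp hi (ε := min s 1) (by positivity)
  obtain ⟨k', hkk, hkk'⟩ := shrink one_pos hφi.aInc_one (ε := min s 1 / (M + 1)) (by positivity)
  have hm' : (0 : ℝ) < m := by exact_mod_cast hm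
  have hkp : (0 : ℝ) < k := by exact_mod_cast hk
  have hkkp : (0 : ℝ) < k' := by exact_mod_cast hkk
  have hm1 : (1 : ℝ) ≤ m := by exact_mod_cast hm
  have hk1 : (1 : ℝ) ≤ k := by exact_mod_cast hk
  have hkk1 : (1 : ℝ) ≤ k' := by exact_mod_cast hkk
  refine ⟨hf, hh, (m * m * k * k') * (C * (M + 2) ^ (1 / p)), ?_, _, hA, ?_⟩
  · have e1 : 1 ≤ (M + 2) ^ (1 / p) := Real.one_le_rpow (by linarith) (by positivity)
    have e2 : (1 : ℝ) ≤ m * m * k * k' := by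
      have := one_le_mul_of_one_le_of_one_le (one_le_mul_of_one_le_of_one_le
        (one_le_mul_of_one_le_of_one_le hm1 hm1) hk1) hkk1
      exact this
    exact one_le_mul_of_one_le_of_one_le e2 (one_le_mul_of_one_le_of_one_le hC e1)
  intro x hx y hy t htx hty ht1
  have ht : 0 < t := (hh.pos x).trans_le htx
  refine le_of_forall_lt_imp_le_of_dense fun τ0 hτ0 => ?_
  obtain ⟨τ', h1, h2⟩ := exists_rat_btwn hτ0
  have hGy := Gi_pos hφ y ht
  rcases le_or_gt τ' 0 with h0 | h0
  · have : (τ' : ℝ) ≤ 0 := by exact_mod_cast h0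
    have h4 : 0 ≤ (m * m * k * k') * (C * (M + 2) ^ (1 / p)) * Gi φ y t := by positivity
    linarith
  refine h1.le.trans ?_
  lift τ' to ℚ≥0 using h0.le with τ
  have hτ : 0 < τ := by exact_mod_cast h0
  have hτ' : (τ : ℝ≥0) ≠ 0 := by exact_mod_cast hτ.ne'
  have f1 : φ x τ < ENNReal.ofReal t := lt_of_lt_Gi hφ (by
    have e : ((τ : ℝ≥0) : ℝ) = ((τ : ℚ) : ℝ) := by norm_cast
    rw [e]; exact h2)
  have f2 : φ x ((τ : ℝ≥0) / k) ≤ ENNReal.ofReal (min s 1 * t) := by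
    rcases hk' x τ with h | h
    · refine h.trans ?_
      rw [ENNReal.ofReal_mul (by positivity)]
      gcongr
    · exact absurd h hτ'
  have c1 : (((τ / k : ℚ≥0)) : ℝ≥0) = (τ : ℝ≥0) / k := by push_cast; rfl
  have f3 := (hx (τ / k)).2
  rw [c1] at f3
  have hst : min s 1 * t ≤ s := by
    calc min s 1 * t ≤ s * 1 := by gcongr; exact min_le_left _ _
      _ = s := mul_one s
  have hst1 : min s 1 * t ≤ t := by
    calc min s 1 * t ≤ 1 * t := by gcongr; exact min_le_right _ _
      _ = t := one_mul t
  replace f3 := f3 (f2.trans (ENNReal.ofReal_le_ofReal hst))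
  have f4 : φi ((τ : ℝ≥0) / k / m) ≤ ENNReal.ofReal ((M + 1) * t) := by
    refine f3.trans ((add_le_add_left f2 _).trans ?_)
    rw [← ENNReal.ofReal_add (by positivity) (by have := hh.pos x; positivity)]
    refine ENNReal.ofReal_le_ofReal ?_
    nlinarith
  have f5 : φi ((τ : ℝ≥0) / k / m / k') ≤ ENNReal.ofReal (min s 1 * t) := by
    rcases hkk' x ((τ : ℝ≥0) / k / m) with h | h
    · refine h.trans ?_
      calc _ ≤ ENNReal.ofReal (min s 1 / (M + 1)) * ENNReal.ofReal ((M + 1) * t) := by gcongr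
        _ = _ := by rw [← ENNReal.ofReal_mul (by positivity)]; congr 1; field_simp
    · refine absurd h ?_
      have : (k : ℝ≥0) ≠ 0 := by exact_mod_cast hk.ne'
      have : (m : ℝ≥0) ≠ 0 := by exact_mod_cast hm.ne'
      positivity
  have c2 : (((τ / k / m / k' : ℚ≥0)) : ℝ≥0) = (τ : ℝ≥0) / k / m / k' := by push_cast; rfl
  have f6 := (hy (τ / k / m / k')).1
  rw [c2] at f6
  replace f6 := f6 (f5.trans (ENNReal.ofReal_le_ofReal hst))
  have f7 : φ y ((τ : ℝ≥0) / k / m / k' / m) < ENNReal.ofReal ((M + 2) * t) := by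
    refine (f6.trans ((add_le_add_left f5 _))).trans_lt ?_
    rw [← ENNReal.ofReal_add (by positivity) (by have := hh.pos y; positivity),
      ENNReal.ofReal_lt_ofReal_iff (by positivity)]
    nlinarith
  have f8 := le_Gi hφ f7
  have f9 := hup y t ((M + 2) * t) ht (by nlinarith)
  rw [mul_div_cancel_right₀ _ ht.ne'] at f9
  have f10 := f8.trans f9
  push_cast at f10
  rw [div_le_iff₀ hm', div_le_iff₀ hkkp, div_le_iff₀ hm', div_le_iff₀ hkp] at f10
  calc ((τ : ℚ) : ℝ) = (τ : ℝ) := by norm_cast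
    _ ≤ _ := f10
    _ = _ := by ring

lemma A1_comp {p C : ℝ} (hp : 0 < p) (hφ : IsWeakPhi Set.univ φ) (h : A1 φ) 
    (hC : 1 ≤ C) (hup : ∀ x s t, 0 < s → s ≤ t → Gi φ x t ≤ C * (t / s) ^ (1 / p) * Gi φ x s) :
    ∃ K : ℝ, 1 ≤ K ∧ ∀ Q : Cube n, volume Q.set ≤ 1 → ∃ A : Set (RSp n), 
      (∀ᵐ x ∂(volume.restrict Q.set), x ∈ A) ∧ ∀ x ∈ A, ∀ y ∈ A, ∀ t, 1 ≤ t →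
        t ≤ 1 / (volume Q.set).toReal → Gi φ x t ≤ K * Gi φ y t := by
  obtain ⟨β, hβ, hβ1, h⟩ := h
  have hβ' : (0 : ℝ) < β := by exact_mod_cast hβ
  have hβ1' : (β : ℝ) < 1 := by exact_mod_cast hβ1
  refine ⟨C * 2 ^ (1 / p) / β, ?_, fun Q hQ => ?_⟩
  · rw [le_div_iff₀ hβ', one_mul]
    have e1 : (1 : ℝ) ≤ 2 ^ (1 / p) := Real.one_le_rpow (by norm_num) (by positivity)
    have := one_le_mul_of_one_le_of_one_le hC e1
    linarith
  specialize h Q hQ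
  set X0 : Set (RSp n) := {x | ∀ᵐ y ∂(volume.restrict Q.set),
      ∀ t : ℝ≥0∞, 1 ≤ t → t ≤ (volume Q.set)⁻¹ →
        (β : ℝ≥0∞) * phiInv φ x t ≤ phiInv φ y t} with hX0
  have hne : X0.Nonempty := by
    have : NeBot (ae (volume.restrict Q.set)) := by
      rw [ae_neBot, Ne, Measure.restrict_eq_zero]
      exact Q.vol_ne_zero
    exact h.exists
  have hseq : ∀ N : ℕ, ∃ u : ℕ → RSp n, (∀ i, u i ∈ X0) ∧ 
      ∀ x ∈ X0, phiInv φ x N ≤ ⨆ i, phiInv φ (u i) N := by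
    intro N
    obtain ⟨u, hu1, hu2, hu3⟩ := exists_seq_tendsto_sSup (hne.image (fun x => phiInv φ x N)) (OrderTop.bddAbove _)
    choose v hv hv' using hu3
    refine ⟨v, hv, fun x hx => ?_⟩
    have e1 : phiInv φ x N ≤ sSup ((fun x => phiInv φ x N) '' X0) := le_sSup ⟨x, hx, rfl⟩
    refine e1.trans (le_of_tendsto' hu2 fun i => ?_)
    rw [← hv' i]
    exact le_iSup (fun i => phiInv φ (v i) N) i
  choose u hu hu' using hseq
  have hy : ∀ᵐ y ∂(volume.restrict Q.set), ∀ N i, 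
      ∀ t : ℝ≥0∞, 1 ≤ t → t ≤ (volume Q.set)⁻¹ →
        (β : ℝ≥0∞) * phiInv φ (u N i) t ≤ phiInv φ y t :=
    ae_all_iff.2 fun N => ae_all_iff.2 fun i => hu N i
  refine ⟨{y | y ∈ X0 ∧ ∀ N i, 
      ∀ t : ℝ≥0∞, 1 ≤ t → t ≤ (volume Q.set)⁻¹ →
        (β : ℝ≥0∞) * phiInv φ (u N i) t ≤ phiInv φ y t}, h.and hy, ?_⟩
  rintro x ⟨hx, -⟩ y ⟨-, hy⟩ t ht1 ht2
  set N : ℕ := ⌊t⌋₊ with hN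
  have hN1 : (1 : ℝ) ≤ N := by
    have : 1 ≤ N := Nat.le_floor (by simpa using ht1)
    exact_mod_cast this
  have hNt : (N : ℝ) ≤ t := Nat.floor_le (by linarith)
  have htN : t ≤ 2 * N := by
    have := (Nat.lt_floor_add_one t).le
    rw [← hN] at this
    linarith
  have hNN : (ENNReal.ofReal N) = (N : ℝ≥0∞) := by simp
  have g1 : (β : ℝ≥0∞) * phiInv φ x N ≤ phiInv φ y N := by
    calc (β : ℝ≥0∞) * phiInv φ x N ≤ β * ⨆ i, phiInv φ (u N i) N := by gcongr; exact hu' N x hx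
      _ = ⨆ i, β * phiInv φ (u N i) N := ENNReal.mul_iSup ..
      _ ≤ _ := iSup_le fun i => by
        refine hy N i N ?_ ?_
        · exact_mod_cast hN1
        · rw [← hNN, ← ENNReal.ofReal_toReal Q.vol_ne_top, ← ENNReal.ofReal_inv_of_pos
            (ENNReal.toReal_pos Q.vol_ne_zero Q.vol_ne_top)]
          refine ENNReal.ofReal_le_ofReal ?_
          rw [← one_div]; exact hNt.trans ht2
  have g2 : β * Gi φ x N ≤ Gi φ y N := by
    have := ENNReal.toReal_mono (phiInv_ne_top hφ (by simp)) g1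
    rw [ENNReal.toReal_mul] at this
    simpa [Gi] using this
  have g3 := hup x N t (by linarith) hNt
  have g4 : (t / N) ^ (1 / p) ≤ 2 ^ (1 / p) := by
    gcongr
    rw [div_le_iff₀ (by linarith)]; exact htN
  have g5 := Gi_mono hφ (x := y) hNt
  have g6 := Gi_pos hφ x (t := N) (by linarith)
  rw [div_mul_eq_mul_div, le_div_iff₀ hβ']
  calc Gi φ x t * β ≤ (C * (t / N) ^ (1 / p) * Gi φ x N) * β := by gcongr
    _ ≤ (C * 2 ^ (1 / p) * Gi φ x N) * β := by gcongr
    _ = C * 2 ^ (1 / p) * (β * Gi φ x N) := by ring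
    _ ≤ C * 2 ^ (1 / p) * Gi φ y t := by
      have := g2.trans g5
      gcongr

lemma Nice_Gi {p r : ℝ} (hp : 0 < p) (hr : 0 < r) (hφ : IsWeakPhi Set.univ φ)
    (h1 : A1 φ) (h2 : A2 φ) (hi : AInc p Set.univ φ) (hd : ADec (1 / r) Set.univ φ) :
    ∃ (h : RSp n → ℝ) (C : ℝ), HOK volume h ∧ Nice volume (cubeFam n) h (Gi φ) r (1 / p) C := by
  obtain ⟨C1, hC1, hup⟩ := Gi_up hp hφ hi
  obtain ⟨C2, hC2, hlo⟩ := Gi_lo hr hφ hd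
  obtain ⟨h, hh, K1, hK1, A, hA, hA'⟩ := A2_comp hp hφ hi h2 hC1 hup
  obtain ⟨K2, hK2, hB⟩ := A1_comp hp hφ h1 hC1 hup
  set C := max (max C1 C2) (max K1 K2) with hC
  have l1 : C1 ≤ C := (le_max_left _ _).trans (le_max_left _ _)
  have l2 : C2 ≤ C := (le_max_right _ _).trans (le_max_left _ _)
  have l3 : K1 ≤ C := (le_max_left _ _).trans (le_max_right _ _)
  have l4 : K2 ≤ C := (le_max_right _ _).trans (le_max_right _ _)
  refine ⟨h, C, hh, hC1.trans l1, hr.le, by positivity, fun x t ht => Gi_pos hφ x ht, ?_, ?_, ?_⟩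
  · intro x s t hs hst
    have ht : 0 < t := hs.trans_le hst
    have := Gi_pos hφ x hs
    refine (hup x s t hs hst).trans ?_
    gcongr
  · intro x s t hs hst
    have := Gi_pos hφ x (hs.trans_le hst)
    refine (hlo x s t hs hst).trans ?_
    gcongr
  · rintro E ⟨hE, Q, hEQ, hvol⟩
    rcases le_total (volume Q.set) 1 with hQ | hQ
    · obtain ⟨B, hB1, hB2⟩ := hB Q hQ
      refine ⟨A ∩ B, ?_, ?_⟩
      · filter_upwards [ae_restrict_of_ae hA, ae_restrict_of_ae_restrict_of_subset hEQ hB1] with x a b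
        exact ⟨a, b⟩
      rintro x ⟨hxA, hxB⟩ y ⟨hyA, hyB⟩ t h1 h2 h3
      have ht : 0 < t := (hh.pos x).trans_le h1
      have hy0 := Gi_pos hφ y ht
      rcases le_total t 1 with h4 | h4
      · refine (hA' x hxA y hyA t h1 h2 h4).trans ?_
        gcongr
      · refine (hB2 x hxB y hyB t h4 ?_).trans ?_
        · rw [hvol] at h3
          refine h3.trans (max_le ?_ le_rfl)
          rw [le_div_iff₀ (ENNReal.toReal_pos Q.vol_ne_zero Q.vol_ne_top), one_mul]
          have := ENNReal.toReal_mono ENNReal.one_ne_top hQ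
          simpa using this
        · gcongr
    · refine ⟨A, ae_restrict_of_ae hA, fun x hx y hy t h1 h2 h3 => ?_⟩
      have ht : 0 < t := (hh.pos x).trans_le h1
      have hy0 := Gi_pos hφ y ht
      refine (hA' x hx y hy t h1 h2 (h3.trans (max_le le_rfl ?_))).trans ?_
      · rw [hvol, div_le_one (ENNReal.toReal_pos Q.vol_ne_zero Q.vol_ne_top)]
        have := ENNReal.toReal_mono Q.vol_ne_top hQ
        simpa using this
      · gcongr

lemma A0_one (h : A0 Set.univ φ) (hφ : IsWeakPhi Set.univ φ) :
    ∃ β : ℝ, 0 < β ∧ ∀ᵐ x ∂(volume : Measure (RSp n)), β ≤ Gi φ x 1 := by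
  obtain ⟨β, hβ, -, h⟩ := h
  refine ⟨β, by exact_mod_cast hβ, ?_⟩
  rw [Measure.restrict_univ] at h
  filter_upwards [h] with x hx
  have := ENNReal.toReal_mono (phiInv_ne_top hφ ENNReal.one_ne_top) hx.1
  simpa [Gi] using this

/-- All structural data needed. -/
lemma setup {p q α r : ℝ} {ψ : RSp n → ℝ≥0 → ℝ≥0∞}
    (hp : 1 < p) (hpq : p ≤ q) (hα : α / (n : ℝ) = 1 / p - 1 / q)
    (hφ : IsWeakPhi Set.univ φ) (hψ : IsWeakPhi Set.univ ψ)
    (hinv : FracInvRel α φ ψ)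
    (hr₁ : α / (n : ℝ) < r) (hr₂ : r ≤ 1 / p)
    (ha0 : A0 Set.univ φ) (ha1 : A1 φ) (ha2 : A2 φ)
    (hainc : AInc p Set.univ φ) (hadec : ADec (1 / r) Set.univ φ) :
    ∃ (h : RSp n → ℝ) (C c Cl c' Cl' : ℝ), HOK volume h ∧ 
      Nice volume (cubeFam n) h (Gi φ) r (1 / p) C ∧ Link volume φ (Gi φ) c Cl ∧
      Link volume ψ (fun x t => t ^ (-(α / n)) * Gi φ x t) c' Cl' := by
  have hγ : 0 ≤ α / n := by
    rw [hα, sub_nonneg]; gcongr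
  have hγp : α / n < 1 / p := by linarith
  obtain ⟨h, C, hh, hN⟩ := Nice_Gi (by linarith) (by linarith) hφ ha1 ha2 hainc hadec
  have h1 := A0_one ha0 hφ
  have hN' := hN.frac hh (γ := α / n) hr₁.le (by linarith)
  obtain ⟨c1, c2, hc1, hrel⟩ := hinv
  have hrel' : ∀ x t, 0 < t → c1 * (t ^ (α / n) * Gi ψ x t) ≤ Gi φ x t ∧ 
      Gi φ x t ≤ c2 * (t ^ (α / n) * Gi ψ x t) := by
    intro x t ht
    obtain ⟨e1, e2⟩ := hrel x t.toNNReal (by simpa using ht)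
    have e3 : ((t.toNNReal : ℝ≥0) : ℝ≥0∞) = ENNReal.ofReal t := rfl
    rw [e3] at e1 e2
    have t1 := phiInv_ne_top hφ (x := x) (t := ENNReal.ofReal t) ENNReal.ofReal_ne_top
    have t2 := phiInv_ne_top hψ (x := x) (t := ENNReal.ofReal t) ENNReal.ofReal_ne_top
    have e4 := ENNReal.toReal_mono t1 e1
    have e5 := ENNReal.toReal_mono (ENNReal.mul_ne_top ENNReal.coe_ne_top 
      (ENNReal.mul_ne_top (ENNReal.rpow_ne_top_of_nonneg hγ ENNReal.ofReal_ne_top) t2)) e2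
    simp only [ENNReal.toReal_mul, ← ENNReal.toReal_rpow, ENNReal.toReal_ofReal ht.le, ENNReal.coe_toReal] at e4 e5
    exact ⟨e4, e5⟩
  have hc2 : (0 : ℝ) < c2 := by
    have := (Gi_pos hφ 0 one_pos).trans_le (hrel' 0 1 one_pos).2
    by_contra! h0
    have : (c2 : ℝ) = 0 := le_antisymm h0 c2.coe_nonneg
    simp_all
  have hc1' : (0 : ℝ) < c1 := by exact_mod_cast hc1
  refine ⟨h, C, _, _, _, _, hh, hN, link_of hφ hN one_pos one_pos (fun x t ht => by simp) h1,
    link_of hψ hN' (κ1 := 1 / c2) (κ2 := 1 / c1) (by positivity) (by positivity) (fun x t ht => ?_) (by simpa using h1)⟩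
  obtain ⟨e1, e2⟩ := hrel' x t ht
  have et : t ^ (-(α / n)) * t ^ (α / n) = 1 := by
    rw [← Real.rpow_add ht]; simp
  have ep : 0 < t ^ (-(α / n)) := by positivity
  constructor
  · rw [one_div, inv_mul_le_iff₀ hc2]
    calc _ ≤ t ^ (-(α / n)) * (c2 * (t ^ (α / n) * Gi ψ x t)) := by gcongr
      _ = (t ^ (-(α / n)) * t ^ (α / n)) * (c2 * Gi ψ x t) := by ring
      _ = _ := by rw [et, one_mul]
  · rw [one_div, le_inv_mul_iff₀ hc1']
    calc _ = (t ^ (-(α / n)) * t ^ (α / n)) * (c1 * Gi ψ x t) := by rw [et, one_mul]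
      _ = t ^ (-(α / n)) * (c1 * (t ^ (α / n) * Gi ψ x t)) := by ring
      _ ≤ _ := by gcongr

end fam

set_option linter.unusedVariables false

section core

variable {n : ℕ}

lemma IsBMO.congr_ae {b b' : RSp n → ℝ} (h : b =ᵐ[volume] b') (hb : IsBMO b) : IsBMO b' := by
  refine ⟨fun x => ?_, ?_⟩
  · obtain ⟨s, hs, hs'⟩ := hb.1 x
    exact ⟨s, hs, hs'.congr (ae_restrict_of_ae h)⟩
  · have : bmoNorm b' = bmoNorm b := by
      unfold bmoNorm
      congr 1; ext Q
      congr 1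
      have e : cubeAvg Q b' = cubeAvg Q b := by
        unfold cubeAvg
        rw [setAverage_eq, setAverage_eq]
        congr 1
        exact integral_congr_ae (ae_restrict_of_ae h.symm)
      rw [e]
      refine lintegral_congr_ae ?_
      filter_upwards [ae_restrict_of_ae h] with x hx
      rw [hx]
    rw [this]; exact hb.2

lemma fracMaximal_smul (α : ℝ) (c : ℝ) (f : RSp n → ℝ) (x : RSp n) :
    fracMaximal α (fun y => c * f y) x = ‖c‖ₑ * fracMaximal α f x := by
  unfold fracMaximal
  simp only [ENNReal.mul_iSup]
  congr 1; ext Q; congr 1; ext hx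
  have : ∀ y, (‖c * f y‖₊ : ℝ≥0∞) = ‖c‖ₑ * (‖f y‖₊ : ℝ≥0∞) := by
    intro y; rw [nnnorm_mul, ENNReal.coe_mul]; rfl
  simp only [this]
  rw [lintegral_const_mul' _ _ (by simp)]
  ring

lemma fracMaximalComm_smul (α : ℝ) (c : ℝ) (b f : RSp n → ℝ) (x : RSp n) :
    fracMaximalComm α b (fun y => c * f y) x = ‖c‖ₑ * fracMaximalComm α b f x := by
  unfold fracMaximalComm
  simp only [ENNReal.mul_iSup]
  congr 1; ext Q; congr 1; ext hx
  have : ∀ y, (‖b x - b y‖₊ : ℝ≥0∞) * (‖c * f y‖₊ : ℝ≥0∞) =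
      ‖c‖ₑ * ((‖b x - b y‖₊ : ℝ≥0∞) * (‖f y‖₊ : ℝ≥0∞)) := by
    intro y; rw [nnnorm_mul, ENNReal.coe_mul]
    change _ * (‖c‖ₑ * _) = _
    ring
  simp only [this]
  rw [lintegral_const_mul' _ _ (by simp)]
  ring

lemma fracMaximalComm_congr {α : ℝ} {b b' : RSp n → ℝ} (h : b =ᵐ[volume] b') (f : RSp n → ℝ) :
    ∀ᵐ x ∂(volume : Measure (RSp n)), fracMaximalComm α b f x = fracMaximalComm α b' f x := by
  filter_upwards [h] with x hx
  unfold fracMaximalComm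
  congr 1; ext Q; congr 1; ext hxQ
  congr 1
  refine lintegral_congr_ae ?_
  filter_upwards [ae_restrict_of_ae h] with y hy
  rw [hx, hy]

/-- Modular bound gives domination. -/
lemma dom_of_modular {h : RSp n → ℝ} {φ : RSp n → ℝ≥0 → ℝ≥0∞} {G : RSp n → ℝ → ℝ} {a b C c Cl : ℝ}
    (hh : HOK volume h) (hG : Nice volume (cubeFam n) h G a b C) (hl : Link volume φ G c Cl) :
    ∃ C0 : ℝ, 0 < C0 ∧ ∀ f : RSp n → ℝ, AEMeasurable f volume → ∫⁻ x, φ x ‖f x‖₊ ≤ 1 →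
      Dom volume h G C0 (fun x => ‖f x‖ₑ) := by
  set I := (∫⁻ x, ENNReal.ofReal (h x) : ℝ≥0∞).toReal with hI
  have hI0 : 0 ≤ I := ENNReal.toReal_nonneg
  have hcl := hl.cl0
  refine ⟨1 + I + Cl, by positivity, fun f hf hint => ?_⟩
  have hu : AEMeasurable (fun x => φ x ‖f x‖₊) volume := by
    have h1 := hl.meas (fun x => ‖hf.mk f x‖₊) hf.measurable_mk.nnnorm
    refine h1.congr ?_
    filter_upwards [hf.ae_eq_mk] with x hx
    rw [hx]
  refine ⟨fun x => (hu.mk _ x).toReal + h x, hu.measurable_mk.ennreal_toReal.add hh.meas, fun x => ?_, ?_, ?_⟩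
  · have : 0 ≤ (hu.mk _ x).toReal := ENNReal.toReal_nonneg
    linarith
  · calc ∫⁻ x, ENNReal.ofReal ((hu.mk _ x).toReal + h x) 
        ≤ ∫⁻ x, (φ x ‖f x‖₊ + ENNReal.ofReal (h x)) := by
          refine lintegral_mono_ae ?_
          filter_upwards [hu.ae_eq_mk] with x hx
          rw [ENNReal.ofReal_add ENNReal.toReal_nonneg (hh.pos x).le, ← hx]
          gcongr
          exact ENNReal.ofReal_toReal_le
      _ = (∫⁻ x, φ x ‖f x‖₊) + ∫⁻ x, ENNReal.ofReal (h x) := lintegral_add_right _ hh.meas.ennreal_ofReal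
      _ ≤ 1 + ENNReal.ofReal I := by rw [hI, ENNReal.ofReal_toReal hh.int]; gcongr
      _ = ENNReal.ofReal (1 + I) := by rw [ENNReal.ofReal_add zero_le_one hI0, ENNReal.ofReal_one]
      _ ≤ _ := ENNReal.ofReal_le_ofReal (by linarith)
  · have hfin := ae_lt_top' hu (ne_top_of_le_ne_top ENNReal.one_ne_top hint)
    filter_upwards [hu.ae_eq_mk, hfin] with x hx hx2
    have hw : 0 < (hu.mk _ x).toReal + h x := by
      have := hh.pos x
      have : 0 ≤ (hu.mk _ x).toReal := ENNReal.toReal_nonneg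
      linarith
    have := hl.L2 x _ ‖f x‖₊ hw (by
      calc φ x ‖f x‖₊ = ENNReal.ofReal ((hu.mk _ x).toReal) := by rw [← hx, ENNReal.ofReal_toReal hx2.ne]
        _ ≤ _ := ENNReal.ofReal_le_ofReal (by linarith [hh.pos x]))
    rw [← ofReal_norm]
    refine ENNReal.ofReal_le_ofReal ?_
    rw [coe_nnnorm] at this
    refine this.trans ?_
    have := hG.pos x _ hw
    gcongr
    linarith

/-- Domination gives a modular bound. -/
lemma modular_of_dom {X : Type*} [MeasurableSpace X] {μ : Measure X} {Fam : Set (Set X)} {h : X → ℝ}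
    {ψ : X → ℝ≥0 → ℝ≥0∞} {H : X → ℝ → ℝ} {a b C c Cl C0 : ℝ}
    (hh : HOK μ h) (hH : Nice μ Fam h H a b C) (hl : Link μ ψ H c Cl) (hC0 : 0 ≤ C0) :
    ∃ Λ : ℝ≥0, 0 < Λ ∧ ∀ F, Dom μ h H C0 F → ∀ g : X → ℝ≥0, (∀ᵐ x ∂μ, (g x : ℝ≥0∞) ≤ F x) →
      ∫⁻ x, ψ x (g x / Λ) ∂μ ≤ 1 := by
  have hc := hl.c0
  have hC := hH.one
  set C1 := C0 + 1 with hC1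
  have hC1' : 1 ≤ C1 := by linarith
  set Λ0 : ℝ := 2 * (C1 * C * C1 ^ b) / c with hΛ0
  have hΛp : 0 < Λ0 := by positivity
  refine ⟨Λ0.toNNReal, by simpa using hΛp, fun F hF g hg => ?_⟩
  obtain ⟨w, hw1, hw2, hw3, hw4⟩ := hF.monoC hh hH.pos (show C0 ≤ C1 by linarith)
  calc ∫⁻ x, ψ x (g x / Λ0.toNNReal) ∂μ ≤ ∫⁻ x, ENNReal.ofReal (C1⁻¹) * ENNReal.ofReal (w x) ∂μ := by
        refine lintegral_mono_ae ?_
        filter_upwards [hw4, hg] with x h1 h2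
        have hw : 0 < w x := (hh.pos x).trans_le (hw2 x)
        rw [← ENNReal.ofReal_mul (by positivity)]
        refine hl.L1 x _ _ (by positivity) ?_
        have h3 := h2.trans h1
        have hHw := hH.pos x _ hw
        rw [← ENNReal.ofReal_coe_nnreal, ENNReal.ofReal_le_ofReal_iff (by positivity)] at h3
        have h4 := hH.up x (C1⁻¹ * w x) (w x) (by positivity) (by
          have : C1⁻¹ ≤ 1 := inv_le_one_of_one_le₀ hC1'
          nlinarith)
        have e : w x / (C1⁻¹ * w x) = C1 := by field_simp
        rw [e] at h4
        have hHw' := hH.pos x (C1⁻¹ * w x) (by positivity)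
        push_cast
        rw [Real.coe_toNNReal _ hΛp.le, div_lt_iff₀ hΛp]
        calc (g x : ℝ) ≤ C1 * H x (w x) := h3
          _ ≤ C1 * (C * C1 ^ b * H x (C1⁻¹ * w x)) := by gcongr
          _ = c * H x (C1⁻¹ * w x) * (Λ0 / 2) := by rw [hΛ0]; field_simp
          _ < c * H x (C1⁻¹ * w x) * Λ0 := by
            have : 0 < c * H x (C1⁻¹ * w x) := by positivity
            nlinarith
    _ = ENNReal.ofReal C1⁻¹ * ∫⁻ x, ENNReal.ofReal (w x) ∂μ := lintegral_const_mul _ hw1.ennreal_ofReal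
    _ ≤ ENNReal.ofReal C1⁻¹ * ENNReal.ofReal C1 := by gcongr
    _ = 1 := by rw [← ENNReal.ofReal_mul (by positivity), inv_mul_cancel₀ (by positivity), ENNReal.ofReal_one]

lemma norm_le_of {φ ψ : RSp n → ℝ≥0 → ℝ≥0∞} {f T : RSp n → ℝ} {Λ : ℝ≥0} (hΛ : 0 < Λ)
    (h : ∀ lam : ℝ≥0, 0 < lam → ∫⁻ x, φ x (‖f x‖₊ / lam) ≤ 1 → 
      ∫⁻ x, ψ x (‖T x‖₊ / (Λ * lam)) ≤ 1) :
    orliczNorm ψ Set.univ T ≤ Λ * orliczNorm φ Set.univ f := by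
  have h0 : (Λ : ℝ≥0∞) ≠ 0 := by simpa using hΛ.ne'
  rw [mul_comm, ← ENNReal.div_le_iff h0 ENNReal.coe_ne_top]
  refine le_sInf ?_
  rintro _ ⟨lam, ⟨hl, hl'⟩, rfl⟩
  rw [ENNReal.div_le_iff h0 ENNReal.coe_ne_top]
  rw [Measure.restrict_univ] at hl'
  refine sInf_le ⟨lam * Λ, ⟨by positivity, ?_⟩, by simp⟩
  rw [Measure.restrict_univ, mul_comm]
  exact h lam hl hl'

lemma core {α : ℝ} (hn : 0 < n) (hα : 0 ≤ α / n) {h : RSp n → ℝ} {φ ψ : RSp n → ℝ≥0 → ℝ≥0∞}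
    {G : RSp n → ℝ → ℝ} {a b C c Cl c' Cl' : ℝ}
    (hh : HOK volume h) (hG : Nice volume (cubeFam n) h G a b C) (hl : Link volume φ G c Cl)
    (hl' : Link volume ψ (fun x t => t ^ (-(α / n)) * G x t) c' Cl')
    (hγa : α / n < a) (hab : a - α / n < 1) (hb1 : b < 1) (hγb : α / n < b)
    {b0 : RSp n → ℝ} (hb0 : IsBMO b0) {B : ℝ} (hB : 1 ≤ B) :
    ∃ Λ : ℝ≥0, 0 < Λ ∧ ∀ f T : RSp n → ℝ, AEMeasurable f volume → 
      (∀ᵐ x ∂(volume : Measure (RSp n)), 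
        ‖T x‖ₑ ≤ fracMaximalComm α b0 f x + ENNReal.ofReal B * fracMaximal α f x) →
      orliczNorm ψ Set.univ T ≤ Λ * orliczNorm φ Set.univ f := by
  have hbm := hb0.1.aestronglyMeasurable.aemeasurable
  set b1 := hbm.mk b0 with hb1'
  have hbb : b0 =ᵐ[volume] b1 := hbm.ae_eq_mk
  have hB1 : IsBMO b1 := hb0.congr_ae hbb
  have hosc := grid_osc hn hbm.measurable_mk hB1
  obtain ⟨C0, hC0, hdom⟩ := dom_of_modular hh hG hl
  have hH := hG.frac hh hγa.le hγb
  have key1 : ∀ σ : Fin n → Bool, _ := fun σ => (grid σ).dom_Ms hG hh (grid_fam σ) hα hγa.le (le_refl (1 : ℝ)) (by linarith) hC0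
  have key2 : ∀ σ : Fin n → Bool, _ := fun σ => (grid σ).dom_Cm hα hγa hab hb1 hγb hG hh hl' (grid_fam σ) (hosc σ) hC0
  choose K1 hK1 hK1' using key1
  choose K2 hK2 hK2' using key2
  set K : ℝ := ∑ σ, (K1 σ + K2 σ) with hK
  have hK0 : 0 ≤ K := Finset.sum_nonneg fun σ _ => add_nonneg (hK1 σ) (hK2 σ)
  have hle1 : ∀ σ, K1 σ ≤ K := fun σ => (le_add_of_nonneg_right (hK2 σ)).trans
    (Finset.single_le_sum (f := fun σ => K1 σ + K2 σ) (fun σ _ => add_nonneg (hK1 σ) (hK2 σ)) (Finset.mem_univ σ))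
  have hle2 : ∀ σ, K2 σ ≤ K := fun σ => (le_add_of_nonneg_left (hK1 σ)).trans
    (Finset.single_le_sum (f := fun σ => K1 σ + K2 σ) (fun σ _ => add_nonneg (hK1 σ) (hK2 σ)) (Finset.mem_univ σ))
  obtain ⟨K3, hK3, hsum⟩ := Dom.sum hh hH (Finset.univ : Finset (Fin n → Bool)) K hK0
  have h6 : (1 : ℝ) ≤ 6 ^ n := one_le_pow₀ (by norm_num)
  have e6 : (6 : ℝ≥0∞) ^ n = ENNReal.ofReal (6 ^ n) := by
    rw [ENNReal.ofReal_pow (by norm_num)]; norm_num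
  set K4 : ℝ := C * (6 ^ n * K3 + B * (6 ^ n * K3)) with hK4
  have hK4' : 0 ≤ K4 := by have := hG.one; positivity
  have main : ∀ f : RSp n → ℝ, AEMeasurable f volume → ∫⁻ x, φ x ‖f x‖₊ ≤ 1 → 
      Dom volume h (fun x t => t ^ (-(α / n)) * G x t) K4
        (fun x => fracMaximalComm α b0 f x + ENNReal.ofReal B * fracMaximal α f x) := by
    intro f hf hint
    have hfd := hdom f hf hint
    have d1 := hsum (fun σ => (grid σ).Ms (α / n) 1 (fun y => ‖f y‖ₑ)) 
      (fun σ => (hK1' σ _ hfd).monoC hh hH.pos (hle1 σ)) Finset.univ_nonempty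
    have d2 := hsum (fun σ => (grid σ).Cm (α / n) b1 (fun y => ‖f y‖ₑ)) 
      (fun σ => (hK2' σ _ hf.enorm hfd).monoC hh hH.pos (hle2 σ)) Finset.univ_nonempty
    have d1' := ((d1.smul hh hH.pos h6 hK3).mono (F1 := fracMaximal α f) (Eventually.of_forall fun x => by
      have := fracMaximal_le hα f x
      rwa [e6] at this)).smul hh hH.pos hB (by positivity)
    have d2' := ((d2.smul hh hH.pos h6 hK3).mono (F1 := fracMaximalComm α b0 f) (by
      filter_upwards [fracMaximalComm_congr (α := α) hbb f] with x hx
      have := fracMaximalComm_le hα b1 f x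
      rw [e6] at this
      rwa [hx]))
    exact Dom.add hh hH (by positivity) (by positivity) d2' d1'
  obtain ⟨Λ, hΛ, hmod⟩ := modular_of_dom hh hH hl' hK4'
  refine ⟨Λ, hΛ, fun f T hf hT => norm_le_of hΛ fun lam hlam hint => ?_⟩
  have hlam' : (0 : ℝ) < lam := by exact_mod_cast hlam
  have hnn : ∀ y, ‖(lam : ℝ)⁻¹ * y‖₊ = ‖y‖₊ / lam := by
    intro y
    rw [nnnorm_mul, nnnorm_inv, Real.nnnorm_of_nonneg hlam'.le, mul_comm, div_eq_mul_inv]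
    rfl
  have := hmod _ (main (fun y => (lam : ℝ)⁻¹ * f y) (hf.const_mul _) (by simpa only [hnn] using hint))
    (fun x => ‖(lam : ℝ)⁻¹ * T x‖₊) (by
      filter_upwards [hT] with x hx
      rw [fracMaximal_smul, fracMaximalComm_smul]
      rw [nnnorm_mul, ENNReal.coe_mul]
      change ‖(lam : ℝ)⁻¹‖ₑ * ‖T x‖ₑ ≤ _
      calc _ ≤ ‖(lam : ℝ)⁻¹‖ₑ * (fracMaximalComm α b0 f x + ENNReal.ofReal B * fracMaximal α f x) := by gcongr
        _ = _ := by ring)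
  simp only [hnn] at this
  simpa only [div_div, mul_comm] using this

end core

set_option linter.unusedVariables false

section fwd

variable {n : ℕ}

/-- the elementary estimate -/
lemma abs_aux {m1 m2 cm : ℝ≥0∞} {bx M : ℝ} (h1 : m1 ≤ cm + ‖bx‖ₑ * m2) (h2 : ‖bx‖ₑ * m2 ≤ m1 + cm)
    (hM : -bx ≤ M) (hM0 : 0 ≤ M) : ‖m1.toReal - bx * m2.toReal‖ₑ ≤ cm + ENNReal.ofReal (2 * M + 1) * m2 := by
  rcases eq_or_ne cm ∞ with rfl | hc
  · simp
  rcases eq_or_ne m2 ∞ with rfl | hm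
  · rw [ENNReal.mul_top (by simp; linarith)]; simp
  have hm1 : m1 ≠ ∞ := ne_top_of_le_ne_top (by finiteness) h1
  lift m1 to ℝ≥0 using hm1
  lift m2 to ℝ≥0 using hm
  lift cm to ℝ≥0 using hc
  have e1 : (m1 : ℝ) ≤ cm + |bx| * m2 := by
    change (m1 : ℝ≥0∞) ≤ cm + (‖bx‖₊ : ℝ≥0∞) * m2 at h1
    have : m1 ≤ cm + ‖bx‖₊ * m2 := by exact_mod_cast h1
    exact_mod_cast this
  have e2 : |bx| * m2 ≤ (m1 : ℝ) + cm := by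
    change (‖bx‖₊ : ℝ≥0∞) * m2 ≤ m1 + cm at h2
    have : ‖bx‖₊ * m2 ≤ m1 + cm := by exact_mod_cast h2
    exact_mod_cast this
  have e3 : ENNReal.ofReal (2 * M + 1) * (m2 : ℝ≥0∞) = ENNReal.ofReal ((2 * M + 1) * m2) := by
    rw [ENNReal.ofReal_mul (by positivity), ENNReal.ofReal_coe_nnreal]
  rw [e3, ← ENNReal.ofReal_coe_nnreal (p := cm), ← ENNReal.ofReal_add (by positivity) (by positivity),
    ← ofReal_norm]
  refine ENNReal.ofReal_le_ofReal ?_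
  simp only [ENNReal.coe_toReal, Real.norm_eq_abs]
  have hm2 : (0 : ℝ) ≤ m2 := m2.coe_nonneg
  have e4 : |bx| - bx ≤ 2 * M := by
    rcases abs_cases bx with ⟨h, _⟩ | ⟨h, _⟩ <;> rw [h] <;> linarith
  have e5 : 0 ≤ |bx| - bx := by linarith [le_abs_self bx]
  have e6 : (|bx| - bx) * m2 ≤ 2 * M * m2 := by gcongr
  have e7 : 0 ≤ (|bx| - bx) * m2 := by positivity
  rw [abs_le]
  constructor <;> nlinarith

lemma comm_bound {α : ℝ} {b f : RSp n → ℝ} (hb : AEMeasurable b volume) (hf : AEMeasurable f volume)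
    {M : ℝ} (hM : 0 ≤ M) {x : RSp n} (hx : -(b x) ≤ M) :
    ‖fracMaximalCommutator α b f x‖ₑ ≤ 
      fracMaximalComm α b f x + ENNReal.ofReal (2 * M + 1) * fracMaximal α f x := by
  refine abs_aux ?_ ?_ hx hM
  · refine iSup₂_le fun Q hQ => ?_
    calc volume Q.set ^ (α / (n : ℝ) - 1) * ∫⁻ y in Q.set, (‖b y * f y‖₊ : ℝ≥0∞) 
        ≤ volume Q.set ^ (α / (n : ℝ) - 1) * ∫⁻ y in Q.set, ((‖b x - b y‖₊ : ℝ≥0∞) * (‖f y‖₊ : ℝ≥0∞) + 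
            ‖b x‖ₑ * (‖f y‖₊ : ℝ≥0∞)) := by
          gcongr with y
          change _ ≤ _ + (‖b x‖₊ : ℝ≥0∞) * _
          rw [← add_mul]
          norm_cast
          rw [nnnorm_mul]
          gcongr
          have := nnnorm_sub_le (b x) (b x - b y)
          rw [_root_.sub_sub_cancel] at this
          rwa [add_comm]
      _ = volume Q.set ^ (α / (n : ℝ) - 1) * (∫⁻ y in Q.set, (‖b x - b y‖₊ : ℝ≥0∞) * (‖f y‖₊ : ℝ≥0∞)) +
            ‖b x‖ₑ * (volume Q.set ^ (α / (n : ℝ) - 1) * ∫⁻ y in Q.set, (‖f y‖₊ : ℝ≥0∞)) := by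
          have hm : AEMeasurable (fun y => ‖b x‖ₑ * (‖f y‖₊ : ℝ≥0∞)) (volume.restrict Q.set) :=
            hf.restrict.enorm.const_mul _
          rw [lintegral_add_right' _ hm, lintegral_const_mul' _ _ (by simp)]
          ring
      _ ≤ _ := by
          gcongr
          · exact le_iSup₂ (f := fun (Q : Cube n) (_ : x ∈ Q.set) => volume Q.set ^ (α / (n : ℝ) - 1) *
              ∫⁻ y in Q.set, (‖b x - b y‖₊ : ℝ≥0∞) * (‖f y‖₊ : ℝ≥0∞) ∂volume) Q hQ
          · exact le_iSup₂ (f := fun (Q : Cube n) (_ : x ∈ Q.set) => volume Q.set ^ (α / (n : ℝ) - 1) *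
              ∫⁻ y in Q.set, (‖f y‖₊ : ℝ≥0∞) ∂volume) Q hQ
  · unfold fracMaximal
    simp only [ENNReal.mul_iSup]
    refine iSup₂_le fun Q hQ => ?_
    calc ‖b x‖ₑ * (volume Q.set ^ (α / (n : ℝ) - 1) * ∫⁻ y in Q.set, (‖f y‖₊ : ℝ≥0∞))
        = volume Q.set ^ (α / (n : ℝ) - 1) * ∫⁻ y in Q.set, ‖b x‖ₑ * (‖f y‖₊ : ℝ≥0∞) := by
          rw [lintegral_const_mul' _ _ (by simp)]; ring
      _ ≤ volume Q.set ^ (α / (n : ℝ) - 1) * ∫⁻ y in Q.set, ((‖b y * f y‖₊ : ℝ≥0∞) + 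
            (‖b x - b y‖₊ : ℝ≥0∞) * (‖f y‖₊ : ℝ≥0∞)) := by
          gcongr with y
          change (‖b x‖₊ : ℝ≥0∞) * _ ≤ _
          norm_cast
          rw [nnnorm_mul, ← add_mul]
          gcongr
          have := nnnorm_add_le (b x - b y) (b y)
          rw [_root_.sub_add_cancel] at this
          rwa [add_comm]
      _ = volume Q.set ^ (α / (n : ℝ) - 1) * (∫⁻ y in Q.set, (‖b y * f y‖₊ : ℝ≥0∞)) +
           volume Q.set ^ (α / (n : ℝ) - 1) * (∫⁻ y in Q.set, (‖b x - b y‖₊ : ℝ≥0∞) * (‖f y‖₊ : ℝ≥0∞)) := by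
          have hm : AEMeasurable (fun y => (‖b y * f y‖₊ : ℝ≥0∞)) (volume.restrict Q.set) :=
            (hb.mul hf).restrict.enorm
          rw [lintegral_add_left' hm]
          ring
      _ ≤ _ := by
          gcongr
          · exact le_iSup₂ (f := fun (Q : Cube n) (_ : x ∈ Q.set) => volume Q.set ^ (α / (n : ℝ) - 1) *
              ∫⁻ y in Q.set, (‖b y * f y‖₊ : ℝ≥0∞) ∂volume) Q hQ
          · exact le_iSup₂ (f := fun (Q : Cube n) (_ : x ∈ Q.set) => volume Q.set ^ (α / (n : ℝ) - 1) *
              ∫⁻ y in Q.set, (‖b x - b y‖₊ : ℝ≥0∞) * (‖f y‖₊ : ℝ≥0∞) ∂volume) Q hQ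

lemma exists_subcube (Q : Cube n) {x : RSp n} (hx : x ∈ Q.set) {ρ : ℝ} (hρ : 0 < ρ) (hρQ : ρ ≤ 2 * Q.r) :
    ∃ Q' : Cube n, x ∈ Q'.set ∧ Q'.set ⊆ Q.set ∧ Q'.r = ρ / 2 ∧ Q'.set ⊆ bx x ρ := by
  have hr := Q.r_pos
  set θ := ρ / 2 / Q.r with hθ
  have hθ0 : 0 ≤ θ := by positivity
  have hθ1 : θ ≤ 1 := by rw [hθ, div_le_one hr]; linarith
  have hθr : θ * Q.r = ρ / 2 := by rw [hθ]; field_simp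
  have key : ∀ i, |x i - (x + θ • (Q.c - x)) i| ≤ ρ / 2 := by
    intro i
    have e : x i - (x + θ • (Q.c - x)) i = θ * (x i - Q.c i) := by simp; ring
    rw [e, abs_mul, abs_of_nonneg hθ0, ← hθr]
    have := hx i
    gcongr
  refine ⟨⟨x + θ • (Q.c - x), ρ / 2, by positivity⟩, key, ?_, rfl, ?_⟩
  · intro y hy i
    have h1 : |y i - (x + θ • (Q.c - x)) i| ≤ ρ / 2 := hy i
    have h2 : |(x + θ • (Q.c - x)) i - Q.c i| ≤ (1 - θ) * Q.r := by
      have e : (x + θ • (Q.c - x)) i - Q.c i = (1 - θ) * (x i - Q.c i) := by simp; ring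
      rw [e, abs_mul, abs_of_nonneg (by linarith)]
      have := hx i
      gcongr
    have h3 := abs_sub_le (y i) ((x + θ • (Q.c - x)) i) (Q.c i)
    nlinarith
  · intro y hy i
    have h1 : |y i - (x + θ • (Q.c - x)) i| ≤ ρ / 2 := hy i
    have h2 := key i
    have h3 := abs_sub_le (y i) ((x + θ • (Q.c - x)) i) (x i)
    rw [abs_sub_comm ((x + θ • (Q.c - x)) i)] at h3
    linarith

/-- Lebesgue: `|b| ≤ M_Q b` a.e. on `Q`. -/
lemma le_restMaximal (hn : 0 < n) {b : RSp n → ℝ} (hb : LocallyIntegrable b volume) :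
    ∀ᵐ x ∂(volume : Measure (RSp n)), ∀ Q : Cube n, x ∈ Q.set → ‖b x‖ₑ ≤ restMaximal Q b x := by
  have hbm := hb.aestronglyMeasurable.aemeasurable
  filter_upwards [lebesgue_diff hn hb] with x hx Q hQ
  have hr := Q.r_pos
  have hρ : ∀ j : ℕ, 0 < Q.r / (j + 1) := fun j => by positivity
  have hρ' : ∀ j : ℕ, Q.r / (j + 1) ≤ 2 * Q.r := fun j => by
    have : Q.r / (j + 1) ≤ Q.r := div_le_self hr.le (by linarith [Nat.cast_nonneg (α := ℝ) j])
    linarith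
  choose Q' h1 h2 h3 h4 using fun j => exists_subcube Q hQ (hρ j) (hρ' j)
  have hlim : Tendsto (fun j : ℕ => Q.r / ((j : ℝ) + 1)) atTop (nhds 0) := by
    have := (tendsto_one_div_add_atTop_nhds_zero_nat (𝕜 := ℝ)).const_mul Q.r
    simpa [div_eq_mul_inv] using this
  have hv : ∀ j, volume (Q' j).set = ENNReal.ofReal (Q.r / (j + 1)) ^ n := by
    intro j; rw [Cube.vol, h3]; congr 2; ring
  have ht := hx (fun j => (Q' j).set) (fun j => Q.r / (j + 1)) hρ hlim h4 (fun j => (hv j).ge)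
  have ht' := ht.const_add (restMaximal Q b x)
  rw [add_zero] at ht'
  refine ge_of_tendsto' ht' fun j => ?_
  have hv0 := (Q' j).vol_ne_zero
  have hvt := (Q' j).vol_ne_top
  calc ‖b x‖ₑ = (volume (Q' j).set)⁻¹ * ∫⁻ y in (Q' j).set, ‖b x‖ₑ := by
        rw [setLIntegral_const, mul_comm ‖b x‖ₑ, ← mul_assoc, ENNReal.inv_mul_cancel hv0 hvt, one_mul]
    _ ≤ (volume (Q' j).set)⁻¹ * ∫⁻ y in (Q' j).set, (‖b y‖ₑ + ‖b y - b x‖ₑ) := by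
        gcongr with y
        have := enorm_sub_le (a := b y) (b := b y - b x)
        rwa [_root_.sub_sub_cancel] at this
    _ = (volume (Q' j).set)⁻¹ * (∫⁻ y in (Q' j).set, ‖b y‖ₑ) + 
          (volume (Q' j).set)⁻¹ * ∫⁻ y in (Q' j).set, ‖b y - b x‖ₑ := by
        rw [lintegral_add_left' hbm.restrict.enorm, mul_add]
    _ ≤ _ := by
        gcongr
        exact le_iSup₂_of_le (f := fun (Q' : Cube n) (_ : x ∈ Q'.set) => ⨆ (_ : Q'.set ⊆ Q.set),
          (volume Q'.set)⁻¹ * ∫⁻ y in Q'.set, (‖b y‖₊ : ℝ≥0∞) ∂volume) (Q' j) (h1 j) (le_iSup_of_le (h2 j) le_rfl)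

lemma test_bound {b : RSp n → ℝ} (hb : AEMeasurable b volume)
    {M : ℝ} (hM : 0 ≤ M) {x : RSp n} (hx : -(b x) ≤ M) {Q : Cube n} 
    (hle : x ∈ Q.set → ‖b x‖ₑ ≤ restMaximal Q b x) :
    ‖commTestFn0 Q b x‖ₑ ≤ 
      fracMaximalComm 0 b (cubeIndicator Q) x + ENNReal.ofReal (2 * M + 1) * fracMaximal 0 (cubeIndicator Q) x := by
  by_cases hxQ : x ∈ Q.set
  swap
  · simp [commTestFn0, hxQ]
  have hone : 1 ≤ fracMaximal 0 (cubeIndicator Q) x := by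
    refine le_iSup₂_of_le (f := fun (Q' : Cube n) (_ : x ∈ Q'.set) => volume Q'.set ^ ((0 : ℝ) / (n : ℝ) - 1) * 
      ∫⁻ y in Q'.set, (‖cubeIndicator Q y‖₊ : ℝ≥0∞)) Q hxQ ?_
    have : ∫⁻ y in Q.set, (‖cubeIndicator Q y‖₊ : ℝ≥0∞) = volume Q.set := by
      rw [setLIntegral_congr_fun Q.meas (g := fun _ => 1) (fun y hy => by simp [cubeIndicator, hy])]
      simp
    rw [this, zero_div, zero_sub, ENNReal.rpow_neg_one, ENNReal.inv_mul_cancel Q.vol_ne_zero Q.vol_ne_top]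
  have e : commTestFn0 Q b x = b x - (restMaximal Q b x).toReal := by simp [commTestFn0, hxQ]
  have h1 : restMaximal Q b x ≤ fracMaximalComm 0 b (cubeIndicator Q) x + ‖b x‖ₑ * 1 := by
    refine iSup₂_le fun Q' hQ' => iSup_le fun hsub => ?_
    have hv0 := Q'.vol_ne_zero
    have hvt := Q'.vol_ne_top
    calc (volume Q'.set)⁻¹ * ∫⁻ y in Q'.set, (‖b y‖₊ : ℝ≥0∞) 
        ≤ (volume Q'.set)⁻¹ * ∫⁻ y in Q'.set, ((‖b x - b y‖₊ : ℝ≥0∞) * (‖cubeIndicator Q y‖₊ : ℝ≥0∞) + ‖b x‖ₑ) := by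
          gcongr 1
          refine setLIntegral_mono' Q'.meas fun y hy => ?_
          have : cubeIndicator Q y = 1 := by simp [cubeIndicator, hsub hy]
          rw [this, nnnorm_one, ENNReal.coe_one, mul_one]
          have := enorm_sub_le (a := b x) (b := b x - b y)
          rw [_root_.sub_sub_cancel] at this
          rwa [add_comm]
      _ = volume Q'.set ^ ((0 : ℝ) / (n : ℝ) - 1) * (∫⁻ y in Q'.set, (‖b x - b y‖₊ : ℝ≥0∞) * (‖cubeIndicator Q y‖₊ : ℝ≥0∞)) + ‖b x‖ₑ * 1 := by
          rw [lintegral_add_right' _ aemeasurable_const, setLIntegral_const, zero_div, zero_sub,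
            ENNReal.rpow_neg_one, mul_add, mul_comm ‖b x‖ₑ, ← mul_assoc _ _ ‖b x‖ₑ, 
            ENNReal.inv_mul_cancel hv0 hvt, one_mul, mul_one]
      _ ≤ _ := by
          gcongr
          exact le_iSup₂ (f := fun (Q' : Cube n) (_ : x ∈ Q'.set) => volume Q'.set ^ ((0 : ℝ) / (n : ℝ) - 1) *
              ∫⁻ y in Q'.set, (‖b x - b y‖₊ : ℝ≥0∞) * (‖cubeIndicator Q y‖₊ : ℝ≥0∞) ∂volume) Q' hQ'
  have h2 : ‖b x‖ₑ * 1 ≤ restMaximal Q b x + fracMaximalComm 0 b (cubeIndicator Q) x := by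
    rw [mul_one]; exact (hle hxQ).trans le_self_add
  have := abs_aux h1 h2 hx hM
  rw [e, ← enorm_neg, neg_sub]
  simp only [ENNReal.toReal_one, mul_one] at this
  refine this.trans ?_
  gcongr
  exact le_mul_of_one_le_right zero_le hone

end fwd

set_option linter.unusedVariables false

section bwd

variable {n : ℕ}

lemma chi_eq (Q : Cube n) (x : RSp n) : (‖cubeIndicator Q x‖₊ : ℝ≥0) = Q.set.indicator (fun _ => 1) x := by
  by_cases hx : x ∈ Q.set <;> simp [cubeIndicator, hx]

lemma meas_chi (Q : Cube n) : Measurable (cubeIndicator Q) := measurable_one.indicator Q.meas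

lemma chi_modular {h : RSp n → ℝ} {ψ : RSp n → ℝ≥0 → ℝ≥0∞} {H : RSp n → ℝ → ℝ} {a b C c Cl : ℝ}
    (hH : Nice volume (cubeFam n) h H a b C) (hl : Link volume ψ H c Cl) (Q : Cube n) :
    ∃ lam : ℝ≥0, 0 < lam ∧ ∫⁻ x, ψ x (‖cubeIndicator Q x‖₊ / lam) ≤ 1 := by
  obtain ⟨β, hβ, hone⟩ := hl.one
  have hv : 0 < (volume Q.set).toReal := ENNReal.toReal_pos Q.vol_ne_zero Q.vol_ne_top
  set t : ℝ := min 1 (1 / (volume Q.set).toReal) with ht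
  have ht0 : 0 < t := by positivity
  have ht1 : t ≤ 1 := min_le_left _ _
  have hC := hH.one
  have hc := hl.c0
  set κ : ℝ := c * β / (C * (1 / t) ^ b) with hκ
  have hκ0 : 0 < κ := by positivity
  refine ⟨(2 / κ).toNNReal, by simp; positivity, ?_⟩
  calc ∫⁻ x, ψ x (‖cubeIndicator Q x‖₊ / (2 / κ).toNNReal) ≤ ∫⁻ x, Q.set.indicator (fun _ => ENNReal.ofReal t) x := by
        refine lintegral_mono_ae ?_
        filter_upwards [hone] with x hx
        rw [chi_eq]
        by_cases hxQ : x ∈ Q.set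
        swap
        · simp [hxQ, hl.zero]
        simp only [hxQ, indicator_of_mem]
        refine hl.L1 x t _ ht0 ?_
        have h1 := hH.up x t 1 ht0 ht1
        push_cast
        rw [Real.coe_toNNReal _ (by positivity), one_div_div]
        calc κ / 2 < κ := by linarith
          _ ≤ c * H x t := by
            rw [hκ, div_le_iff₀ (by positivity)]
            calc c * β ≤ c * (C * (1 / t) ^ b * H x t) := by gcongr; linarith
              _ = _ := by ring
    _ = ENNReal.ofReal t * volume Q.set := by rw [lintegral_indicator Q.meas, setLIntegral_const]
    _ = ENNReal.ofReal (t * (volume Q.set).toReal) := by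
        rw [ENNReal.ofReal_mul ht0.le, ENNReal.ofReal_toReal Q.vol_ne_top]
    _ ≤ ENNReal.ofReal 1 := by
        refine ENNReal.ofReal_le_ofReal ?_
        rw [← le_div_iff₀ hv]; exact min_le_right _ _
    _ = 1 := ENNReal.ofReal_one

lemma chi_ne_top {h : RSp n → ℝ} {ψ : RSp n → ℝ≥0 → ℝ≥0∞} {H : RSp n → ℝ → ℝ} {a b C c Cl : ℝ}
    (hH : Nice volume (cubeFam n) h H a b C) (hl : Link volume ψ H c Cl) (Q : Cube n) :
    orliczNorm ψ Set.univ (cubeIndicator Q) ≠ ∞ := by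
  obtain ⟨lam, h1, h2⟩ := chi_modular hH hl Q
  refine ne_top_of_le_ne_top ENNReal.coe_ne_top (sInf_le ⟨lam, ⟨h1, ?_⟩, rfl⟩)
  rwa [Measure.restrict_univ]

lemma chi_ne_zero {ψ : RSp n → ℝ≥0 → ℝ≥0∞} (hψ : IsWeakPhi Set.univ ψ) (Q : Cube n) :
    orliczNorm ψ Set.univ (cubeIndicator Q) ≠ 0 := by
  intro h0
  have h1 : ∀ k : ℕ, ∫⁻ x in Q.set, ψ x k ≤ 1 := by
    intro k
    have : sInf ((fun lam : ℝ≥0 => (lam : ℝ≥0∞)) ''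
      {lam : ℝ≥0 | 0 < lam ∧ (∫⁻ x in Set.univ, ψ x (‖cubeIndicator Q x‖₊ / lam) ∂volume) ≤ 1}) < ((1 / (k + 1) : ℝ≥0) : ℝ≥0∞) := by
      change orliczNorm ψ Set.univ (cubeIndicator Q) < _
      rw [h0]
      simp
    obtain ⟨_, ⟨lam, ⟨hl, hl'⟩, rfl⟩, hlt⟩ := sInf_lt_iff.1 this
    have hlt' : lam < 1 / (k + 1) := by
      change (lam : ℝ≥0∞) < _ at hlt
      exact ENNReal.coe_lt_coe.1 hlt
    rw [Measure.restrict_univ] at hl'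
    refine le_trans ?_ hl'
    rw [← lintegral_indicator Q.meas]
    refine lintegral_mono fun x => ?_
    by_cases hx : x ∈ Q.set
    swap
    · simp [hx]
    rw [indicator_of_mem hx, chi_eq, indicator_of_mem hx]
    refine hψ.mono x trivial ?_
    rw [le_div_iff₀ hl]
    rw [lt_div_iff₀ (by positivity)] at hlt'
    calc (k : ℝ≥0) * lam ≤ lam * (k + 1) := by rw [mul_comm]; gcongr; simp
      _ ≤ 1 := hlt'.le
  have h2 := lintegral_iSup' (μ := volume.restrict Q.set) (f := fun (k : ℕ) x => ψ x k)
    (fun k => by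
      have := hψ.meas (fun _ => (k : ℝ≥0)) measurable_const
      rw [Measure.restrict_univ] at this
      exact this.restrict)
    (Eventually.of_forall fun x i j hij => hψ.mono x trivial (by exact_mod_cast hij))
  have h3 : ∀ x, ⨆ k : ℕ, ψ x k = ∞ := by
    intro x
    have ht := (hψ.lim_top x trivial).comp tendsto_natCast_atTop_atTop (α := ℕ)
    exact iSup_eq_of_tendsto (fun i j hij => hψ.mono x trivial (by exact_mod_cast hij)) ht
  simp only [h3] at h2
  rw [setLIntegral_const, ENNReal.top_mul Q.vol_ne_zero] at h2
  have h4 : (∞ : ℝ≥0∞) ≤ 1 := by rw [h2]; exact iSup_le h1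
  simp at h4

lemma isBMO_zero : IsBMO (fun _ : RSp n => (0 : ℝ)) := by
  refine ⟨locallyIntegrable_const 0, ?_⟩
  have : bmoNorm (fun _ : RSp n => (0 : ℝ)) = 0 := by
    simp [bmoNorm, cubeAvg]
  rw [this]; simp

lemma norm_mono {ψ : RSp n → ℝ≥0 → ℝ≥0∞} (hψ : IsWeakPhi Set.univ ψ) {f g : RSp n → ℝ}
    (h : ∀ᵐ x ∂(volume : Measure (RSp n)), ‖f x‖₊ ≤ ‖g x‖₊) :
    orliczNorm ψ Set.univ f ≤ orliczNorm ψ Set.univ g := by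
  refine le_sInf ?_
  rintro _ ⟨lam, ⟨hl, hl'⟩, rfl⟩
  refine sInf_le ⟨lam, ⟨hl, le_trans ?_ hl'⟩, rfl⟩
  rw [Measure.restrict_univ]
  refine lintegral_mono_ae ?_
  filter_upwards [h] with x hx
  exact hψ.mono x trivial (by gcongr)

lemma mul_norm_le {ψ : RSp n → ℝ≥0 → ℝ≥0∞} (A : ℝ≥0) (f : RSp n → ℝ) :
    A * orliczNorm ψ Set.univ f ≤ orliczNorm ψ Set.univ (fun x => A * f x) := by
  rcases eq_or_ne A 0 with rfl | hA
  · simp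
  have hA' : 0 < A := pos_iff_ne_zero.2 hA
  refine le_sInf ?_
  rintro _ ⟨lam, ⟨hl, hl'⟩, rfl⟩
  have : orliczNorm ψ Set.univ f ≤ ((lam / A : ℝ≥0) : ℝ≥0∞) := by
    refine sInf_le ⟨lam / A, ⟨by positivity, ?_⟩, rfl⟩
    convert hl' using 3 with x
    congr 1
    rw [nnnorm_mul, NNReal.nnnorm_eq]
    field_simp
  calc (A : ℝ≥0∞) * orliczNorm ψ Set.univ f ≤ A * ((lam / A : ℝ≥0) : ℝ≥0∞) := by gcongr
    _ = lam := by rw [← ENNReal.coe_mul, mul_div_cancel₀ _ hA]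

/-- Averaging lemma. -/
lemma avg_norm (hn : 0 < n) {h : RSp n → ℝ} {ψ : RSp n → ℝ≥0 → ℝ≥0∞} (hψ : IsWeakPhi Set.univ ψ)
    {H : RSp n → ℝ → ℝ} {a b C c Cl : ℝ} (hh : HOK volume h)
    (hH : Nice volume (cubeFam n) h H a b C) (hl : Link volume ψ H c Cl) (ha : 0 < a) (ha1 : a < 1) (hb : b < 1) :
    ∃ Λ : ℝ≥0, ∀ (Q : Cube n) (f : RSp n → ℝ) (A : ℝ≥0), AEMeasurable f volume →
      (A : ℝ≥0∞) ≤ (volume Q.set)⁻¹ * ∫⁻ y in Q.set, ‖f y‖ₑ →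
      A * orliczNorm ψ Set.univ (cubeIndicator Q) ≤ Λ * orliczNorm ψ Set.univ f := by
  have hl' : Link volume ψ (fun x t => t ^ (-((0 : ℝ) / n)) * H x t) c Cl := by simpa using hl
  obtain ⟨Λ, hΛ, hcore⟩ := core (α := 0) hn (by simp) hh hH hl hl' (by simpa using ha) (by simpa using ha1)
    hb (by simpa using hH.b0) (isBMO_zero (n := n)) le_rfl
  refine ⟨Λ, fun Q f A hf hA => (mul_norm_le A _).trans (hcore f _ hf (Eventually.of_forall fun x => ?_))⟩
  by_cases hx : x ∈ Q.set
  swap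
  · simp [cubeIndicator, hx]
  refine le_trans ?_ le_add_self
  rw [ENNReal.ofReal_one, one_mul]
  have : ‖(A : ℝ) * cubeIndicator Q x‖ₑ = A := by
    simp [cubeIndicator, hx, enorm_eq_nnnorm]
  rw [this]
  refine le_iSup₂_of_le (f := fun (Q' : Cube n) (_ : x ∈ Q'.set) => volume Q'.set ^ ((0 : ℝ) / (n : ℝ) - 1) * 
      ∫⁻ y in Q'.set, (‖f y‖₊ : ℝ≥0∞)) Q hx ?_
  rw [zero_div, zero_sub, ENNReal.rpow_neg_one]
  exact hA

lemma phi_psi {γ : ℝ} (hγ : 0 ≤ γ) {h : RSp n → ℝ} {φ ψ : RSp n → ℝ≥0 → ℝ≥0∞} 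
    {G : RSp n → ℝ → ℝ} {a b C c Cl c' Cl' : ℝ} (hh : HOK volume h)
    (hG : Nice volume (cubeFam n) h G a b C) (hl : Link volume φ G c Cl)
    (hl' : Link volume ψ (fun x t => t ^ (-γ) * G x t) c' Cl') (hγa : γ ≤ a) (hγb : γ < b) :
    ∃ Λ : ℝ≥0, ∀ Q : Cube n, orliczNorm φ Set.univ (cubeIndicator Q) ≤
      ((Λ * (volume Q.set).toNNReal ^ γ : ℝ≥0) : ℝ≥0∞) * orliczNorm ψ Set.univ (cubeIndicator Q) := by
  have hH := hG.frac hh hγa hγb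
  have hC := hG.one
  obtain ⟨C0, hC0, hdom⟩ := dom_of_modular hh hH hl'
  obtain ⟨Λ, hΛ, hmod⟩ := modular_of_dom (C0 := C0 * C + C0 + 1) hh hG hl (by positivity)
  refine ⟨Λ, fun Q => ?_⟩
  have hv : 0 < (volume Q.set).toNNReal := ENNReal.toNNReal_pos Q.vol_ne_zero Q.vol_ne_top
  set v := (volume Q.set).toNNReal with hv'
  have hvr : (0 : ℝ) < v := by exact_mod_cast hv
  have hvol : volume Q.set = (v : ℝ≥0∞) := (ENNReal.coe_toNNReal Q.vol_ne_top).symm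
  refine norm_le_of (by positivity) fun lam hlam hint => ?_
  have hlam' : (0 : ℝ) < lam := by exact_mod_cast hlam
  have hnn : ∀ y, ‖(lam : ℝ)⁻¹ * y‖₊ = ‖y‖₊ / lam := by
    intro y
    rw [nnnorm_mul, nnnorm_inv, Real.nnnorm_of_nonneg hlam'.le, mul_comm, div_eq_mul_inv]
    rfl
  obtain ⟨w, hw1, hw2, hw3, hw4⟩ := hdom (fun y => (lam : ℝ)⁻¹ * cubeIndicator Q y) ((meas_chi Q).const_mul _).aemeasurable
    (by simpa only [hnn] using hint)
  have hD : Dom volume h G (C0 * C + C0 + 1) (fun x => ((‖cubeIndicator Q x‖₊ / lam / v ^ γ : ℝ≥0) : ℝ≥0∞)) := by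
    refine ⟨fun x => w x + Q.set.indicator (fun _ => (v : ℝ)⁻¹) x, hw1.add (measurable_const.indicator Q.meas), ?_, ?_, ?_⟩
    · intro x
      have : 0 ≤ Q.set.indicator (fun _ => (v : ℝ)⁻¹) x := indicator_nonneg (fun _ _ => by positivity) x
      linarith [hw2 x]
    · calc ∫⁻ x, ENNReal.ofReal (w x + Q.set.indicator (fun _ => (v : ℝ)⁻¹) x) 
          ≤ ∫⁻ x, (ENNReal.ofReal (w x) + Q.set.indicator (fun _ => ENNReal.ofReal (v : ℝ)⁻¹) x) := by
            refine lintegral_mono fun x => ?_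
            refine ENNReal.ofReal_add_le.trans ?_
            gcongr
            by_cases hx : x ∈ Q.set <;> simp [hx]
        _ = (∫⁻ x, ENNReal.ofReal (w x)) + 1 := by
            rw [lintegral_add_left hw1.ennreal_ofReal, lintegral_indicator Q.meas, setLIntegral_const,
              hvol, ← ENNReal.ofReal_coe_nnreal (p := v), ← ENNReal.ofReal_mul (by positivity), inv_mul_cancel₀ hvr.ne',
              ENNReal.ofReal_one]
        _ ≤ ENNReal.ofReal C0 + ENNReal.ofReal 1 := by rw [ENNReal.ofReal_one]; gcongr
        _ = ENNReal.ofReal (C0 + 1) := (ENNReal.ofReal_add hC0.le zero_le_one).symm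
        _ ≤ _ := ENNReal.ofReal_le_ofReal (by have : 0 ≤ C0 * C := by positivity
                                              linarith)
    · filter_upwards [hw4] with x hx
      by_cases hxQ : x ∈ Q.set
      swap
      · simp [cubeIndicator, hxQ]
      have hwx : 0 < w x := (hh.pos x).trans_le (hw2 x)
      simp only [hxQ, indicator_of_mem]
      set w' := w x + (v : ℝ)⁻¹ with hw'
      have hw0 : 0 < w' := by positivity
      have h1 := hH.almost_inc (x := x) hwx (show w x ≤ w' by rw [hw']; linarith [inv_pos.2 hvr])
      have hGp := hG.pos x w' hw0
      have h2 : w' ^ (-γ) ≤ (v : ℝ) ^ γ := by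
        calc w' ^ (-γ) ≤ ((v : ℝ)⁻¹) ^ (-γ) := Real.rpow_le_rpow_of_nonpos (by positivity) (by linarith) (by linarith)
          _ = _ := by rw [Real.rpow_neg (by positivity), Real.inv_rpow (by positivity), inv_inv]
      have h3 : (‖(lam : ℝ)⁻¹ * cubeIndicator Q x‖₊ : ℝ) ≤ C0 * (w x ^ (-γ) * G x (w x)) := by
        have hHp := hH.pos x _ hwx
        rw [← ofReal_norm, ENNReal.ofReal_le_ofReal_iff (by positivity)] at hx
        exact hx
      rw [hnn] at h3
      rw [← ENNReal.ofReal_coe_nnreal]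
      refine ENNReal.ofReal_le_ofReal ?_
      push_cast at h3 ⊢
      rw [div_le_iff₀ (by positivity)]
      calc _ ≤ C0 * (w x ^ (-γ) * G x (w x)) := h3
        _ ≤ C0 * (C * (w' ^ (-γ) * G x w')) := by gcongr
        _ ≤ C0 * (C * ((v : ℝ) ^ γ * G x w')) := by gcongr
        _ = (C0 * C) * G x w' * (v : ℝ) ^ γ := by ring
        _ ≤ _ := by gcongr; linarith
  have := hmod _ hD (fun x => ‖cubeIndicator Q x‖₊ / lam / v ^ γ) (Eventually.of_forall fun x => le_rfl)
  refine le_trans (le_of_eq ?_) this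
  congr 1; ext x; congr 1
  rw [div_div, div_div]; congr 1; ring

end bwd

set_option linter.unusedVariables false

section bwd2

variable {n : ℕ}

lemma DS_M_fin (σ : Fin n → Bool) {g : RSp n → ℝ≥0∞} (hg : AEMeasurable g volume) (hgi : ∫⁻ x, g x ≠ ∞) :
    ∀ᵐ x ∂(volume : Measure (RSp n)), (grid σ).M g x < ∞ := by
  have h1 : ∀ t : ℝ≥0, (t : ℝ≥0∞) * volume {x | (grid σ).M g x = ∞} ≤ ∫⁻ x, g x := by
    intro t
    refine le_trans ?_ ((grid σ).weak hg t)
    refine mul_le_mul' le_rfl (measure_mono fun x hx => ?_)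
    have hx' : (grid σ).M g x = ∞ := hx
    show (t : ℝ≥0∞) < (grid σ).M g x
    rw [hx']; exact ENNReal.coe_lt_top
  have h0 : volume {x | (grid σ).M g x = ∞} = 0 := by
    by_contra hne
    have h2 : (∞ : ℝ≥0∞) ≤ ∫⁻ x, g x := by
      have e : (⨆ t : ℕ, (t : ℝ≥0∞)) * volume {x | (grid σ).M g x = ∞} ≤ ∫⁻ x, g x := by
        rw [ENNReal.iSup_mul]
        exact iSup_le fun t => by exact_mod_cast h1 t
      rwa [ENNReal.iSup_natCast, ENNReal.top_mul hne] at e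
    exact hgi (top_le_iff.1 h2)
  rw [ae_iff]
  simpa using h0

lemma fracMaximal_fin {α : ℝ} (hα : 0 ≤ α / n) (hα1 : α / n ≤ 1) {f : RSp n → ℝ}
    (hf : AEMeasurable f volume) (hfi : ∫⁻ x, ‖f x‖ₑ ≠ ∞) :
    ∀ᵐ x ∂(volume : Measure (RSp n)), fracMaximal α f x < ∞ := by
  have h := ae_all_iff.2 fun σ : Fin n → Bool => DS_M_fin σ hf.enorm hfi
  filter_upwards [h] with x hx
  refine (fracMaximal_le hα f x).trans_lt (ENNReal.mul_lt_top (by simp) (ENNReal.sum_lt_top.2 fun σ _ => ?_))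
  rw [DS.Ms_one]
  have hb : ∀ k, (grid σ).V k ^ (α / n) * (grid σ).E k (fun y => ‖f y‖ₑ) x ≤ 
      (grid σ).M (fun y => ‖f y‖ₑ) x + ∫⁻ y, ‖f y‖ₑ := by
    intro k
    have hv0 : (grid σ).V k ≠ 0 := by
      rw [grid_V]; exact pow_ne_zero _ (by simp; positivity)
    have hvt : (grid σ).V k ≠ ∞ := by rw [grid_V]; finiteness
    rcases le_total ((grid σ).V k) 1 with h1 | h1
    · refine le_trans ?_ le_self_add
      calc _ ≤ 1 * (grid σ).E k (fun y => ‖f y‖ₑ) x := by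
            gcongr; exact ENNReal.rpow_le_one h1 hα
        _ ≤ _ := by rw [one_mul]; exact le_iSup (fun k => (grid σ).E k (fun y => ‖f y‖ₑ) x) k
    · refine le_trans ?_ le_add_self
      unfold DS.E
      rw [← mul_assoc]
      calc _ ≤ 1 * ∫⁻ y in (grid σ).Q k x, ‖f y‖ₑ := by
            gcongr
            calc (grid σ).V k ^ (α / n) * ((grid σ).V k)⁻¹ ≤ (grid σ).V k ^ (1 : ℝ) * ((grid σ).V k)⁻¹ := by
                  gcongr
              _ = 1 := by rw [ENNReal.rpow_one, ENNReal.mul_inv_cancel hv0 hvt]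
        _ ≤ _ := by rw [one_mul]; exact setLIntegral_le_lintegral _ _
  exact (iSup_le hb).trans_lt (ENNReal.add_lt_top.2 ⟨hx σ, hfi.lt_top⟩)

lemma int_cube {b : RSp n → ℝ} (hb : LocallyIntegrable b volume) (Q : Cube n) : IntegrableOn b Q.set volume := by
  refine (hb.integrableOn_isCompact (isCompact_bx (x := Q.c) Q.r_pos.le)).mono_set ?_
  intro y hy; exact hy

/-- the average of `|b|`. -/
noncomputable def mAv (Q : Cube n) (b : RSp n → ℝ) : ℝ≥0∞ := (volume Q.set)⁻¹ * ∫⁻ y in Q.set, ‖b y‖ₑ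

lemma mAv_fin {b : RSp n → ℝ} (hb : LocallyIntegrable b volume) (Q : Cube n) : mAv Q b < ∞ :=
  ENNReal.mul_lt_top (ENNReal.inv_lt_top.2 (pos_iff_ne_zero.2 Q.vol_ne_zero)) (int_cube hb Q).2

lemma bchi_norm (b : RSp n → ℝ) (Q : Cube n) (y : RSp n) :
    ‖b y * cubeIndicator Q y‖ₑ = Q.set.indicator (fun y => ‖b y‖ₑ) y := by
  by_cases hy : y ∈ Q.set <;> simp [cubeIndicator, hy]

lemma bchi_int {b : RSp n → ℝ} (hb : LocallyIntegrable b volume) (Q : Cube n) : 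
    ∫⁻ y, ‖b y * cubeIndicator Q y‖ₑ ≠ ∞ := by
  simp only [bchi_norm]
  rw [lintegral_indicator Q.meas]
  exact (int_cube hb Q).2.ne

lemma frac_chi {α : ℝ} (hα : 0 ≤ α / n) (hα1 : α / n ≤ 1) (Q : Cube n) {x : RSp n} (hx : x ∈ Q.set) :
    fracMaximal α (cubeIndicator Q) x = volume Q.set ^ (α / n) := by
  have hv0 := Q.vol_ne_zero
  have hvt := Q.vol_ne_top
  have hint : ∀ Q' : Cube n, ∫⁻ y in Q'.set, (‖cubeIndicator Q y‖₊ : ℝ≥0∞) = volume (Q.set ∩ Q'.set) := by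
    intro Q'
    rw [← Measure.restrict_apply Q.meas, ← lintegral_indicator_one Q.meas]
    refine lintegral_congr fun y => ?_
    by_cases hy : y ∈ Q.set <;> simp [cubeIndicator, hy]
  refine le_antisymm ?_ ?_
  · refine iSup₂_le fun Q' hQ' => ?_
    have hv0' := Q'.vol_ne_zero
    have hvt' := Q'.vol_ne_top
    rw [hint]
    rcases le_total (volume Q'.set) (volume Q.set) with h | h
    · calc _ ≤ volume Q'.set ^ (α / (n : ℝ) - 1) * volume Q'.set := by gcongr; exact inter_subset_right
        _ = volume Q'.set ^ (α / n) := by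
            nth_rw 2 [← ENNReal.rpow_one (volume Q'.set)]
            rw [← ENNReal.rpow_add _ _ hv0' hvt', _root_.sub_add_cancel]
        _ ≤ _ := by gcongr
    · calc _ ≤ volume Q'.set ^ (α / (n : ℝ) - 1) * volume Q.set := by gcongr; exact inter_subset_left
        _ ≤ volume Q.set ^ (α / (n : ℝ) - 1) * volume Q.set := by
            gcongr 1
            rw [← neg_sub 1, ENNReal.rpow_neg, ENNReal.rpow_neg]
            exact ENNReal.inv_le_inv.2 (ENNReal.rpow_le_rpow h (by linarith))
        _ = volume Q.set ^ (α / n) := by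
            nth_rw 2 [← ENNReal.rpow_one (volume Q.set)]
            rw [← ENNReal.rpow_add _ _ hv0 hvt, _root_.sub_add_cancel]
  · refine le_iSup₂_of_le (f := fun (Q' : Cube n) (_ : x ∈ Q'.set) => volume Q'.set ^ (α / (n : ℝ) - 1) * 
      ∫⁻ y in Q'.set, (‖cubeIndicator Q y‖₊ : ℝ≥0∞)) Q hx ?_
    simp only [hint, inter_self]
    nth_rw 3 [← ENNReal.rpow_one (volume Q.set)]
    rw [← ENNReal.rpow_add _ _ hv0 hvt, _root_.sub_add_cancel]

lemma frac_bchi {α : ℝ} (b : RSp n → ℝ) (Q : Cube n) {x : RSp n} (hx : x ∈ Q.set) :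
    volume Q.set ^ (α / n) * mAv Q b ≤ fracMaximal α (fun y => b y * cubeIndicator Q y) x := by
  have hv0 := Q.vol_ne_zero
  have hvt := Q.vol_ne_top
  refine le_iSup₂_of_le (f := fun (Q' : Cube n) (_ : x ∈ Q'.set) => volume Q'.set ^ (α / (n : ℝ) - 1) * 
      ∫⁻ y in Q'.set, (‖b y * cubeIndicator Q y‖₊ : ℝ≥0∞)) Q hx ?_
  have : ∫⁻ y in Q.set, (‖b y * cubeIndicator Q y‖₊ : ℝ≥0∞) = ∫⁻ y in Q.set, ‖b y‖ₑ :=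
    setLIntegral_congr_fun Q.meas (fun y hy => by simp [cubeIndicator, hy, enorm_eq_nnnorm])
  simp only [this]
  rw [mAv, ← mul_assoc, ← ENNReal.rpow_neg_one, ← ENNReal.rpow_add _ _ hv0 hvt, sub_eq_add_neg]

lemma rest_ge (b : RSp n → ℝ) (Q : Cube n) {x : RSp n} (hx : x ∈ Q.set) :
    mAv Q b ≤ restMaximal Q b x :=
  le_iSup₂_of_le (f := fun (Q' : Cube n) (_ : x ∈ Q'.set) => ⨆ (_ : Q'.set ⊆ Q.set),
          (volume Q'.set)⁻¹ * ∫⁻ y in Q'.set, (‖b y‖₊ : ℝ≥0∞) ∂volume) Q hx (le_iSup_of_le Subset.rfl le_rfl)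

lemma rest_le (b : RSp n → ℝ) (Q : Cube n) (x : RSp n) :
    restMaximal Q b x ≤ fracMaximal 0 (fun y => b y * cubeIndicator Q y) x := by
  refine iSup₂_le fun Q' hQ' => iSup_le fun hsub => ?_
  refine le_iSup₂_of_le (f := fun (Q' : Cube n) (_ : x ∈ Q'.set) => volume Q'.set ^ ((0 : ℝ) / (n : ℝ) - 1) * 
      ∫⁻ y in Q'.set, (‖b y * cubeIndicator Q y‖₊ : ℝ≥0∞)) Q' hQ' ?_
  have : ∫⁻ y in Q'.set, (‖b y * cubeIndicator Q y‖₊ : ℝ≥0∞) = ∫⁻ y in Q'.set, (‖b y‖₊ : ℝ≥0∞) :=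
    setLIntegral_congr_fun Q'.meas (fun y hy => by simp [cubeIndicator, hsub hy])
  simp only [this]
  rw [zero_div, zero_sub, ENNReal.rpow_neg_one]

/-- The main lower-bound step. -/
lemma avg_bound (hn : 0 < n) {h : RSp n → ℝ} {ψ : RSp n → ℝ≥0 → ℝ≥0∞} (hψ : IsWeakPhi Set.univ ψ)
    {H : RSp n → ℝ → ℝ} {a b' C c Cl : ℝ} (hh : HOK volume h)
    (hH : Nice volume (cubeFam n) h H a b' C) (hl : Link volume ψ H c Cl) (ha : 0 < a) (ha1 : a < 1) (hb1 : b' < 1)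
    {b : RSp n → ℝ} (hb : LocallyIntegrable b volume) :
    ∃ Λ : ℝ≥0, ∀ (Q : Cube n) (T : RSp n → ℝ) (s D : ℝ≥0), s ≠ 0 →
      (∀ᵐ x ∂(volume : Measure (RSp n)), x ∈ Q.set → s * ((mAv Q b).toReal - b x) ≤ |T x|) →
      orliczNorm ψ Set.univ T ≤ ((D * s : ℝ≥0) : ℝ≥0∞) * orliczNorm ψ Set.univ (cubeIndicator Q) →
      (volume Q.set)⁻¹ * ∫⁻ y in Q.set, ENNReal.ofReal ((mAv Q b).toReal - b y) ≤ ((Λ * D : ℝ≥0) : ℝ≥0∞) := by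
  obtain ⟨Λ, hΛ⟩ := avg_norm hn hψ hh hH hl ha ha1 hb1
  refine ⟨Λ, fun Q T s D hs hT hTn => ?_⟩
  have hbm := hb.aestronglyMeasurable.aemeasurable
  set m := (mAv Q b).toReal with hm
  set f : RSp n → ℝ := Q.set.indicator (fun x => s * max (m - b x) 0) with hf
  have hfm : AEMeasurable f volume := 
    (((aemeasurable_const.sub hbm).max aemeasurable_const).const_mul _).indicator Q.meas
  have hA : (volume Q.set)⁻¹ * ∫⁻ y in Q.set, ENNReal.ofReal (m - b y) ≠ ∞ := by
    refine ENNReal.mul_ne_top (ENNReal.inv_ne_top.2 Q.vol_ne_zero) ?_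
    have hi : IntegrableOn (fun y => m - b y) Q.set volume :=
      (integrableOn_const Q.vol_ne_top).sub (int_cube hb Q)
    refine ne_top_of_le_ne_top hi.2.ne (lintegral_mono fun y => ?_)
    rw [← ofReal_norm]
    exact ENNReal.ofReal_le_ofReal (le_abs_self _)
  set A := ((volume Q.set)⁻¹ * ∫⁻ y in Q.set, ENNReal.ofReal (m - b y)).toNNReal with hA'
  have hAe : (A : ℝ≥0∞) = (volume Q.set)⁻¹ * ∫⁻ y in Q.set, ENNReal.ofReal (m - b y) := ENNReal.coe_toNNReal hA
  have h1 := hΛ Q f (s * A) hfm (by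
    have e : ∫⁻ y in Q.set, ‖f y‖ₑ = s * ∫⁻ y in Q.set, ENNReal.ofReal (m - b y) := by
      rw [← lintegral_const_mul' _ _ ENNReal.coe_ne_top]
      refine setLIntegral_congr_fun Q.meas fun y hy => ?_
      simp only [hf, indicator_of_mem hy]
      rw [← ofReal_norm, Real.norm_of_nonneg (by positivity), ENNReal.ofReal_mul (by positivity),
        ENNReal.ofReal_coe_nnreal]
      congr 1
      simp [ENNReal.ofReal_max]
    rw [e, ENNReal.coe_mul, hAe]
    exact le_of_eq (by ring))
  have h2 : orliczNorm ψ Set.univ f ≤ orliczNorm ψ Set.univ T := by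
    refine norm_mono hψ ?_
    filter_upwards [hT] with x hx
    by_cases hxQ : x ∈ Q.set
    swap
    · simp [hf, hxQ]
    rw [← NNReal.coe_le_coe, coe_nnnorm, coe_nnnorm]
    simp only [hf, indicator_of_mem hxQ]
    rw [Real.norm_of_nonneg (by positivity), Real.norm_eq_abs, mul_max_of_nonneg _ _ s.coe_nonneg]
    exact max_le (hx hxQ) (by simp)
  have hX0 := chi_ne_zero hψ Q
  have hXt := chi_ne_top hH hl Q
  have h3 : ((s * A : ℝ≥0) : ℝ≥0∞) * orliczNorm ψ Set.univ (cubeIndicator Q) ≤ 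
      ((Λ * (D * s) : ℝ≥0) : ℝ≥0∞) * orliczNorm ψ Set.univ (cubeIndicator Q) := by
    refine h1.trans ?_
    rw [ENNReal.coe_mul Λ, mul_assoc]
    gcongr
    exact h2.trans hTn
  have h4 := (ENNReal.mul_le_mul_iff_left hX0 hXt).1 h3
  have h5 : s * A ≤ Λ * (D * s) := by exact_mod_cast h4
  rw [← hAe]
  norm_cast
  have hs0 : 0 < s := pos_iff_ne_zero.2 hs
  refine le_of_mul_le_mul_left ?_ hs0
  calc s * A ≤ _ := h5
    _ = _ := by ring

lemma bmo_of_avg {b : RSp n → ℝ} (hb : LocallyIntegrable b volume) {K : ℝ≥0}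
    (hK : ∀ Q : Cube n, (volume Q.set)⁻¹ * ∫⁻ y in Q.set, ENNReal.ofReal ((mAv Q b).toReal - b y) ≤ K) :
    IsBMO b := by
  refine ⟨hb, lt_of_le_of_lt (iSup_le fun Q => ?_) (ENNReal.coe_lt_top (r := 2 * K))⟩
  have hv0 := Q.vol_ne_zero
  have hvt := Q.vol_ne_top
  have hi := int_cube hb Q
  set m := cubeAvg Q b with hm
  have hvr : 0 < (volume Q.set).toReal := ENNReal.toReal_pos hv0 hvt
  have hmm : m ≤ (mAv Q b).toReal := by
    rw [hm, cubeAvg, setAverage_eq, mAv, ENNReal.toReal_mul, ENNReal.toReal_inv, Measure.real, smul_eq_mul]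
    gcongr
    rw [← integral_norm_eq_lintegral_enorm hi.1]
    exact integral_mono hi hi.norm fun y => Real.le_norm_self _
  have hi2 : IntegrableOn (fun y => m - b y) Q.set volume :=
      (integrableOn_const Q.vol_ne_top).sub hi
  have hz : ∫ y in Q.set, (m - b y) = 0 := by
    have hci : IntegrableOn (fun _ : RSp n => m) Q.set volume := integrableOn_const Q.vol_ne_top
    rw [integral_sub hci hi, setIntegral_const, hm, cubeAvg, setAverage_eq, smul_eq_mul, smul_eq_mul]
    have : volume.real Q.set ≠ 0 := hvr.ne'
    field_simp
    simp
  have hpm : ∫⁻ y in Q.set, ENNReal.ofReal (m - b y) = ∫⁻ y in Q.set, ENNReal.ofReal (-(m - b y)) := by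
    rw [integral_eq_lintegral_pos_part_sub_lintegral_neg_part hi2, sub_eq_zero] at hz
    refine (ENNReal.toReal_eq_toReal_iff' ?_ ?_).1 hz
    · refine ne_top_of_le_ne_top hi2.2.ne (lintegral_mono fun y => ?_)
      rw [← ofReal_norm]
      exact ENNReal.ofReal_le_ofReal (le_abs_self _)
    · refine ne_top_of_le_ne_top hi2.2.ne (lintegral_mono fun y => ?_)
      rw [← ofReal_norm]
      exact ENNReal.ofReal_le_ofReal (neg_le_abs _)
  have habs : ∫⁻ y in Q.set, (‖b y - m‖₊ : ℝ≥0∞) = 2 * ∫⁻ y in Q.set, ENNReal.ofReal (m - b y) := by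
    rw [two_mul]
    nth_rw 2 [hpm]
    have hmeas : AEMeasurable (fun y => ENNReal.ofReal (m - b y)) (volume.restrict Q.set) := 
      hi2.1.aemeasurable.ennreal_ofReal
    rw [← lintegral_add_left' hmeas]
    refine lintegral_congr fun y => ?_
    rw [← enorm_eq_nnnorm, ← ofReal_norm, Real.norm_eq_abs]
    rcases le_total 0 (m - b y) with h | h
    · rw [ENNReal.ofReal_of_nonpos (p := -(m - b y)) (by linarith), add_zero, abs_sub_comm, abs_of_nonneg h]
    · rw [ENNReal.ofReal_of_nonpos h, zero_add, abs_sub_comm, abs_of_nonpos h]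
  rw [habs, mul_left_comm, ENNReal.coe_mul]
  gcongr
  · simp
  · refine le_trans ?_ (hK Q)
    gcongr

lemma neg_bdd_of_avg (hn : 0 < n) {b : RSp n → ℝ} (hb : LocallyIntegrable b volume) {K : ℝ≥0}
    (hK : ∀ Q : Cube n, (volume Q.set)⁻¹ * ∫⁻ y in Q.set, ENNReal.ofReal ((mAv Q b).toReal - b y) ≤ K) :
    ∀ᵐ x ∂(volume : Measure (RSp n)), max (-(b x)) 0 ≤ K := by
  have hbm := hb.aestronglyMeasurable.aemeasurable
  filter_upwards [lebesgue_diff hn hb] with x hx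
  suffices hmain : ENNReal.ofReal (-(b x)) ≤ K by
    rw [← ENNReal.ofReal_coe_nnreal, ENNReal.ofReal_le_ofReal_iff K.coe_nonneg] at hmain
    exact max_le hmain K.coe_nonneg
  set Q : Cube n := ⟨x, 1, one_pos⟩ with hQdef
  have hQ : x ∈ Q.set := fun i => by simp [hQdef]
  have hr := Q.r_pos
  have hρ : ∀ j : ℕ, 0 < Q.r / (j + 1) := fun j => by positivity
  have hρ' : ∀ j : ℕ, Q.r / (j + 1) ≤ 2 * Q.r := fun j => by
    have : Q.r / (j + 1) ≤ Q.r := div_le_self hr.le (by linarith [Nat.cast_nonneg (α := ℝ) j])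
    linarith
  choose Q' h1 h2 h3 h4 using fun j => exists_subcube Q hQ (hρ j) (hρ' j)
  have hlim : Tendsto (fun j : ℕ => Q.r / ((j : ℝ) + 1)) atTop (nhds 0) := by
    have := (tendsto_one_div_add_atTop_nhds_zero_nat (𝕜 := ℝ)).const_mul Q.r
    simpa [div_eq_mul_inv] using this
  have hv : ∀ j, volume (Q' j).set = ENNReal.ofReal (Q.r / (j + 1)) ^ n := by
    intro j; rw [Cube.vol, h3]; congr 2; ring
  have ht := hx (fun j => (Q' j).set) (fun j => Q.r / (j + 1)) hρ hlim h4 (fun j => (hv j).ge)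
  have ht' := ht.const_add (K : ℝ≥0∞)
  rw [add_zero] at ht'
  refine ge_of_tendsto' ht' fun j => ?_
  have hv0 := (Q' j).vol_ne_zero
  have hvt := (Q' j).vol_ne_top
  have hmeas : AEMeasurable (fun y => ENNReal.ofReal ((mAv (Q' j) b).toReal - b y)) (volume.restrict (Q' j).set) := 
    ((aemeasurable_const.sub hbm).ennreal_ofReal).restrict
  calc ENNReal.ofReal (-(b x)) = (volume (Q' j).set)⁻¹ * ∫⁻ y in (Q' j).set, ENNReal.ofReal (-(b x)) := by
        rw [setLIntegral_const, mul_comm (ENNReal.ofReal (-(b x))), ← mul_assoc, ENNReal.inv_mul_cancel hv0 hvt, one_mul]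
    _ ≤ (volume (Q' j).set)⁻¹ * ∫⁻ y in (Q' j).set, (ENNReal.ofReal ((mAv (Q' j) b).toReal - b y) + ‖b y - b x‖ₑ) := by
        gcongr with y
        rw [← ofReal_norm (b y - b x)]
        refine le_trans ?_ ENNReal.ofReal_add_le
        refine ENNReal.ofReal_le_ofReal ?_
        have e1 := Real.le_norm_self (b y - b x)
        have e2 : 0 ≤ (mAv (Q' j) b).toReal := ENNReal.toReal_nonneg
        linarith
    _ = (volume (Q' j).set)⁻¹ * (∫⁻ y in (Q' j).set, ENNReal.ofReal ((mAv (Q' j) b).toReal - b y)) + 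
          (volume (Q' j).set)⁻¹ * ∫⁻ y in (Q' j).set, ‖b y - b x‖ₑ := by
        rw [lintegral_add_left' hmeas, mul_add]
    _ ≤ _ := by
        gcongr
        exact hK _

end bwd2

lemma abs_sub_comm_aux {n : ℕ} {Q : Cube n} {b : RSp n → ℝ} {x : RSp n} (hx : x ∈ Q.set) :
    |commTestFn0 Q b x| = |(restMaximal Q b x).toReal - b x| := by
  simp only [commTestFn0, indicator_of_mem hx]
  exact abs_sub_comm _ _

/-- under the fractional assumptions, for `b ∈ L¹_loc(ℝⁿ)` the
following are equivalent: (1) `b ∈ BMO(ℝⁿ)` and `b⁻ ∈ L^∞(ℝⁿ)`; (2) the commutator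
`[M_α,b] : L^φ(ℝⁿ) → L^ψ(ℝⁿ)` is bounded; (3) `sup_Q ‖(b − M_Q b)χ_Q‖_ψ/‖χ_Q‖_ψ < ∞`. -/
theorem statement17 {n : ℕ} (hn : 0 < n) (p q α r : ℝ)
    (φ ψ : RSp n → ℝ≥0 → ℝ≥0∞)
    (hp : 1 < p) (hpq : p ≤ q) (hα : α / (n : ℝ) = 1 / p - 1 / q)
    (hφ : IsWeakPhi Set.univ φ) (hψ : IsWeakPhi Set.univ ψ)
    (hinv : FracInvRel α φ ψ)
    (hr₁ : α / (n : ℝ) < r) (hr₂ : r ≤ 1 / p)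
    (ha0 : A0 Set.univ φ) (ha1 : A1 φ) (ha2 : A2 φ)
    (hainc : AInc p Set.univ φ) (hadec : ADec (1 / r) Set.univ φ)
    (b : RSp n → ℝ) (hb : LocallyIntegrable b volume) :
    ((IsBMO b ∧ ∃ M : ℝ, ∀ᵐ x ∂(volume : Measure (RSp n)), max (-(b x)) 0 ≤ M) ↔
      (∃ C : ℝ≥0, ∀ f : RSp n → ℝ, MemOrlicz φ Set.univ f →
        orliczNorm ψ Set.univ (fracMaximalCommutator α b f) ≤
          (C : ℝ≥0∞) * orliczNorm φ Set.univ f)) ∧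
    ((IsBMO b ∧ ∃ M : ℝ, ∀ᵐ x ∂(volume : Measure (RSp n)), max (-(b x)) 0 ≤ M) ↔
      (⨆ Q : Cube n, orliczNorm ψ Set.univ (commTestFn0 Q b) /
        orliczNorm ψ Set.univ (cubeIndicator Q)) < ∞) := by
  obtain ⟨h, C, c, Cl, c', Cl', hh, hG, hl, hl'⟩ := setup hp hpq hα hφ hψ hinv hr₁ hr₂ ha0 ha1 ha2 hainc hadec
  have hp0 : 0 < p := by linarith
  have hq0 : 0 < q := by linarith
  have hγ : 0 ≤ α / n := by
    rw [hα, sub_nonneg]; gcongr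
  have hp1 : 1 / p < 1 := by rw [div_lt_one hp0]; exact hp
  have hγp : α / n < 1 / p := by linarith
  have hγ1 : α / n ≤ 1 := by linarith
  have hbm := hb.aestronglyMeasurable.aemeasurable
  have hH := hG.frac hh (γ := α / n) hr₁.le hγp
  have back : (∃ K : ℝ≥0, ∀ Q : Cube n, (volume Q.set)⁻¹ * ∫⁻ y in Q.set, ENNReal.ofReal ((mAv Q b).toReal - b y) ≤ K) →
      (IsBMO b ∧ ∃ M : ℝ, ∀ᵐ x ∂(volume : Measure (RSp n)), max (-(b x)) 0 ≤ M) := by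
    rintro ⟨K, hK⟩
    exact ⟨bmo_of_avg hb hK, K, neg_bdd_of_avg hn hb hK⟩
  obtain ⟨Λ, hΛ⟩ := avg_bound hn hψ hh hH hl' (by linarith) (by linarith) (by linarith) hb
  refine ⟨⟨?_, fun h2 => back ?_⟩, ⟨?_, fun h3 => back ?_⟩⟩
  · rintro ⟨hB, M, hM⟩
    obtain ⟨Λ', _, hcore⟩ := core hn hγ hh hG hl hl' hr₁ (by linarith) hp1 hγp hB (B := 2 * max M 0 + 1)
      (by linarith [le_max_right M 0])
    refine ⟨Λ', fun f hf => ?_⟩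
    have hfm : AEMeasurable f volume := by simpa using hf.1
    refine hcore f _ hfm ?_
    filter_upwards [hM] with x hx
    exact comm_bound hbm hfm (le_max_right _ _) ((le_max_left _ _).trans (hx.trans (le_max_left _ _)))
  · obtain ⟨C0, hC0⟩ := h2
    obtain ⟨Λ', hΛ'⟩ := phi_psi hγ hh hG hl hl' hr₁.le hγp
    refine ⟨Λ * (C0 * Λ'), fun Q => ?_⟩
    have hv0 := Q.vol_ne_zero
    have hvt := Q.vol_ne_top
    have hv : 0 < (volume Q.set).toNNReal := ENNReal.toNNReal_pos hv0 hvt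
    refine hΛ Q (fracMaximalCommutator α b (cubeIndicator Q)) ((volume Q.set).toNNReal ^ (α / n)) (C0 * Λ') ?_ ?_ ?_
    · exact (NNReal.rpow_pos hv).ne'
    · filter_upwards [fracMaximal_fin hγ hγ1 (hbm.mul (meas_chi Q).aemeasurable) (bchi_int hb Q)] with x hx hxQ
      refine le_trans ?_ (le_abs_self _)
      unfold fracMaximalCommutator
      rw [frac_chi hγ hγ1 Q hxQ]
      have e := ENNReal.toReal_mono hx.ne (frac_bchi (α := α) b Q hxQ)
      rw [ENNReal.toReal_mul] at e
      have e2 : (((volume Q.set).toNNReal ^ (α / n) : ℝ≥0) : ℝ) = (volume Q.set ^ (α / n)).toReal := by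
        rw [← ENNReal.toReal_rpow, NNReal.coe_rpow]; rfl
      rw [e2, mul_sub]
      change _ ≤ (fracMaximal α (fun y => b y * cubeIndicator Q y) x).toReal at e
      linarith
    · have hmem : MemOrlicz φ Set.univ (cubeIndicator Q) := by
        refine ⟨(meas_chi Q).aemeasurable, ?_⟩
        obtain ⟨lam, h1, h2⟩ := chi_modular hG hl Q
        refine ⟨lam⁻¹, by positivity, ?_⟩
        rw [Measure.restrict_univ]
        refine lt_of_le_of_lt (le_trans (le_of_eq ?_) h2) ENNReal.one_lt_top
        refine lintegral_congr fun x => ?_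
        rw [mul_comm, div_eq_mul_inv]
      calc _ ≤ (C0 : ℝ≥0∞) * orliczNorm φ Set.univ (cubeIndicator Q) := hC0 _ hmem
        _ ≤ C0 * (((Λ' * (volume Q.set).toNNReal ^ (α / n) : ℝ≥0) : ℝ≥0∞) * orliczNorm ψ Set.univ (cubeIndicator Q)) := by
            gcongr; exact hΛ' Q
        _ = _ := by rw [← mul_assoc, ← ENNReal.coe_mul, mul_assoc C0]
  · rintro ⟨hB, M, hM⟩
    obtain ⟨Λ', _, hcore⟩ := core (α := 0) hn (by simp) hh hH hl' (by simpa using hl') (by simp; linarith) 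
      (by simp; linarith) (by linarith) (by rw [zero_div]; linarith) hB (B := 2 * max M 0 + 1)
      (by linarith [le_max_right M 0])
    refine lt_of_le_of_lt (iSup_le fun Q => ENNReal.div_le_of_le_mul ?_) (ENNReal.coe_lt_top (r := Λ'))
    refine hcore _ _ (meas_chi Q).aemeasurable ?_
    filter_upwards [hM, le_restMaximal hn hb] with x hx hx2
    exact test_bound hbm (le_max_right _ _) ((le_max_left _ _).trans (hx.trans (le_max_left _ _))) (hx2 Q)
  · set S := ⨆ Q : Cube n, orliczNorm ψ Set.univ (commTestFn0 Q b) /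
        orliczNorm ψ Set.univ (cubeIndicator Q) with hS
    refine ⟨Λ * S.toNNReal, fun Q => ?_⟩
    refine hΛ Q (commTestFn0 Q b) 1 S.toNNReal one_ne_zero ?_ ?_
    · have h0 : (0 : ℝ) / n = 0 := zero_div _
      filter_upwards [fracMaximal_fin (α := 0) h0.ge (h0.le.trans zero_le_one) (hbm.mul (meas_chi Q).aemeasurable) (bchi_int hb Q)] with x hx hxQ
      have e := ENNReal.toReal_mono ((rest_le b Q x).trans_lt hx).ne (rest_ge b Q hxQ)
      rw [NNReal.coe_one, one_mul, abs_sub_comm_aux hxQ]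
      refine le_trans ?_ (le_abs_self _)
      linarith
    · rw [mul_one, ENNReal.coe_toNNReal h3.ne]
      have := le_iSup (fun Q : Cube n => orliczNorm ψ Set.univ (commTestFn0 Q b) /
        orliczNorm ψ Set.univ (cubeIndicator Q)) Q
      exact (ENNReal.div_le_iff (chi_ne_zero hψ Q) (chi_ne_top hH hl' Q)).1 this
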